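/- Let r := √2 − 1. For every FM-tetrahedron T of type 1rrr (radii r_A = 1 and r_B = r_C = r_D = r) and every weighted tetrahedron T₀ with radii (1,r,r,r) and edge lengths dist(A,B) = dist(A,C) = dist(A,D) = 1 + r and dist(B,C) = dist(B,D) = dist(C,D) = 2r (the tight tetrahedron of type 1rrr), one has δ(T) ≤ δ(T₀). -/

import Mathlib

open MeasureTheory Metric

noncomputable def tetra (A B C D : EuclideanSpace ℝ (Fin 3)) :
    Set (EuclideanSpace ℝ (Fin 3)) :=
  convexHull ℝ {A, B, C, D}

noncomputable def density (A B C D : EuclideanSpace ℝ (Fin 3)) (rA rB rC rD : ℝ) : ℝ :=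
  (volume (tetra A B C D ∩
    (closedBall A rA ∪ closedBall B rB ∪ closedBall C rC ∪ closedBall D rD))).toReal /
  (volume (tetra A B C D)).toReal

notation:65 a:65 "⊹" b:66 => Nat.add a b
notation:70 a:70 "⋆" b:71 => Nat.mul a b
notation:65 a:65 "∸" b:66 => Nat.sub a b
notation:70 a:70 "÷" b:71 => Nat.div a b
notation:70 a:70 "℅" b:71 => Nat.mod a b

noncomputable section

/-! ### The certificate checker (natural number arithmetic only) -/

/-- Evaluate the argument before passing it on (helps kernel reduction). -/
def force {β : Type} (x : Nat) (f : Nat → β) : β := @Nat.rec (fun _ => β) (f 0) (fun n _ => f (Nat.succ n)) x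

theorem force_eq {β : Type} (x : Nat) (f : Nat → β) : force x f = f x := by
  cases x <;> rfl

def nite (b : Bool) (x y : Nat) : Nat := @Bool.rec (fun _ => Nat) y x b

def nmax (x y : Nat) : Nat := nite (Nat.ble x y) y x

/-- choice of the evaluation point in an interval -/
def pick (l h n p : Nat) : Nat :=
  nite (Nat.ble (2 ⋆ n) p) l (nite (Nat.ble (2 ⋆ p) n) h ((l ⊹ h) ÷ 2))

/-- error made by moving one coordinate to the chosen point -/
def er (l h n p t : Nat) : Nat := nmax ((h ∸ t) ⋆ n) ((t ∸ l) ⋆ p)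

def coord (l h n p : Nat) (k : Nat → Nat → Nat) : Nat :=
  force n fun n => force p fun p => force (pick l h n p) fun t => force (er l h n p t) fun e => k t e

/-- box of edge lengths, in units of `1/5741` -/
structure Bx where
  (al ah bl bh cl ch xl xh yl yh zl zh : Nat)

/-- products of the multipliers, positive and negative parts, and the constant -/
structure Lm where
  (ap an bp bn cp cn xp xn yp yn zp zn rp rn : Nat)

/-- negative part of a lower bound of the divided difference -/
def gN (kp kq ko Lp Ln el eh fl gl oh : Nat) : Nat :=
  ((kp ⊹ kq) ⋆ (oh ⋆ oh) ⊹ (ko ⋆ oh ⊹ Ln) ⋆ (2 ⋆ eh)) ∸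
    (kp ⋆ (fl ⋆ (2 ⋆ el ⊹ fl)) ⊹ kq ⋆ (gl ⋆ (2 ⋆ el ⊹ gl)) ⊹ Lp ⋆ (2 ⋆ el))

/-- positive part of an upper bound of the divided difference -/
def gP (kp kq ko Lp Ln el eh fh gh ol : Nat) : Nat :=
  (kp ⋆ (fh ⋆ (2 ⋆ eh ⊹ fh)) ⊹ kq ⋆ (gh ⋆ (2 ⋆ eh ⊹ gh)) ⊹ Lp ⋆ (2 ⋆ eh)) ∸
    ((kp ⊹ kq) ⋆ (ol ⋆ ol) ⊹ (ko ⋆ ol ⊹ Ln) ⋆ (2 ⋆ el))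

def d2p (a b c : Nat) : Nat := (a ⊹ b) ⋆ (b ⊹ c) ⋆ (c ⊹ a)
def d2n (a b c x y z : Nat) : Nat := a ⋆ (x ⋆ x) ⊹ b ⋆ (y ⋆ y) ⊹ c ⋆ (z ⋆ z)

/-- lower bound over a box for `∑ k_X D_X + m L` (valid when positive) -/
def lbD (k0 k1 k2 k3 m : Nat) (L : Lm) (B : Bx) : Nat :=
  coord B.al B.ah
    (gN k0 k1 (k2 ⊹ k3) (m ⋆ L.ap) (m ⋆ L.an) B.al B.ah (B.bl ⊹ B.cl) (B.xl ⊹ B.yl) B.zh)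
    (gP k0 k1 (k2 ⊹ k3) (m ⋆ L.ap) (m ⋆ L.an) B.al B.ah (B.bh ⊹ B.ch) (B.xh ⊹ B.yh) B.zl)
    fun a ea =>
  coord B.bl B.bh
    (gN k0 k2 (k1 ⊹ k3) (m ⋆ L.bp) (m ⋆ L.bn) B.bl B.bh (B.al ⊹ B.cl) (B.xl ⊹ B.zl) B.yh)
    (gP k0 k2 (k1 ⊹ k3) (m ⋆ L.bp) (m ⋆ L.bn) B.bl B.bh (B.ah ⊹ B.ch) (B.xh ⊹ B.zh) B.yl)
    fun b eb =>
  coord B.cl B.ch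
    (gN k0 k3 (k1 ⊹ k2) (m ⋆ L.cp) (m ⋆ L.cn) B.cl B.ch (B.al ⊹ B.bl) (B.yl ⊹ B.zl) B.xh)
    (gP k0 k3 (k1 ⊹ k2) (m ⋆ L.cp) (m ⋆ L.cn) B.cl B.ch (B.ah ⊹ B.bh) (B.yh ⊹ B.zh) B.xl)
    fun c ec =>
  coord B.xl B.xh
    (gN k1 k2 (k0 ⊹ k3) (m ⋆ L.xp) (m ⋆ L.xn) B.xl B.xh (B.al ⊹ B.yl) (B.bl ⊹ B.zl) B.ch)
    (gP k1 k2 (k0 ⊹ k3) (m ⋆ L.xp) (m ⋆ L.xn) B.xl B.xh (B.ah ⊹ B.yh) (B.bh ⊹ B.zh) B.cl)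
    fun x ex =>
  coord B.yl B.yh
    (gN k1 k3 (k0 ⊹ k2) (m ⋆ L.yp) (m ⋆ L.yn) B.yl B.yh (B.al ⊹ B.xl) (B.cl ⊹ B.zl) B.bh)
    (gP k1 k3 (k0 ⊹ k2) (m ⋆ L.yp) (m ⋆ L.yn) B.yl B.yh (B.ah ⊹ B.xh) (B.ch ⊹ B.zh) B.bl)
    fun y ey =>
  coord B.zl B.zh
    (gN k2 k3 (k0 ⊹ k1) (m ⋆ L.zp) (m ⋆ L.zn) B.zl B.zh (B.bl ⊹ B.xl) (B.cl ⊹ B.yl) B.ah)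
    (gP k2 k3 (k0 ⊹ k1) (m ⋆ L.zp) (m ⋆ L.zn) B.zl B.zh (B.bh ⊹ B.xh) (B.ch ⊹ B.yh) B.al)
    fun z ez =>
  (k0 ⋆ d2p a b c ⊹ k1 ⋆ d2p a x y ⊹ k2 ⋆ d2p b x z ⊹ k3 ⋆ d2p c y z ⊹
    m ⋆ (L.ap ⋆ (a ⋆ a) ⊹ L.bp ⋆ (b ⋆ b) ⊹ L.cp ⋆ (c ⋆ c) ⊹ L.xp ⋆ (x ⋆ x) ⊹ L.yp ⋆ (y ⋆ y)
      ⊹ L.zp ⋆ (z ⋆ z) ⊹ L.rp)) ∸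
  (k0 ⋆ d2n a b c z y x ⊹ k1 ⋆ d2n a x y z c b ⊹ k2 ⋆ d2n b x z y c a ⊹ k3 ⋆ d2n c y z x b a ⊹
    m ⋆ (L.an ⋆ (a ⋆ a) ⊹ L.bn ⋆ (b ⋆ b) ⊹ L.cn ⋆ (c ⋆ c) ⊹ L.xn ⋆ (x ⋆ x) ⊹ L.yn ⋆ (y ⋆ y)
      ⊹ L.zn ⋆ (z ⋆ z) ⊹ L.rn) ⊹ (ea ⊹ eb ⊹ ec ⊹ ex ⊹ ey ⊹ ez))

/-- negative part of a lower bound for the divided difference of `k W + m L` -/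
def wN (k Lp Ln qh ol oh fl fh gl gh hl hh il ih : Nat) : Nat :=
  force (fl ⊹ gl ⊹ hl ⊹ il) fun sP => force (2 ⋆ qh ⊹ oh) fun sM =>
  (k ⋆ (oh ⋆ (sM ∸ sP) ⊹ nmax ((fh ∸ hl) ⋆ (gh ∸ il)) ((hh ∸ fl) ⋆ (ih ∸ gl))) ⊹ Ln) ∸
  (k ⋆ (ol ⋆ (sP ∸ sM) ⊹ ((fl ∸ hh) ⋆ (il ∸ gh) ⊹ (hl ∸ fh) ⋆ (gl ∸ ih))) ⊹ Lp)

/-- positive part of an upper bound for the divided difference of `k W + m L` -/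
def wP (k Lp Ln ql ol oh fl fh gl gh hl hh il ih : Nat) : Nat :=
  force (fh ⊹ gh ⊹ hh ⊹ ih) fun sP => force (2 ⋆ ql ⊹ ol) fun sM =>
  (k ⋆ (oh ⋆ (sP ∸ sM) ⊹ nmax ((fh ∸ hl) ⋆ (ih ∸ gl)) ((hh ∸ fl) ⋆ (gh ∸ il))) ⊹ Lp) ∸
  (k ⋆ (ol ⋆ (sM ∸ sP) ⊹ ((fl ∸ hh) ⋆ (gl ∸ ih) ⊹ (hl ∸ fh) ⋆ (il ∸ gh))) ⊹ Ln)

/-- lower bound over a box of squared edges for `k W + m L` (valid when positive) -/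
def lbW (k m : Nat) (L : Lm) (B : Bx) : Nat :=
  coord B.al B.ah
    (wN k (m ⋆ L.ap) (m ⋆ L.an) B.ah B.zl B.zh B.bl B.bh B.xl B.xh B.cl B.ch B.yl B.yh)
    (wP k (m ⋆ L.ap) (m ⋆ L.an) B.al B.zl B.zh B.bl B.bh B.xl B.xh B.cl B.ch B.yl B.yh)
    fun a ea =>
  coord B.bl B.bh
    (wN k (m ⋆ L.bp) (m ⋆ L.bn) B.bh B.yl B.yh B.al B.ah B.xl B.xh B.cl B.ch B.zl B.zh)
    (wP k (m ⋆ L.bp) (m ⋆ L.bn) B.bl B.yl B.yh B.al B.ah B.xl B.xh B.cl B.ch B.zl B.zh)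
    fun b eb =>
  coord B.cl B.ch
    (wN k (m ⋆ L.cp) (m ⋆ L.cn) B.ch B.xl B.xh B.al B.ah B.yl B.yh B.bl B.bh B.zl B.zh)
    (wP k (m ⋆ L.cp) (m ⋆ L.cn) B.cl B.xl B.xh B.al B.ah B.yl B.yh B.bl B.bh B.zl B.zh)
    fun c ec =>
  coord B.xl B.xh
    (wN k (m ⋆ L.xp) (m ⋆ L.xn) B.xh B.cl B.ch B.al B.ah B.bl B.bh B.yl B.yh B.zl B.zh)
    (wP k (m ⋆ L.xp) (m ⋆ L.xn) B.xl B.cl B.ch B.al B.ah B.bl B.bh B.yl B.yh B.zl B.zh)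
    fun x ex =>
  coord B.yl B.yh
    (wN k (m ⋆ L.yp) (m ⋆ L.yn) B.yh B.bl B.bh B.al B.ah B.cl B.ch B.xl B.xh B.zl B.zh)
    (wP k (m ⋆ L.yp) (m ⋆ L.yn) B.yl B.bl B.bh B.al B.ah B.cl B.ch B.xl B.xh B.zl B.zh)
    fun y ey =>
  coord B.zl B.zh
    (wN k (m ⋆ L.zp) (m ⋆ L.zn) B.zh B.al B.ah B.bl B.bh B.cl B.ch B.xl B.xh B.yl B.yh)
    (wP k (m ⋆ L.zp) (m ⋆ L.zn) B.zl B.al B.ah B.bl B.bh B.cl B.ch B.xl B.xh B.yl B.yh)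
    fun z ez =>
  (k ⋆ (a ⋆ z ⋆ (b ⊹ y ⊹ c ⊹ x) ⊹ b ⋆ y ⋆ (a ⊹ z ⊹ c ⊹ x) ⊹ c ⋆ x ⋆ (a ⊹ z ⊹ b ⊹ y)) ⊹
    m ⋆ (L.ap ⋆ a ⊹ L.bp ⋆ b ⊹ L.cp ⋆ c ⊹ L.xp ⋆ x ⊹ L.yp ⋆ y ⊹ L.zp ⋆ z ⊹ L.rp)) ∸
  (k ⋆ (a ⋆ z ⋆ (a ⊹ z) ⊹ b ⋆ y ⋆ (b ⊹ y) ⊹ c ⋆ x ⋆ (c ⊹ x) ⊹ a ⋆ b ⋆ x ⊹ a ⋆ c ⋆ y ⊹ b ⋆ c ⋆ z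
      ⊹ x ⋆ y ⋆ z) ⊹
    m ⋆ (L.an ⋆ a ⊹ L.bn ⋆ b ⊹ L.cn ⋆ c ⊹ L.xn ⋆ x ⊹ L.yn ⋆ y ⊹ L.zn ⋆ z ⊹ L.rn)
    ⊹ (ea ⊹ eb ⊹ ec ⊹ ex ⊹ ey ⊹ ez))

def sqBx (B : Bx) (k : Bx → Nat) : Nat :=
  force (B.al ⋆ B.al) fun al => force (B.ah ⋆ B.ah) fun ah =>
  force (B.bl ⋆ B.bl) fun bl => force (B.bh ⋆ B.bh) fun bh =>
  force (B.cl ⋆ B.cl) fun cl => force (B.ch ⋆ B.ch) fun ch =>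
  force (B.xl ⋆ B.xl) fun xl => force (B.xh ⋆ B.xh) fun xh =>
  force (B.yl ⋆ B.yl) fun yl => force (B.yh ⋆ B.yh) fun yh =>
  force (B.zl ⋆ B.zl) fun zl => force (B.zh ⋆ B.zh) fun zh =>
  k ⟨al, ah, bl, bh, cl, ch, xl, xh, yl, yh, zl, zh⟩

/-- decode the multipliers -/
def mkLm {β : Type} (n : Nat) (k : Lm → β) (bad : β) : β :=
  force (n ℅ 512) fun n1 => force (n ÷ 512 ℅ 512) fun n2 => force (n ÷ 262144 ℅ 128) fun n0 =>
  force (n0 ∸ 45) fun ap => force (45 ∸ n0) fun an =>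
  force (n1 ∸ 256) fun bp => force (256 ∸ n1) fun bn =>
  force (n2 ∸ 256) fun cp => force (256 ∸ n2) fun cn =>
  force (621 ∸ (n0 ⊹ n1 ⊹ n2)) fun dp => force ((n0 ⊹ n1 ⊹ n2) ∸ 621) fun dn =>
  @Bool.rec (fun _ => β) bad
  (force (ap ⋆ bp ⊹ an ⋆ bn) fun a0 => force (ap ⋆ bn ⊹ an ⋆ bp) fun a1 =>
  force (ap ⋆ cp ⊹ an ⋆ cn) fun b0 => force (ap ⋆ cn ⊹ an ⋆ cp) fun b1 =>
  force (ap ⋆ dp ⊹ an ⋆ dn) fun c0 => force (ap ⋆ dn ⊹ an ⋆ dp) fun c1 =>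
  force (bp ⋆ cp ⊹ bn ⋆ cn) fun x0 => force (bp ⋆ cn ⊹ bn ⋆ cp) fun x1 =>
  force (bp ⋆ dp ⊹ bn ⋆ dn) fun y0 => force (bp ⋆ dn ⊹ bn ⋆ dp) fun y1 =>
  force (cp ⋆ dp ⊹ cn ⋆ dn) fun z0 => force (cp ⋆ dn ⊹ cn ⋆ dp) fun z1 =>
  force (64 ⋆ (65918162 ⋆ an)) fun rp =>
  force (64 ⋆ (65918162 ⋆ ap ⊹ 22619538 ⋆ (109 ∸ n0))) fun rn =>
  k ⟨a0, a1, b0, b1, c0, c1, x0, x1, y0, y1, z0, z1, rp, rn⟩) (Nat.ble n0 109)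

/-- the support sphere condition fails on the whole box -/
def leafF (n : Nat) (B : Bx) : Bool :=
  mkLm n (fun L => Nat.blt
    (L.an ⋆ (B.ah ⋆ B.ah) ⊹ L.bn ⋆ (B.bh ⋆ B.bh) ⊹ L.cn ⋆ (B.ch ⋆ B.ch) ⊹ L.xn ⋆ (B.xh ⋆ B.xh)
      ⊹ L.yn ⋆ (B.yh ⋆ B.yh) ⊹ L.zn ⋆ (B.zh ⋆ B.zh) ⊹ L.rn)
    (L.ap ⋆ (B.al ⋆ B.al) ⊹ L.bp ⋆ (B.bl ⋆ B.bl) ⊹ L.cp ⋆ (B.cl ⋆ B.cl) ⊹ L.xp ⋆ (B.xl ⋆ B.xl)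
      ⊹ L.yp ⋆ (B.yl ⋆ B.yl) ⊹ L.zp ⋆ (B.zl ⋆ B.zl) ⊹ L.rp)) false

/-- `2 κ 2^64 S^3`, rounded up -/
def kA (w j : Nat) : Nat := w ⋆ (35184372088832 ⋆ 189218084021) ÷ (1024 ⊹ j ⋆ j) ⊹ 1

/-- `2^64` times the constant term of the tangent to `arctan`, rounded up -/
def cA (w j : Nat) : Nat :=
  (w ⋆ 17179869184 ⋆ (j ⋆ (990904320 ⊹ j ⋆ j ⋆ (752640 ⊹ 64 ⋆ (j ⋆ j)))) ÷
    (32 ⋆ (990904320 ⊹ j ⋆ j ⋆ (1075200 ⊹ 225 ⋆ (j ⋆ j)))) ⊹ 1)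
  ∸ w ⋆ 17179869184 ⋆ (32 ⋆ j) ÷ (1024 ⊹ j ⋆ j)

def wA : Nat := 1073741824
def wB : Nat := 76308482

def dlow (k0 k1 k2 k3 m : Nat) (L : Lm) (B : Bx) : Nat := lbD k0 k1 k2 k3 m L B ÷ 8192

def leafN (n : Nat) (B : Bx) : Bool :=
  force (n ℅ 64) fun j0 => force (n ÷ 64 ℅ 64) fun j1 => force (n ÷ 4096 ℅ 64) fun j2 =>
  force (n ÷ 262144 ℅ 64) fun j3 => force (n ÷ 16777216) fun n =>
  force (n ℅ 1024 ⋆ 369566570) fun v => force (n ÷ 1024 ℅ 128 ⋆ 680000) fun mf =>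
  force (n ÷ 131072 ℅ 32 ⋆ 1086301020364561) fun mW => force (n ÷ 4194304) fun n =>
  force (n ℅ 32 ⋆ 5741) fun m0 => force (n ÷ 32 ℅ 32 ⋆ 5741) fun m1 =>
  force (n ÷ 1024 ℅ 32 ⋆ 5741) fun m2 => force (n ÷ 32768 ℅ 32 ⋆ 5741) fun m3 =>
  mkLm (n ÷ 1048576) (fun L =>
    force (cA wA j0 ⊹ cA wB j1 ⊹ cA wB j2 ⊹ cA wB j3) fun c =>
    @Bool.rec (fun _ => Bool) false
    (force (dlow 8192 0 0 0 m0 L B) fun l0 => force (dlow 0 8192 0 0 m1 L B) fun l1 =>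
    force (dlow 0 0 8192 0 m2 L B) fun l2 => force (dlow 0 0 0 8192 m3 L B) fun l3 =>
    @Bool.rec (fun _ => Bool) false
    (force (d2p B.ah B.bh B.ch ∸ d2n B.al B.bl B.cl B.zl B.yl B.xl) fun h0 =>
    force (d2p B.ah B.xh B.yh ∸ d2n B.al B.xl B.yl B.zl B.cl B.bl) fun h1 =>
    force (d2p B.bh B.xh B.zh ∸ d2n B.bl B.xl B.zl B.yl B.cl B.al) fun h2 =>
    force (d2p B.ch B.yh B.zh ∸ d2n B.cl B.yl B.zl B.xl B.bl B.al) fun h3 =>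
    force (kA wA j0) fun A0 => force (kA wB j1) fun A1 => force (kA wB j2) fun A2 =>
    force (kA wB j3) fun A3 =>
    force (A0 ÷ (l0 ⋆ h0)) fun k0 => force (A1 ÷ (l1 ⋆ h1)) fun k1 =>
    force (A2 ÷ (l2 ⋆ h2)) fun k2 => force (A3 ÷ (l3 ⋆ h3)) fun k3 =>
    force (A0 ÷ l0 ⊹ A0 ÷ h0 ⊹ A1 ÷ l1 ⊹ A1 ÷ h1 ⊹ A2 ÷ l2 ⊹ A2 ÷ h2 ⊹ A3 ÷ l3 ⊹ A3 ÷ h3 ⊹ 9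
      ⊹ nite (Nat.ble 1 (j0 ⊹ j1 ⊹ j2 ⊹ j3)) (c ⋆ 189218084021 ÷ v ⊹ 1) 0) fun K =>
    force (lbD k0 k1 k2 k3 mf L B) fun q =>
    Nat.ble 1 q && Nat.ble K (3719335000000000000 ⊹ q))
    (Nat.ble 1 l0 && Nat.ble 1 l1 && Nat.ble 1 l2 && Nat.ble 1 l3))
    (Nat.ble (j0 ⊹ j1 ⊹ j2 ⊹ j3) 0 || (Nat.ble 1 v && Nat.ble (16384 ⋆ (v ⋆ v)) (sqBx B (lbW 4096 mW L))))) false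

/-- certificate trees -/
inductive CT where
  | a (s t : CT) | b (s t : CT) | c (s t : CT) | d (s t : CT) | e (s t : CT) | f (s t : CT)
  | y | z | w (n : Nat) | n (n : Nat)

def leafY (B : Bx) : Bool := Nat.blt B.zh B.xl || Nat.blt B.zh B.yl || Nat.blt B.ch B.bl

def leafZ (B : Bx) : Bool :=
  Nat.ble B.ah 8291 && Nat.ble B.bh 8291 && Nat.ble B.ch 8291 &&
  Nat.ble B.xh 4928 && Nat.ble B.yh 4928 && Nat.ble B.zh 4928

/-- check a certificate tree on a box -/
def CT.chk : CT → Bx → Bool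
  | .a s t, B => force ((B.al ⊹ B.ah) ÷ 2) fun m => s.chk {B with ah := m} && t.chk {B with al := m}
  | .b s t, B => force ((B.bl ⊹ B.bh) ÷ 2) fun m => s.chk {B with bh := m} && t.chk {B with bl := m}
  | .c s t, B => force ((B.cl ⊹ B.ch) ÷ 2) fun m => s.chk {B with ch := m} && t.chk {B with cl := m}
  | .d s t, B => force ((B.xl ⊹ B.xh) ÷ 2) fun m => s.chk {B with xh := m} && t.chk {B with xl := m}
  | .e s t, B => force ((B.yl ⊹ B.yh) ÷ 2) fun m => s.chk {B with yh := m} && t.chk {B with yl := m}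
  | .f s t, B => force ((B.zl ⊹ B.zh) ÷ 2) fun m => s.chk {B with zh := m} && t.chk {B with zl := m}
  | .y, B => leafY B
  | .z, B => leafZ B
  | .w k, B => leafF k B
  | .n k, B => leafN k B

def root : Bx := ⟨8119, 12876, 8119, 12876, 8119, 12876, 4756, 9513, 4756, 9513, 4756, 9513⟩

end

namespace CT

def t0 : CT := (a (f (b (c (d (a (e (b (c (f (a (b (c (d (e (f (a (d (e (b (c (f z (n 6915408707)) (n 6831526723)) (n 6831522627)) (n 6915412803)) (n 6915670851)) (n 6831788803)) (n 7032849219)) (n 7032853251)) (e (n 7033111299) (n 7301284611))) (d (n 6848041795) (n 7083180803))) (d (e (n 6848299907) (n 7083180867)) (n 7100216131))) (b (d (f (n 6848307971) (n 7083184899)) (n 7100224195)) (n 6949225219))) (f (d (n 7099696003) (n 7469052739)) (n 7166800771))) (f (c (n 6797710147) (n 6747120515)) (n 6931661763))) (c (c y (n 6546305987)) (n 6059504643))) (b (c (f (f y (n 7301030659)) (n 7569199939)) (n 6797452099)) (f (n 6260839235) (n 7015809923)))) (f (b (c (e (a (n 6798234307) (n 6748168835)) (n 6932198019)) (n 6059524803))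 (e (n 5926077186) (n 6529540803))) (b (e (n 6260839235) (n 7015817987)) (n 5858444099)))) (c (a (b (e (f (f y (n 7301804803)) (n 7569974083)) (n 7569720003)) (e (n 6798484291) (n 7502869251))) (b (f (n 6798496387) (n 7502873283)) (n 6412874435))) (a (b (n 6613156611) (n 6445642563)) (n 5154067139)))) (d (a (e (b (c (f (n 6075769730) (n 6830740483)) (f (n 5387645890) (n 6260053058))) (f (n 4515484674) (n 5371118786))) (c (n 5438235523) (b (n 6159139714) (n 6343943170)))) (b (c (n 5270471490) (f (n 5219885826) (n 6343951234))) (n 0))) (a (c (n 4649964354) (e (n 3995386818) (n 5589230467))) (n 0)))) (c (c y (b (a (e (n 5271491586) (n 6378533763)) (n 4751405891)) y)) (a (d (e (f (b (n 5102941314) (n 4717323522)) (f (n 5136491842) (n 5538878914))) (n 0)) (n 0)) (d (n 0) (n 0))))) (b (c (a (d (e (b (c (f (n 6763881475) (n 6730060867)) (f (n 6914618435) (n 6864020675))) (f (n 6243783811) (n 6226740483))) (f (n 6025425923) (n 6209971267))) (f (e (n 6025942019) (n 7502345092)) (e (n 6210229315) (n 7535633412)))) (b (c (n 4885099331) (n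 5170049923)) (n 4046234563))) (a (d (f (b (n 5722920067) (n 6075495683)) (b (e (n 6075229571) (n 7232865539)) (e (n 6343661123) (n 7484519811)))) (f (n 5387891779) (n 5639283971))) (f (n 0) (n 3827348611)))) (a (e (d (c (b (f (n 6395036931) (n 6377997763)) y) (f (b (n 6209967682) (c (n 6629394050) (n 6494914370))) (a (b (c (n 7300220675) (n 6846973954)) (c (n 6847232002) (f (n 6763084034) (b (n 7249623426) (c (n 7400618434) (n 7266135426)))))) (b (n 7015012034) (n 6780127170))))) (c (f (n 6227788931) (n 6478918979)) (c (n 5975344579) (n 4565796418)))) (c (f (n 5388407875) (n 5639800067)) (c (n 5270443331) (n 5169518083)))) (c (f (n 0) (n 3828122755)) (f (n 0) (d (n 5153002946) (n 6344447235))))))) (f (b (c (f (b (d (c (a (e (n 6077080130) (n 6831800899)) (e (n 5389480450) (n 6261379586))) (e (n 4516545090) (n 5371933250))) (f y (n 4399874627))) (c (c y (e (n 4937007682) (n 6194782786))) (n 0))) (b (a (n 4650750594) (d (n 3996185154) (n 5590540867))) (n 0))) (b (d (f (e (c (n 5103231618) (n 4717101762)) (e (n 5136536194) y)) (n 0)) (n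 0)) (d (n 0) (n 0)))) (c (c y (e (n 0) (n 0))) (n 0))) (b (c (a (d (n 0) (n 4314936067)) (n 0)) (n 0)) (c (n 0) (n 0)))))
def t1 : CT := (c (f (b (c (b (c (a (n 6293587139) (n 5941265475)) (n 6109037763)) (a (n 804632292886930174087562499) (n 6159369347))) (a (n 6662423939) (n 823975032213787945994065155))) (c (a (n 6662681987) (n 823937253281924988832871683)) (n 6511691267))) (b (c (a (d (e (f (b (c (b (c (a (n 6175614211) (n 6007841987)) (n 6175618307)) (n 6158837059)) (n 6259504515)) (c (n 6259762563) (n 6628599299))) (a (b (c (d (e (f (a (c (b (c (b (f (n 631300192316443480095745347) (b (d (n 631300192320951546488837443) (n 611995010565023380513776963)) (n 612145683570621872436696387))) (n 612107978425730812083725635)) (n 612107978425730829246817603)) (n 631375307458311625440257411)) (n 631413086390174634141574595)) (n 573535320054266458845766979)) (d (n 592802796669952402927146371) (n 611995010565168584767853955))) (n 554267991017182046012859715)) (f (n 631187150668757589124736323) (n 554230212085319088918259011))) (f (b (n 689328410297014597010875843) (n 6293054979)) (d (n 689328410301524896887629315) (n 650718120572150090500171203)))) (c (c y (e (n 650943834937135253459326467)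 (n 689366189228879753481053699))) (f (n 747206029058970148371195459) (n 708896937775840407041107587)))) (b (c (n 631224929605130759727244547) (n 554569115669693028789413251)) (n 554531336735578306073093571)))) (b (c (n 6108509443) (n 6410499395)) (n 6527939971))) (c (b (n 6058439875) (n 6360425795)) (n 6494647683))) (f (n 5370574019) (b (n 592690050170032980038804611) (n 496691127970604203172717827)))) (a (d (e (f (b (n 6611826243) (n 6846707395)) (a (b (c (f (n 747243807990833105516127811) (n 708934716707703381365646979)) (n 786155148583492982173624067)) (c (n 766812335469658881052403459) (n 844070398703356667585914819))) (b (n 651019319009381221659862595) (n 747544932645598138803447491)))) (n 6695712323)) (n 6494385667)) (d (n 882680467067296703533577603) (n 6326613315)))) (c (c y (b (c y (b (a (n 805422477620572997010875971) (n 747544858858621843596408195)) y)) y)) (a (e (d (f (n 6813149059) (b (c (n 844070398703356667502290755) (n 882680467067298886920464387)) (c (n 882680467067298886920464387) (n 882680467067301086061160643)))) (n 6897297219)) (n 6729529091)) (n 882680467067301085004461635))))) (b (f (c (a (n 6829938243) (n 6746314179)) (b (n 6678943554) (n 6863493058))) (c (a (e (d (f (b (n 6829672259) (n 7014479811)) (a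 (b (c (n 844070398703356667502032834) (n 882680467067301154579052611)) (c (n 882680467067301085977012291) (n 882680467067301137583733059))) (n 882680467067296721820481475))) (n 6829930307)) (n 6561498819)) (d (n 786155074792008689040787075) (n 6578275907))) (a (e (d (f (b (c (n 7131662339) (n 7014222018)) (c (n 7232321730) (n 7098108354))) (a (e (b (c (n 979318900985769279528139138) (n 1056162797926034404424055426)) (c (n 1017966526920645537233660546) (n 1075994597331769897415375810))) (c (n 882492531638673735387740483) (n 1017740738777686897706695234))) (c (n 882680467067296687896950978) (n 998623861385267659590891970)))) (c (n 7165212675) (n 6947113155))) (c (n 882304374844620497357145987) (n 882304374844620497222928451))) (b (n 921328388150080357532993346) (n 959976161658909239375333378))))) (c (f (a (n 6964414275) (n 7081854595)) (a (d (e (f (c (n 7165474947) (n 7165475138)) (b (c (n 882680467067301086044121410) (n 1018004379639484754907392578)) (f (n 1017778739070474341303216706) (n 998699345462021694554401410)))) (n 6997702723)) (n 882228816980894582815881219)) (d (n 902023353968107083169036227) (n 6913816323)))) (f (b (d (n 6964152450) (n 7517804355)) (f (n 7232587715) (n 7115143746))) (f (c (b (n 7064549954) (n 1114266278622421721143344002))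 (b (d (n 1133571239017416535838063490) (n 7618463811)) (n 1172331980386955013762874626))) (a (c (b (n 1075543168619814003997436802) (n 1114755486275263095521963266)) (n 1133571239021931130648554754)) (n 1017966674499101760544864514)))))))
def t2 : CT := (b (c (f (e (d (a (c (b (c (b (b (f (n 631112035544914940401046787) (n 457855211948709105311700163)) (n 612032789506043173322118403)) (n 669910408267998759008621955)) (b (n 669910408267998759008621955) (n 708896937780348473467753987))) (c y (e (n 882492236499929823718954819) (n 805008606475192798314780355)))) (b (b (c (n 727825805961817267446769155) (n 786155148588001048533427907)) (d (n 882530015431792780863887171) (n 804970827543329841152812739))) (c (e (n 863187202317958679893399555) (n 862999340671812717361260419)) (n 920989705942554083448871043)))) (b (c (n 592765239103526240578196675) (n 747168545288674952648877507)) (c (n 747130766356811995487425987) (n 766812261687190651650987715)))) (c (b (c (n 650153428851581740073641091) (n 727411565872257969063224579)) (n 765984002878289854953444739)) (b (n 785364668710963173781955971) (n 862622658157678034098611843)))) (d (b (c (b (n 650304544579033568720221315) (n 727524902667846840548353283)) (n 766135118605741683599766915)) (c (n 785440226574689088105375107) (n 862735994953266905583482499))) (b (n 6293320900) (n 688914465360000555293635972))))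 (b (c (d (n 804444257488008109767017666) (n 573121329018560579550598339)) (a (n 882454752715831239014372931) (n 631450791544081671890687299))) (c (a (n 882454752715831239014372931) (n 631375233680355757550490947)) (a (n 824464092306191961732437891) (n 766548842186326008728409731))))) (e (a (c (f (d (b (c (e (n 882492236499929875359229955) (n 862999340671812717310666563)) (e (n 940482896909569032801249538) (n 882304374853783826994591747))) (n 998323031891934100478781891)) (b (n 766849597892687808605742851) (n 882717729490329979338647555))) (d (w 11952352) (n 882717729494983214502271043))) (f (b (d (c (n 978942439846377865566251331) (n 1036932878895083706087664194)) (n 978565978688677075412613123)) (d (n 1095036580952411022243687490) (n 1036594122895784895831107971))) (d (w 11952352) (n 882379194856754026315274819)))) (c (f (b (d (n 786155074801024752789251779) (n 689666797372554524872963651)) (n 959298649665112273661224899)) (n 881664348099032192564352898)) (f (b (d (n 882341932433725235412367426) (n 844107587339411465082009411)) (n 1036631828040680352821569795)) (d (w 11952352) (n 844107587344064614531098819))))) (d (a (b (c (n 862735994958069640824387331) (n 959449544018405910782179395)) (c (n 882041029140040784951928963) (n 1036820427543364235317770755))) (c (f (n 651321033955446450627573379) (n 651321033960033613004171011)) (n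 978754578200377002413815811))) (f (n 804820449676484209798579843) (n 882078365363556702492063555))))) (c (b (b (c y (f (c y (e (d (n 978980292565216929107958658) (n 882717729490334377754519427)) (n 882944403081512120640628483))) (n 882454752715835569062558658))) y) y) (a (b (f (c (d (e (n 1075731546765936313133980738) (n 998963207684743986733672899)) (n 1017289162487279282120321155)) (n 1133270557107053657777793859)) (c (n 882454752715835620468218691) (n 1133910309196707189444599363))) (c (f (n 1133346114970779572101471043) (n 1133948088128570146606566979)) (f (n 1210792187411062809792110082) (n 1250117339629681926583898050)))) (f (b (d (n 1075430643489984836202162691) (n 997908791816030736478660611)) (n 1133308409825892942443211395)) (b (n 1037121405479576933978364547) (n 1114567717452822348934962434))))))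
def t3 : CT := (a (f (b (e (d t1 (c (c (b (f (n 7367590980) (n 650153428842559096435537028)) (n 6243513603)) (b (n 6125815043) (n 6511687043))) (b (c (n 6477874563) (n 6595057219)) (c (n 6947898947) (n 1036594122877752904397915907))))) (d (c (b (c (f (n 7367332932) (n 650304544570010925082117252)) (n 6242997507)) (c (n 6125815043) (n 6511428995))) (b (c (n 6309848451) (n 6662170115)) (c (n 6729537091) (n 6913824515)))) (c (n 5639275652) (n 6024893827)))) (c (b (c y (b (c y (f (n 7233111555) (f (n 7014476162) (c y (e (n 1036933321607784673595382530) (n 882041029126224221073864323)))))) y)) y) (f (b (c (f (n 6947633282) (b (n 7148960130) (d (n 7165733442) (n 8541730435)))) (e (d (f (c (n 7434176578) (n 7182252802)) (c (b (n 7383579458) (n 7333244098)) (b (n 1210754113322272081279483074) (n 1229946401008968277677076034)))) (n 7585167235)) (n 7820056323))) (c (b (c y (f (n 7400614722) (e (n 7299689666) (n 8675952451)))) y) (d (e (a (f (b (c (n 7383841282) (n 1268744847518887619358912002)) (c (n 1268820405382613533682331138) (n 1307355284822225907543994306))) (b (n 1249628191491911826275855938) (n 1268820405387128128425975746))) (n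 1191449374292709750408510082)) (n 7752943747)) (n 7551875011)))) (b (c (d (e (f (b (c (n 7148694146) (n 1114304057554286877345344386)) (c (n 1114341836486149834507053954) (n 1153102651642666806276549890))) (b (c (a (n 1056727489655618664131746690) (n 882680467067296688249530435)) (n 1114304057558799272931253506)) (d (n 1094735751458923377371405570) (n 1075656210258481701218445699)))) (n 7618459523)) (n 7501281027)) (e (d (f (f (b (c (n 7265873154) (n 1210942343903310410341969602)) (n 1191486931868158418016825026)) (n 1152838863211424356687441410)) (d (n 1153027019996472663172476034) (n 1133684206882638528027060994))) (n 1114002711543096559355590851)) (n 1094359364079315017182771651))) (c (c y (b (a (n 1191524710800021375111683778) (n 1153554227933083218040351682)) y)) (d (e (d (n 1230210189453741368091635458) (n 1210641514405468750392880258)) (n 1171881141970822742178036291)) (n 1171730026243370913514678595))))))) t2) (f (e (d (b (c (f (b (n 650266691851171670213559299) (n 785327037344030178580399235)) (b (c (n 650266691855673084690300928) (n 0)) (c (n 0) (n 689667166305186396596106563)))) (f (n 4263286147) (c (b (n 709009979419018264300782915) (n 844070324916382570529715715)) (b (n 863413211817190732753835522) (n 882680467067298885527963394))))) (c (b (c y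 (n 844070324916380370416465347)) y) (f (b (n 6041929410) (n 6377469890)) (b (c (n 882680467067298885763102466) (n 1037309413825959463078099202)) (c (n 1037347192753318820612696322) (n 1134136152107929816241039810)))))) (c (b (n 0) (n 0)) (b (n 3105658179) (c (n 5605979715) (n 6142588675))))) (b (c (n 0) (n 0)) (c (n 0) (c (n 5656053187) (n 5773235843))))) (b (c (e (c (b (n 882680467071941087036702720) (n 882680467071941069856833536)) (b (n 573572951421320410576191488) (n 882680467071941087036702720))) (d (n 650492775155825629458333696) (n 552800220485142881180319744))) (f (e (d (b (c (n 785816466371460768862594434) (n 863413211821705344106657410)) (c (n 844070324920894965662639746) (n 882680467071813497451210690))) (c (n 573911412272439031236162947) (n 786230042364432207217981059))) (d (n 882041029139732915638239232) (n 727637722945579054993540419))) (b (n 766624252476086236307521536) (n 863111939601984006666584064)))) (c (b (b (c y (n 882680467071800349548347392)) y) y) (a (b (c (n 978716873069001087181678531) (n 1056087830376432175345330435)) (f (n 1094547520882404040059152707) (n 1075806902291806175987260098))) (n 1017402425509385195418025984))))))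
def t4 : CT := (d (e (f (e t0 (b (f (f y (e (f y (a (c (b (n 6579348163) (n 6999036675)) (n 4867556163)) (c (n 5489099331) (n 5555696259)))) y)) (a (c (c (e (a (n 6243529604) (n 6294127364)) (n 4565816068)) (n 0)) (d (n 0) (n 2485183364))) (c (n 0) (n 0)))) (a (f (f y (c (n 0) (n 0))) (c (n 0) (n 0))) (c (f (n 0) (n 0)) (n 0))))) (e (a t3 (f (b (c (f (n 0) (n 0)) (f (n 0) (n 882680467067296681201500160))) (c (f (n 0) (n 882680467067296681201500160)) (f (n 0) (c (n 882680467067296681201500160) (a (n 940595717187164802528347651) (n 824840553445726394985252098)))))) (a (b (c (n 438324375347430137668829184) (n 804858007261065518210088960)) (c (n 804820228329202561048379392) (n 978679241711064343897964544))) (b (n 380710397451705657564594176) (n 824200746588063941756190720))))) (f (a (b (c (b (f (n 6176158596) (n 5907456964)) (n 0)) (b (n 0) (n 0))) (d (c (b (n 0) y) (f (n 3625756035) (a (n 6376953539) (n 7048308163)))) (n 0))) (b (n 0) (n 0))) (a (b (c (a (d (e (b (f (n 534624791122849442500740292) (n 534624791127509206836737284)) (f (n 688990097010702764371117444) (n 688990097019866094041851332)))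 (b (n 380372526882679812628190340) (n 592615525319464980462470404))) (f (n 7249626245) (n 611317941275331451470509253))) (n 650003567502990749070262272)) (d (e (a (f (b (n 785628752290099773532575236) (n 862020777783027243177772739)) (n 882191775946121902738933507)) (n 0)) (n 882342522720369921843265536)) (a (n 862133671875333505406730240) (n 3994588356)))) (c (b (c y (a (n 883208265308735863285905155) (n 632204230352257437249864964))) y) (b (f (a (n 882191775927799574334834372) (n 882191775927801773660083588)) (n 997683593982410879458117316)) (f (n 1075694727064606806480808259) (n 1055749590894847152843421635))))) (b (n 534361297830639107437494272) (n 823749391653786924290670592)))))) (f (f y (e (f y (e (a (b (n 0) (n 0)) (n 0)) y)) y)) (a (b (c (e (f (n 0) (a (n 552800220485142881180319744) (n 3877151621))) (f (b (n 687445809384670314742415360) (n 726055951535588832724968069)) (n 552800220485142881180319744))) (e (n 0) (n 726696865211263581044080640))) (c (f (n 0) (n 746039456964309500813115392)) (f (n 0) (n 881890798851492922343292928)))) (f (c (e (n 0) (n 0)) (e (n 0) (n 0))) (n 880986687023352445428301824))))) (f (e (c (e (f (f y (d (f y (a (b (c (n 6580380355) (n 6999552771)) (n 4869620547)) (b (n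 5490389571) (n 5558276739)))) y)) (a (b (b (f (c (n 6244831940) (n 6294643460)) (n 4566586180)) (n 0)) (e (n 0) (n 2486731652))) (b (n 0) (n 0)))) (f (f y (a (b (n 0) (n 0)) (n 0))) (a (n 0) (n 0)))) (e (a (f (f y (b (n 0) (n 0))) (b (n 0) (n 0))) (b (f (n 0) (n 0)) (n 0))) (a (b (f (n 0) (n 3626287876)) (n 0)) (f (n 0) (n 0))))) (f y (e (f y (b (n 0) (n 0))) y))) (f (e (a (e (c (b (c (f (n 6176932740) (n 5908231108)) (n 0)) (c y (n 0))) (e (b (c (n 0) (n 0)) (f (n 3626530179) (a (n 6377727683) (n 7049082307)))) (n 0))) (b (n 0) (n 0))) (c (n 0) (n 0))) (e (a (n 0) (n 0)) (b (n 648835888595243635105071104) (n 725377037566418547533414400)))) (e (a (e (c (b (a (e (d (c (f (n 534322559667945785207579844) (n 534322559672605549510022404)) (f (n 688801202351387978563085700) (n 688801202360551308233561540))) (c (n 379805842904735455203579012) (n 592237736000835408845890820))) (f (n 7249884293) (n 611242383411605537147348165))) (n 649814672843675963261714432)) (b (c y (a (n 882754918126380377245246980) (n 612407848695139000150942980)))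 y)) (b (a (f (c (n 6830192004) (n 6997702403)) (c (n 824012220863357973771871748) (n 881965102345637876943316676))) (n 862283975940979524072636416)) (c (f (a (n 881965102336621831365093060) (n 881965102336624030690600324)) (n 997570257186822007939950276)) (f (n 1075316937745977234863712579) (n 1055560696235532367001577411))))) (b (c (n 0) (n 0)) (c (n 0) (n 861982998851725033188918660)))) (b (n 882754918126378172951822336) (n 804293094170411430693568512))) (b (n 707128042590023690320084992) (n 0))))))
def t5 : CT := (f (e (a (a (e (b (f (c (d (a (b (n 4414043074) (n 4984464450)) (n 4951180226)) (n 4061979522)) (d (c (a (e (f (b (d (n 3742688129) (n 3423921025)) (n 4162114561)) (n 4262777922)) (n 4212454338)) (n 4044948418)) (a (e (b (d (f (d (a (c (e (f (b (e (n 3238839041) (n 3457209153)) (n 3608204161)) (n 3658535809)) (n 3641762689)) (f (e (b (n 1961534826300124283066430145) (n 1826588998120165834033513281)) (n 1787715288889922209310364417)) (n 1961534826225814786253308801))) (c (n 3574653825) (f (n 1826400546182708851563877121) (n 3373323073)))) (c (e (n 3071062721) (n 3524322113)) (f (e (n 1903506903467456043351327489) (n 1768410402281903637679624961)) (n 1865236697842018420685587265))))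 (c (n 3926971393) (e (n 1826626850839005086167909313) (n 3675313089)))) (f (d (e (n 1864934835394053865611510529) (n 2551235265)) (n 1903469050674307362855109377)) (n 2836448193))) (c (n 3541357569) (f (d (n 1845856179583297691751334849) (n 2752562049)) (n 3490759745)))) (d (b (c (n 3926983553) (f (f y (n 3675321153)) (n 4161860545))) (n 4061459457)) (f (n 2752570049) (n 3944014785)))) (e (d (f (c (n 3793023873) (b (n 1845441422989544406192812801) (n 3927237505))) (n 4044682241)) (n 2769343169)) (n 3675587457)))) (a (e (c (n 2736046977) (f (n 1980651039535443003463172096) (n 0))) (n 0)) (n 0)))) (c (n 5034796162) (d (b (f (d (e (n 4011123842) (n 4816438338)) (n 3826574402)) (n 4430554306)) (a (n 4346664258) (n 5068088514))) (e (n 3172254850) (n 4195669058))))) (c (f (n 4800173122) (n 5622252866)) (f (d (b (f (e (n 3524580417) (n 4363711490)) (n 4128822402)) (n 3961046273)) (n 2769597441)) (d (f (n 4665689474) (n 5118674434)) (n 4229477698))))) (b (f (f y (c (n 5856895874) (n 3793036162))) (n 4414047234)) (f (n 3877176322) (n 5286454466)))) (b (f (c (e (n 4800189250) (n 5622289154))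 (e (d (a (e (f (n 3524596545) (n 4363715522)) (n 4128842562)) (n 3961078529)) (n 2769617601)) (f y (n 4900606722)))) (e (n 3877176322) (n 5286474626))) (e (f (n 3390895042) (n 4984726658)) (n 3978105794)))) (b (f (b (c (e (a (n 5421224642) (n 5639340674)) (a (n 6008181378) (n 6193009218))) (a (e (a (d (n 4581843714) (n 4246291138)) (n 4346966722)) (f y (n 5521384130))) (e (d (a (n 5051622017) (e (n 5353878145) (n 5639115329))) (n 4615672386)) (f y (n 5873726018))))) (e (a (n 4011672322) (n 4028723906)) (f y (n 4531786434)))) (a (e (n 3877446530) (n 5219640066)) (e (n 3541914370) (n 4984767170)))) (e (f (n 0) (n 0)) (a (n 3928048450) (n 3139527426))))) (f y (f y (e (a (n 3692639170) (n 4162683650)) y)))) (a (e (a (e (c (f (b (n 5789762946) (n 6092011074)) (b (c (n 6645397058) (n 6276036354)) (b (n 6578284290) (n 6611835074)))) (f (b (d (f (a (n 4933862850) (n 5638509890)) (b (n 5370070530) (n 5655283330))) (n 4430546242)) (f (b (n 5252625922) (n 5504280514)) (b (n 5604943874) (b (n 5923707074) (n 6007593282))))) (b (a (e (d (f (b (n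 5738903362) (n 5940488258)) (c (n 6460581954) (b (f (n 6040889346) (b (n 6107994498) (n 6175103490))) (f (n 6191880642) (b (n 6242212546) (n 1384197337079063198498327362)))))) (d (n 5403617154) (n 5487503106))) (n 5856605954)) (n 5571393154)) (a (e (d (c (f (n 6494132482) (b (n 6729013698) (n 1326320308612913608485276546))) (b (f (e (n 1384046737860441035487877506) (n 6578018498)) (b (n 1403577707763831337923939138) (n 1422995857380462434611923970))) (f (n 1403464666116147645724527298) (n 1403464666120655746678950850)))) (b (n 5940484162) (n 1306789264927057207354493250))) (d (n 6309587138) (n 6628353986))) (b (n 6242477954) (n 6276032706)))))) (f (n 4128830658) (c (n 6645401027) (n 5588174402)))) (e (f (f (n 4682736834) (n 4749579586)) (c (n 6142084546) (n 5387109890))) (n 0))) (e (c (n 4212720771) (n 0)) (n 0))) (e (f (n 0) (n 0)) (a (n 0) (f (n 4112351938) (n 5454254915))))))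
def t6 : CT := (b t5 (f (a (e (a (e (a (c (f (b (n 5421184322) (n 5639284226)) (b (n 6008120898) (n 6192928578))) (b (f (b (d (n 4581803394) (n 4246254850)) (n 4346918338)) (f (d (n 5236106946) (n 5353547266)) (b (n 5521319618) (n 5672310914)))) (f (d (b (n 5051557505) (f (n 5353809601) (n 5639018561))) (n 4615607874)) (c (b (n 6226220930) (n 6209177921)) (b (f (n 5638756226) (n 1442075177201943235639151105)) (f (d (n 1461417990315777302417934849) (n 6108514242)) (n 1480911402648229134059473793))))))) (f (b (n 4011640066) (n 4028675522)) (b (n 4816942594) (b (n 5722908290) (n 5622503170))))) (b (f (n 3877430402) (n 5219599746)) (f (n 3541878082) (n 4984714754)))) (f (e (n 0) (n 0)) (b (n 3928020226) (n 3139487106)))) (e (n 0) y)) (e (n 0) (e (n 0) y))) (a (e (c (f (b (f (n 6092010946) (n 6192404610)) (a (f (e (n 6528207170) (n 7669065346)) (b (n 6712756802) (c (n 6914079618) (n 6746045634)))) (n 6864021058))) (b (a (f (b (n 6880266626) (n 6762826370)) (c (e (n 7098370754) (n 8407000899)) (b (n 6930336706) (e (n 1326508981911299509997305154) (n 8457328642)))))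 (n 6897313346)) (a (e (a (e (d (a (e (d (c (b (n 7199030594) (n 1345890090470334197516496642)) (b (n 1365345133570611329614773954) (n 1365119493001616480804302786))) (n 1326358751632069155280682370)) (b (n 1287824093557897924617731138) (n 1326660245217207527981743554))) (b (n 1268518911801974225223842690) (n 1326660171430231233076428034))) (d (n 1268368238796382364428172162) (n 7299955394))) (d (n 1268443870447082477712870146) (n 7719389634))) (d (n 1249100909759295718128650754) (n 7534840066))) (n 7148968002)) (n 6964418370)))) (a (f (b (c (b (n 6209181890) (f (n 6561507074) (n 6561237762))) (b (f (n 5772712258) (f (n 6158584450) (n 1422769921659043241809709954))) (f (f (n 6024366657) (n 1422657027585312139269933826)) (d (n 1461568441960446875852377090) (n 6444066754))))) (e (a (e (d (c (a (b (f (n 6678940290) (n 1384198222522774338846100610)) (c (n 1442527712727563928633637954) (n 1500593340705118675801767170))) (n 1364930893490193490995874498)) (f (b (n 1480911328861257237536213953) (n 1461531253328902275170860417)) (n 1461568737117368102210010498))) (b (n 1364817778055533503605934530) (n 1403616224569960842894277314))) (d (n 1345550744166356537835031106) (n 6712494338))) (d (n 1326207857265543891161487682) (n 6544988226))) (n 6829942722)))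 (e (b (a (e (d (c (b (f (n 6745787010) (n 1345587859015430539937352962)) (c (n 1403917127854783264799886402) (n 1461982755832342392767544706))) (f (n 1442300965353917939702860802) (n 1442300965358425834649845314))) (n 1326245045901596575382407874)) (b (n 1306940380654506837548505474) (n 1345738900955906073611766402))) (n 1287635051324630548025481602)) (f (c (d (n 1423222457189171880569110210) (n 1306752297656434894805957698)) (n 1500404519837288182270164929)) (c (n 1423222457189171880686550978) (n 1403653855932388004783750594)))) (b (n 6846719938) (n 1287409705903529712458176834)))) (f (e (n 4884047554) (n 6863766978)) (b (n 6427293442) (n 1268104524147619206734325762))))) (b (n 0) (e (n 4112299522) (n 5454222659)))) (b (n 0) (e (n 0) (n 0))))))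
def t7 : CT := (f (c (b (d (d (a (e (c (f (b (c (d (d (n 2038603773513580598031860481) (n 2057870881189736126400480001)) (n 2096405096542047200384692929)) (n 1691379576158209179078140545)) (n 1904034996856798303474201409)) (b (e (n 2019676012141404910466675585) (n 1749595904066963866961888129)) (n 1749671314284675182579725313))) (n 1633917452436239684395893377)) (b (f (f y (n 1980575924467888653272400577)) (n 1942230382413963429092840257)) (f (n 1672300947345116445222425409) (n 1576040524106206759376442305)))) (b (f (e (c (n 1941890593388125716382274241) (n 1749068078917944015306920449)) (n 2018846572740874634020057729)) (e (n 1653033544521055720220447553) (n 1671961601041136433341985601))) (f (n 1845554612285490132956537601) (n 1576002597600391246830953409)))) (a (e (b (a (c (n 1961949822701550525959934657) (w 24494288)) (e (n 1807472858746132746457350721) (n 1710948573279992753578353281))) (f (n 1981141280280259702855340673) (n 1769126873970349719258178433))) (f (e (n 1922925422091030639684661889) y) (n 1691605833953134964776944449))) (b (f (e (n 1922849569009589319663133249) (n 1710533669112286827525235329)) (n 1691605686379182374865654529)) (n 1787790699328309937571889152)))) (a (e (n 2077741566331979064540135424) (f (n 2019336665837420530905382912) (n 1749520715138110558878826496)))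 (f (n 2038603625939623504024436736) (n 1749482714845318734382366720)))) (d (a (e (d (f (b (n 1903921512487256756262314945) (n 1653523858978534920404640897)) (b (n 1749822061149303148186215553) (n 1634482982171699366211921217))) (f (n 1981216690570033027586495425) (n 1672791040441666760573232257))) (c (n 1672225315545790999191147649) (f (n 1923189210459222643839906753) (n 1595797946100229899312477185)))) (c (e (n 2870002625) (n 3944014913)) (f (n 1807246406443821896538571713) (n 1691794433464544520783840321)))) (f (e (n 1846233231108721141574795264) (n 0)) (e (n 1711400887444671279015133184) (n 0))))) (b (n 1652883140332218342950567936) (n 1518125836798081730418311168))) (c (b (d (a (e (f (b (c (d (n 1884805668040448018490373185) (n 1749897545081941908653913089)) (n 1633993009147034921169621825)) (c (n 1730592584686942747972646081) (n 1576229049853162862532138049))) (b (c (f (d (n 1653523858834419681342829761) (n 3071325313)) (n 1653523858834419715836785921)) (n 1750538680272090282867856449)) (f (d (n 1595759945947049749969413441) (n 1595797724878912603716363521)) (n 1692246895203184520658462081)))) (f (b (n 1672376578995818637254513601) (n 1576040524106206725369021569)) (b (n 1556773268856102988039636097) (n 1460550329261535093758936321)))) (b (c (n 1653033544372432466288366529)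 (f (n 1884504174529616668785431425) (n 1537769949480585519579321409))) (e (n 1576002597600391195677213889) (n 3507545217)))) (e (f (a (n 1807774647479169819183415296) (n 0)) (c (n 1672866598161277435046040577) (n 1673168313120849079998349312))) (n 1633842142282569845131182080))) (d (c (a (e (f (b (n 1595797724734793035008746881) (n 1557338698311326332789761537)) (b (n 1595797724734793052775818817) (d (n 1518729072669237519469029185) (n 4782597825)))) (n 4598318530)) (n 4447323521)) (a (b (e (n 1750538680272090283253732737) (n 1595797946100229900302595393)) (n 1673168460690307059381478977)) (n 1634482834453627121844667777))) (c (f (n 2970653825) (n 3843339650)) (f (n 1595797872322252107577032704) (n 1595797872322265202161657153))))) (b (b (n 1556660348451219265091010560) (n 1498896434266813001745039360)) (a (n 1576455548363839291674620993) (n 1479742368236933756198322176)))))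
def t8 : CT := (a (e (a (d t7 (d (b (c (e (a (n 1750010808234660942965637120) (n 1556848605358886854728876032)) (n 1903695798198824021979561984)) (n 1556735758740992366399717376)) (f (n 1595797724883407472361996288) (n 1595797724883407472361996288))) (f y (n 1595797724883407438002257920)))) (d (b (f (c (d (b (f (c (a (e (n 1903016589009976843620643521) (n 1652317220550681780282270401)) (e (n 1652279367831842545294451393) (n 1594365003155687732738609793))) (d (c (e (n 2057191976517121324597707393) (n 1652016022545791935008813697)) (n 1632861781607942600872755777)) (n 1748087846133671712417382400))) (c (n 1671923674386697700603142977) (e (n 1903658092984135949587641025) (n 1594252035439099920945840833)))) (c (f (n 2870014721) (n 3944027009)) (e (n 1806907060209647729851298561) (n 1594968137904429754689327873)))) (a (f (n 1768372771072607708302540800) (n 0)) (f (n 1768033498555604025049350144) (n 0)))) (n 1517560260741674503153647616)) (d (b (a (c (n 1537091035651308301606515649) (n 1498632572002163636476625665)) (n 1672037158904853616666869760)) (c (n 3256153153) (n 1595797872466367261293150208))) (n 1595005843049307703462592512))) (f (d (e (f (n 1826287061887472417311293440) (n 1479327122768433136202153984)) (n 1633427090540911380219822080)) (n 1440868170131942711222075392))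 (c (d (n 3625247937) (n 3457471618)) (n 1595797872466367244113281024)))) (f (b (n 1690437195966683723774033920) (n 1324850472481969588521664512)) (n 1440905949063805616844177408)))) (d (a (b (f (f y (e (f y (c (b (d (n 1594930654120471976712667969) (n 0)) (n 0)) (n 1575550478465528243262362113))) y)) (d (b (a (e (c (n 1575852219742706696060990401) (n 1556660496025189210143634177)) (n 1730027597953563958196568064)) (c (n 3541115842) (n 1671396614595996869834109697))) (c (n 3457221698) (n 1846573462865432638862975937))) (n 1730102934456360988005367808))) (f (f y (b (c (n 0) (n 1615140906941130212603068416)) (n 1595119179844896523408113664))) (c (d (n 4229227778) (n 3725907074)) (d (n 1615140906941130281322545152) (n 1383029363468137015550148608))))) (c (b (f (f y (f y (e (n 1498217695351438050371908353) y))) (d (n 4229251970) (n 3725927234))) (d (n 3725927426) (n 3306492866))) (c (f (f y (n 1574984780766851336947892224)) (b (n 1690550532901884252427124736) (n 3742696449))) (n 1613746010975105517596180480)))) (b (f (f y (e (n 1478724061811175372001116160) y)) (n 1652883092876381711643967488)) (f (n 1460135572956003419010629632) (n 1324850472481969588521664512))))) (a (d (c (b (f (e (d (b (c (f (e (a (n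 1594364929368711454996648577) (n 1594138624712415169507328641)) (a (n 1555679745862901073758749313) (n 1574758549175552209820435009))) (n 4380254913)) (a (f (n 1652016022550295637648298561) (n 1536639164348094647972745921)) (f (n 1652016022550295501064999489) (n 1459607922279520597384987265)))) (c (n 4195701505) (n 1575135453050470692075950785))) (c (b (n 1709967796642458510625415745) (n 3893965505)) (f (n 1652016022545783135559221248) (n 0)))) (f y (f y (e (n 4044718785) y)))) (e (d (n 4044702593) (n 3541377858)) (n 4195709698))) (e (f (n 0) (n 4598596610)) (n 3659100929))) (e (d (f (b (n 1690550560722026577117839360) (n 1478837399759685799632699392)) (b (n 1613670406709385267590987776) (n 0))) (n 1594252035727321635305291776)) (d (f (b (n 1690550560722053019974091265) (n 1478837399759703292800758465)) (b (n 1613670406709398276460872449) (n 4497691585))) (n 1594252035727321686844899328)))) (b (f (f y (n 1613481511761839968191774720)) (n 1421111190720165648854417408)) (n 1420997853924576777369288704))) (e (d (b (f (c (c (d (b (f (a (e (e (n 1574758549175552209736540737) (n 1574720991604618137274008129)) (c (n 5269480001) (n 1555378252421880089129906753))) (e (c (n 5068161537) (f (n 1593875058065440073508581889) (n 5118485057)))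 (c (n 1574532687385224500938691073) (n 1536149145326746795936985601)))) (n 4900635265)) (n 4816740993)) (e (n 1574796032959509987109466753) (n 1555415809848694437846819393))) (d (f (a (n 1651827275316314706460127809) (n 1632598168077066173567857217)) (e (n 1536450564836680644208988801) (n 1517221236092392437007376961))) (a (n 1594214183008491045903495745) (n 1574834107471628086149489217)))) (b (n 1575098164264812190865662401) (n 1575098163686926470905692737))) (c (d (n 4279862017) (n 4598620930)) (a (n 1613670406709402673936945857) (n 1613670332922422015697453761)))) (f (c (n 3189596929) (n 1594214256799962174691737600)) (n 0))) (f (f y (n 1478724061811175389180985344)) (n 1401768672889344750233059328))) (d (c (b (f (f y (c (f y (n 5336851074)) (n 1516919595509759941893554753))) (e (n 5001290434) (n 5336601218))) (n 1382124366046256989635986049)) (c (f (b (n 1690475371793199681676390913) (n 1478837399174235856773165697)) (b (n 1478875547617436127087415937) (n 5974360898))) (f (n 1440340714309600938721017856) (n 1555755525809561177605644993)))) (c (f (f y (b (n 1382350818420627632398373378) (n 5756506754))) (n 3860681410)) (n 1594252035727321566585815040))))))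
def t9 : CT := (d (b (c (a (e (d (f (a (c (e (f (b (n 1595759945802930060466103617) (n 1576681511425160399383991809)) (b (n 1557112541228982653603325441) (n 1557527445396688580713420481))) (n 4380210561)) (b (e (n 1750538680272090334407726401) (n 1595797946100229900118046017)) (e (n 1750538680272090249246578241) (n 1595797946100229900621358593)))) (c (n 4195665217) (n 1576228902112572311009015105))) (a (c (e (b (f (n 1557527445396688529274480385) (n 1538373158011791442896525313)) (f (n 1557716044912599639732295617) (n 1557904496850058787251591425))) (n 5269399362)) (f (n 1653938910585085569400870657) (n 1634822623492980067034765377))) (f (n 1441471599735855855462299201) (n 1441622494102378800181716801)))) (f (c (a (n 1711287476713491691947988097) (n 3893933249)) (e (n 1673168313120849131537956864) (n 0))) (c (f (n 4195657217) (n 1538260190151083976547411650)) (n 1576530617072157341999470145)))) (f (d (n 4044678401) (n 3541357698)) (n 4195665346))) (f (e (n 0) (n 4598596610)) (n 3659056577))) (f (d (e (f (n 1731196162235502428411658240) (n 1731196162235502428411658240)) (a (n 1615140906941130332862152704) (n 0))) (n 1595797946109228436774977536)) (e (c (e (a (n 1557112661463028863100552897) (n 1421714399255905942791042497)) (a (n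 1479742322120099620432418369) (n 4145333633))) (n 1441057110945554128084926464)) (b (n 1673357133988683971341320192) (n 1673583586218932829796958208))))) (a (e (d (a (c (f (c (e (b (f (f (n 1576794774433772976400012929) (n 1557527445396688529291253505)) (c (n 5269395329) (n 1557489740256310002349021121))) (f (c (n 5068064769) (n 1673734185433051414974994305)) (c (n 1577247383750864716495620417) (n 1577059005609395591637665985)))) (n 4900562689)) (b (e (n 1750538680272090387088181057) (n 1595948988040705434698688193)) (e (n 1731535803758046502706251841) (n 1576832700953103720737183617)))) (c (b (c (e (n 1596740796087822381164562753) (n 6309582914)) (n 1693453902421799550108080385)) (f (n 1596778575019687502989789889) (n 1499990205969900663062432449))) (n 1635124504455247259470432769))) (f (n 1576455548363839258976089857) (n 1557188293113731073033665153))) (f (c (c (n 4816676481) (n 1518653736170952919203751553)) (n 1479742368236950956771677825)) (c (f (n 1461116201582735811209897921) (n 1461266874592837868870473921)) (n 1460512891918714369398049025)))) (a (c (f (c (b (n 4061697537) (n 1557753897631440987173197505)) (n 1653901205440198734591067777)) (f (n 1557716118699582462518134721) (n 1538411379674528147070814465))) (n 1576455548363795926999891968)) (e (c (f (n 3457717761)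 (n 1441773388473414140017809345)) (n 1557112661463028862177801857)) (f (n 1383481825062661723816722432) (n 1383708055931999293518681921))))) (c (f (d (n 4279813633) (n 4598580610)) (n 1403201689337134241233286914)) (f (e (n 1673168682199859076797605313) y) (n 1596062398785409119813674817)))) (e (c (f (n 3189556609) (n 1364214643311303892357658242)) (f (n 1595797872466367226933411840) (n 1576643880224884831223588609))) (n 1306337688632130592483311616)))) (c (a (e (b (f (n 1518427357727671486443945984) (c (n 1595797724734793016755389761) (n 1595797872322252056037425152))) (d (f (f y (n 1499311218205028359880611265)) (c (n 1422242566143972028959983298) (n 1557452182703394588449867521))) (n 1538298116656895120606494720))) (n 0)) (n 0)) (e (n 1731196162307560022449586176) (n 1692511200017155893544091648))))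
def t10 : CT := (d (a (c (e (f (b (c (f (b (c (n 4564497857) (f (n 1653599490485121908154086721) (n 1692510757286295241938216385))) (b (n 1576568248416547891909273153) (n 1538184558495878219213874817))) (b (c (d (n 5185255106) (n 5134919234)) (f (d (n 1673318986112936692107224705) (n 4598048257)) (d (n 1634784401830252141773629185) (n 4832929409)))) (c (n 5420132162) (e (n 1634973075133141642694924161) (n 5403354946))))) (b (f (n 1750538680272090214819472705) (n 1750538680272090249850295873)) (f (n 1750538680272090181030155841) (n 1731271425021982029145478977)))) (c (b (f (d (n 1538260042572627856214501249) (n 4900038401)) (c (n 5688563905) (n 1635123895712688240768096321))) (f (c (n 5638494210) (n 1538184706083346057928939521)) (n 1538637020243525384453265730))) (f (n 1731309203953845020415530881) (n 1692887808888288668552300801)))) (b (c (b (f (d (c (b (a (n 1499763015856364862884063170) (n 5906675522)) (n 1499838426146138187648505921)) (f (n 1634935369988254997752620930) (n 1615743451240943875290867714))) (n 1499687679358075881802213186)) (c (d (a (c (f (n 5939960130) (n 1500026878092604603024316930)) (f (n 1538523535873983889133312258) (n 1480533687125591955640195522))) (n 6024112322)) (n 1422392648849249932630071426)) (f (n 1596513679774793535071492226)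 (n 1499763089656865202551691586)))) (f (c (b (n 1519218870622386221640358145) (n 1519294207125185450573076674)) (n 1615894198033514229662783618)) (d (n 1519482585280176472256977474) (n 1480496055767685883105417602)))) (f (b (n 1712041948703736868262156161) (n 1692887882675264929282164993)) (n 1673733687519584679923321217))) (c (f (d (n 1538712356746326846836087426) (n 1480458350622794822550849986)) (n 1500027173245024377188158466)) (n 1460814265600863351518038977)))) (f (b (c (n 4816160258) (f (n 1595797946100229900486882689) (n 1595797946100229901074085441))) (f (n 1441547231386558064992761602) (n 1422392943997161708448688130))) (b (c (f (n 5772457794) (n 6040889346)) (n 1538184779870326750763067330)) (f (n 1422543617002755768485718274) (n 1422769700307134750487779970))))) (f (b (n 1576455548363839293016802561) (n 1576455548363839242316318593)) (b (n 1576455548363839362524809217) (n 1537958743008509583808035713)))) (b (f (c (c (n 4614833602) (f (n 1537769949480589901234750785) (n 1537769949480589901905839618))) (e (n 1557112661463028862966076737) (n 1479742322120090480808867073))) (c (c (b (n 1383933401064852163348448962) (n 1403351403107535068591077250)) (e (n 1538523462087011991402096578) (n 5319472898))) (e (n 1557112661463028880934475713) (n 1479742322120099312234702593)))) (f (c (f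 (n 1422204270698771408420648578) (n 1422392796423204720524441474)) (n 1479742368236959598866372353)) (c (c (n 1422807184086584530354612418) (n 1480420793060872347272128834)) (n 1441245636668606148894300609))))) (f (c (b (c (f (n 1672866598161273037905499393) (e (n 1538071443061218180233991617) (n 5168481666))) (a (n 1673168460694810658069058881) (n 1537769949480589866522686721))) (c (f (n 1538146927142471399648831042) (n 1518992787327021035560412930)) (f (n 1595797872322265203101181441) (n 1557376624830661475324434178)))) (e (n 1557112661463028964350522625) (n 1479742322120073915521826816))) (b (c (c (b (f (n 4749039298) (n 1480495686823788412979422914)) (n 1499951541589809805625698114)) (f (n 1557301066966935612137973314) (n 1538184779879333846938851138))) (n 1479742368236960147984647809)) (c (c (n 1519407322564355633603450946) (n 1538335674245856791121401986)) (n 1460512891920121830163908801)))))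
def t11 : CT := (e (d (b (a t10 (c (b (f (d (n 3826574594) (n 3558134978)) (f (n 4782872002) (n 5235590978))) (f (n 4044670402) (n 1345361332998209782810982146))) (c (b (f (d (n 1537770097072552456578196737) (n 1383029289248815104944766976)) (n 1499235512785364289286358530)) (f (n 1537770097072556854960244161) (n 1480194635978528667464677250))) (f (n 1441057110945554025005711360) (n 1441057110945554815279693824))))) (f (a (e (c (b (c (d (f (b (a (n 1557904423063082509727471873) (n 6208923650)) (n 1557904496854566750951344897)) (n 1558130506362957874637081154)) (n 1538599462677099240274298946)) (a (n 1693076555978158965001325057) (n 1538297821527017539155302593))) (d (f (n 1558055538799550333755624449) (n 1596891690598471474481495617)) (n 1538599684038032522902534849))) (b (n 1557112661463029000572795265) (n 1518729194056209598367165953))) (d (b (c (a (n 1461304653524700928893032770) (n 5437171778)) (n 1460512845803261646209063233)) (c (n 1480609761498160643706227458) (n 1460776975508298461359410369))) (b (c (n 1441848946337140054491961282) (n 1479742322120099277824886785)) (c (n 1461154054310591059379652994) (n 1460701565362640324737923713))))) (c (b (n 1344871830197469825881126594) (n 1364440874185140660870883394)) (n 1557527519350293951261179904))) (a (c (b (c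 (a (n 1480722581784911139210038274) (n 1383933917591713820368476738)) (n 1558017612293739133105376194)) (d (n 1577775255783799215583428545) (n 1538863767626196147611401602))) (n 1441434236325513436824862720)) (c (c (n 1325906216119979017112164610) (n 1383896212446827156887345538)) (n 1538561776123063141637554176))))) (b (c (a (b (f (b (n 1518427357727671520803684352) (n 1538071516852693672474443776)) (c (d (n 1480345013818194352237749762) (n 3792737666)) (a (n 1653863426512843808959399362) (n 1518578252094212026521392514)))) (f (c (d (n 3943994818) (n 3340014914)) (n 1808679570816838143678873600)) (d (n 1499876205091525153367562114) (n 1441471599740372648960755330)))) (n 1306299171830504686939537408)) (f (n 1731196162307559867830763520) (n 1731196162307560022449586176))) (a (d (a (f (c (b (n 1519105976557675510985164674) (n 1538411158313599211519899970)) (n 1576455548363821974601623617)) (c (n 1538637536756871774382357250) (n 1518691635476469209256193089))) (e (f (b (n 1422393018076863280883695616) (n 1441924135558722868131166465)) (b (n 1422656585160709536725629313) (n 1306375173006103906977348673))) (n 1345248586502930604184567808))) (e (a (f (c (n 1576907816239091502032385921) (w 24510656)) (c (n 1519294502282108823223429634) (w 24510656))) (n 1403200951760103168171573248)) (n 1403201099334055843747332096)))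 (n 1345248438928977911428939776)))) (b (d (a (c (f (b (d (n 4296078594) (n 3960530114)) (n 4497659394)) (b (f (n 5134931394) (n 5638243970)) (n 1345286291643322330837727042))) (b (f (e (n 1673168682199845879704190976) (n 1557112984099468039546528897)) (d (n 1615140906941139012874454658) (n 1615140906950150541540111810))) (f (d (n 1615140906941143342033978945) (n 1615140906941143342235301249)) (n 1576795069748324536020940674)))) (b (f (n 1421488389742984861765861376) (n 1248309249295131994796127554)) (f (n 2937386242) (n 4162115138)))) (c (f (n 0) (n 1325604501160380975925952512)) (a (n 1615140906950137394677940224) (n 0)))) (d (a (c (f (b (n 1383858802436326079159645954) (n 1403201689341640040722507906)) (b (n 1364478653117003618770266562) (n 1403390362649046336333454018))) (c (e (n 1557791824155829909493645312) (n 1480383825785735725493256192)) (n 1654354137585158986043228160))) (b (n 1287296221533988244550582272) (n 1326170152125160822423945216))) (b (n 1364553768258854166055616512) (f (n 1383858950014777865365618688) (n 1383858950023811490297190338))))))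
def t12 : CT := (c (a (d (f (a (b (e (d (f (b (n 6829680386) (n 6913562882)) (a (c (e (n 6997449026) (n 7819532227)) (b (b (n 6846192130) (n 6879742594)) (b (n 6913297154) (n 1229945663134699530426026946)))) (n 6947116930))) (n 7081596547)) (n 7383594499)) (e (d (e (a (d (c (b (a (n 1191298258551747122912594498) (n 7098108290)) (f (n 7366543938) (n 1210716186816456534391028610))) (b (f (n 7081331266) (n 1249326033819469868908711042)) (f (n 7047777346) (n 1268518395293144559301983810)))) (b (n 7265880386) (n 7232588290))) (d (n 6812895554) (n 7584909442))) (d (n 7047780546) (n 7719131138))) (n 7266142019)) (n 7417145027))) (b (n 5823313219) (n 6326887939))) (a (b (e (d (f (a (e (d (c (b (b (n 1114153015613806945271581250) (n 1133533460085551379585731266)) (b (n 1152876125625432856721390466) (n 1172256496310200996180556802))) (b (f (b (n 1191335594770757311058185026) (n 1191373152341693582762085378)) (d (n 1191335594779773443811347266) (n 6997183298))) (d (n 1210565292454443924042320962) (n 1191072027695940146893458242)))) (d (n 1094509151636689938644502978) (n 7332989186))) (n 7165221059)) (c (n 6863230914) (n 1114115384255898776742697026))) (a (c (d (a (e (n 1114153015622827475953810370)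 (n 7282395650)) (n 1094810497656898451089164802)) (n 1094847907644868337077619011)) (e (n 1191523751564821647183608770) (n 1133608796592860805349804546))) (n 1056087240071319949644167554))) (n 1075203969880766239200282691)) (n 6947121155)) (d (e (f (a (c (b (d (n 1191636866994977931716230402) (n 7500761538)) (n 1210716186825474728778825410)) (n 1249326033828488063229132482)) (n 1133533533877040070010374530)) (d (n 1191373668859550238879280898) (n 1172293980098671169676540610))) (n 1114078269406824672450091139)) (n 1152612484759131399474411970))) (b (a (n 1055748705419564636337117058) (n 882680467067296686706042307)) (d (n 1094471815435696346236225794) (n 7635244675))))) (b (d (n 0) (n 4464612483)) (d (n 4263286211) (n 5320508675)))) (b (d (n 863413138030212233891414016) (n 0)) (d (n 959900825156110004250476544) (n 2955191299)))) (d (f (a (a (d (b (e (a (e (d (c (f (b (d (n 6594533762) (n 6762305730)) (b (n 6695197314) (n 6728747842))) (e (a (d (b (c (f (n 6812633794) (n 1249062245383717222756682626)) (f (n 1307052463066995097173265218) (n 1307203062290118798025460802))) (n 1307052684432436480521047298)) (n 1249062171596743126857845570)) (n 1229832621491521636726246082)) (n 1229757358775700901856320066))) (f (a (e (d (b (c (f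 (n 6443539010) (n 1345587047354187696787462914)) (f (b (n 1422807036508121744400226882) (n 1403389108252421731417889474)) (n 1422957709518221740191288194))) (f (n 1384234894649997322685025218) (n 1384385567660099362947632322))) (n 1345511858429846890373745282)) (n 1326169340463917968806418946)) (n 1306901863852880931719256514)) (b (d (e (a (b (c (f (n 1365080459686644029504654210) (n 1345700162797868128842845314)) (n 1403652749128016363871046786)) (n 1365005196975331292258274562)) (n 1306901863852889727963270018)) (n 1326432907543251927073594114)) (n 1326131487745087615928404610)) (n 1364967713195881460650773634)))) (c (f (n 6863231042) (n 6879742274)) (f (n 1325867920665753554582018242) (n 1326056298820740075257629186)))) (c (n 6880012354) (d (n 1287672387534635736543308098) (n 6846191682)))) (f (d (n 6477359106) (n 6863234882)) (e (n 1191109585266872019879762242) (n 7299442690)))) (n 6880016066)) (e (f (d (c (b (b (n 1307090389572810644078496770) (n 1306939937932649068619664578)) (n 1326320308617426004138298754)) (b (n 1403577707768339335765593410) (n 1423033341168928210447272770))) (n 1287559493460909031899302466)) (c (b (d (n 1307090389577323039849217538) (n 7030733762)) (n 1345888836091745981275602882)) (n 1423184014174522321184787330))) (n 6947121346))) (b (c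 (n 6343140931) (n 1326093782600192053409253314)) (n 1268216680347072765225109762))) (b (d (n 1152386696616172793149830978) (n 6695728515)) (n 1191147364198732777448056962))) (d (n 3508065538) (n 4783395970))) (a (a (b (e (d (a (f (c (b (f (c (b (n 1268706109356335027803163842) (n 1268555436355248965976882562)) (n 1307203062290125257773714818)) (n 1268706109360843025544150466)) (n 1287973585971880062597758594)) (e (n 1345700162797863816393690242) (n 1287973585971875664484145794))) (n 1268517952575799288417778818)) (f (n 1191448341275041621867530882) (n 1191448341275048219155401346))) (c (n 1171352753433549016797317506) (n 1248685784235164557049367106))) (n 1171993150596308317829638402)) (d (e (c (e (n 1287936102192711808408649218) (n 1229720022570214706715331522)) (n 1345888909883511748059758146)) (n 1210302168101488789514656194)) (n 1268216680351591758820575491))) (b (f (n 1133382713297484623381567682) (n 1133382713301992620485289731)) (n 1191147364203238574924273602))) (a (n 1074940550384405260665140674) (n 863375359098349276729704448)))) (a (d (f (a (n 3826816451) (n 6293071107)) (a (n 1190808091686232709911578307) (n 6964155843))) (n 0)) (n 0))))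
def t13 : CT := (a (f (e (d (f (c (a (b (e (d (f (b (c (n 7249099842) (n 1307279062871205341734141378)) (c (n 1268443501512200900677238274) (n 1326508981915816303831318466))) (c (e (n 1268857520236200033711849026) (n 7634975682)) (n 1307279062875713339424800706))) (n 7148697922)) (n 7199037379)) (d (f (b (e (n 1326848180645839276818591682) (n 8088226050)) (n 1365458617944662970109030338)) (e (n 1326848180645843674764439490) (n 1229608013940185948782889538))) (n 1248874974042397717021879106))) (c (n 1152575296127582400075565314) (n 1210641071679091987180980610))) (e (a (b (d (f (c (n 1365118755131848945313284034) (n 1364892893201922841216319426)) (n 1345738679599494171691613634)) (n 1306751781147618422268918210)) (d (d (n 1423373277768727360064221122) (n 1384424158253213925160288002)) (n 1345512891452036175898377090))) (d (n 1249326181397923857394338306) (n 6595315778))) (b (n 1268142229292492674817104578) (n 1326358751636583611695926658)))) (a (e (c (b (d (d (n 1249401813053147362773724930) (n 1229870769362785061070732418)) (n 1190997060132541385110223426)) (d (n 1326885959577711029871996866) (n 1249025425696083286643207234))) (b (d (n 1365420027356069599609122754) (n 1306940085520130049666481218)) (n 1423410688053947997613223874))) (c (b (n 1171730026243362117119412483)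 (n 1210302758406315143803206339)) (d (n 1287823798414522732231556418) (n 1229456603073858130203146819)))) (b (c (n 1152575296132090397380347907) (n 1249326181402436253181839618)) (d (n 1230096926445119941799082754) (n 1171654615962595991106386178))))) (a (e (d (f (b (n 5605455683) (n 1190658599281266567967176834)) (c (n 1152048161982442875817584835) (n 1287409041829776646112569922))) (b (n 1132743127791464559864184832) (n 1171466164016114279504674816))) (b (n 3122431555) (n 1151898079272659171046881027))) (c (n 3374351811) (n 1190883723336934914323906560)))) (d (a (b (d (n 1133157884380714251383519043) (n 6209185347)) (e (n 1210679514698245196809279555) (n 6293071619))) (n 1075016698539433532629975040)) (n 0))) (d (a (d (a (f (e (e (c (n 1113664223914040682521583554) (w 16403674)) (n 1307618644663923810054991810)) (n 1133157884394233846643853955)) (e (w 14830820) (n 1153027785540850853855919363))) (b (f (e (n 1249590131247214938410741570) (n 882191775927801774079248707)) (e (n 1055711490587522163469475778) (n 882191775945831565650594307))) (f (e (n 1346567473647712870102757314) (n 1171881068192853647248624131)) (e (w 16146650) (n 1055372882152742200986860611))))) (e (f (b (n 1230096336144810416492801027) (n 1287974411468216144529485570)) (n 1288388139655969762165415874)) (n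 1094171059747340182699149507))) (e (b (f (n 1152500033425272646907461632) (n 1153102154021947170477861954)) (c (n 1172181676325526834929205248) (n 1268970340523113170198622082))) (n 1075016698570958730021568512))) (e (c (f (n 1171654247027696922984740803) (n 1113588692855176799112947971)) (n 1210151495123320992432128000)) (n 1035841643330371362726905476)))) (f (f (c (b (n 0) (d (n 1133195073016766844251406336) (n 8206722115))) (b (n 1171767214874893516680462336) (n 1210603366538706719839617024))) (c (b (n 1094434331651734164993998848) (n 1133195073030277643133517824)) (n 1171767214879397150667571200))) (d (n 1074941214494209299514916864) (n 1055485212158738761932341248))))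
def t14 : CT := (f (d (a (b (c (a (d (e (f (b (c (d (a (b (e (b (d (d (n 1500026878097115040306731842) (n 1461417031094523780546730754)) (n 1441998881477470419870849602)) (n 1461416957307125273277008706)) (n 1364590956894915566813358402)) (n 1422769552733182212451638146)) (n 1383933401073868261993523522)) (a (n 1480495686832804511658056002) (n 1325830289312346786338220098))) (b (e (n 1557903906563827476758039042) (n 1461115832665877532275419266)) (n 1499951615381302877403257474))) (c (d (n 1422882815741794788863675522) (n 1403389550992307092995476162)) (n 1538787780876092731854720194))) (b (b (e (n 1481136157926936805343264194) (n 1384234968734505810019523330)) (n 1442451048208107030654520834)) (e (n 1267990846691622533162889154) (n 1442488974713922543888138050)))) (f (b (n 1326169635611827545148798850) (n 1325868437179108810145442050)) (b (n 1287371262897904892622448962) (n 1345550227671048563771611970)))) (e (f (b (c (n 1461416662154716423950210882) (n 1499612490447254584246175618)) (n 1441810946057863409794320642)) (b (n 1403313771767652293134027138) (n 1442149849630987199622183874))) (f (n 1287182663377479289091172034) (n 1287559345891473235033233474)))) (f (e (d (b (n 1287671944812777966054455106) (n 1306600739216134694015117506)) (n 1287295483664225300162848450)) (n 4933862914)) (b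 (d (n 1287671944817290395262167042) (n 1229154888127762146585257666)) (n 1345888467156855725202118850)))) (d (d (e (a (b (f (n 1422053718066835250230365057) (w 19016405)) (n 1402937283396273712709529537)) (f (n 1519181184077366255119499264) (n 1286994405735759956490882370))) (b (d (n 1441811019845385401013370880) (n 1441735683342588216585748480)) (n 1461342284896676484587978752))) (c (f (n 1461040588396787963378270208) (e (n 1538938084947773173849391104) (n 1383971622737167829685020994))) (n 1596514214744436705702445056))) (c (n 1441697830623185894373326848) (n 1596250287944876330475061248)))) (d (c (e (f (b (a (n 1519746816442297015197532098) (n 1345436964662431588239579842)) (e (n 1539315712852905823977893826) (n 1442414302154450112622132994))) (a (n 1268028939218134743521193922) (n 1404029957369721501942579138))) (a (f (n 1403502887778897577274018882) (n 1442640247094311131687190466)) (n 1287447042122542097244658178))) (e (a (w 19013855) (e (n 1344984770997450378141761536) (n 1519445263063312618881064066))) (f (n 1500103173831184237080910850) (n 1539202901788520516159537152)))) (c (a (e (b (n 1480835402071960580493704386) (n 1616422365210122900940550082)) (n 1364704736421386996537395842)) (n 1345248438937985179403157504)) (n 1558093110201448012284166144)))) (b (f (c (b (n 1190883575762982324647493632)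 (n 1229644317128015003904901120)) (n 1345436079209695684987977728)) (d (n 1190883575771989626981449728) (n 1152310917405028787605733376))) (a (n 1268028671144982352498786304) (n 1209850075306719915844567040)))) (a (b (f (b (n 1441772724395117887178670080) (n 1461266210514546013591568384)) (b (n 1442149406904599488134905856) (n 1461266210514546013591568384))) (f (n 1499801089949643895805575168) (n 1383858655308225552574316544))) (n 1151972161396859185399857152))) (d (b (c (a (a (f (d (e (n 1190770876849688836372721602) (n 1326583963323588182820031810)) (b (n 1326244621640011168118508162) (n 1384385742908689221430574402))) (e (w 16138464) (n 1113325025760755537492606786))) (b (n 1210565144885267571704594432) (n 1268706330722044771141943296))) (n 1094471520297075437681508352)) (b (c (f (n 1268216532787051223037509632) (e (w 15088876) (n 1210602923845277923458154496))) (f (n 1364854450188663109709725696) (w 15606528))) (f (n 1345700310372229867689213952) (w 15345408)))) (c (d (f (e (a (w 16138464) (n 1113325172758203903755943936)) (n 1268593879383963591315030016)) (w 14828268)) (b (a (n 1384724849400774097856655298) (n 1171691878386073483651352642)) (n 1307316694238395769389318144))) (a (w 17181932) (n 1288011304956601051868299264)))) (e (n 1287408599108314832297787392) (n 1229268151154952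083253231616))))
def t15 : CT := (f (c (d (d t6 (b (f (e (a (a (e (b (f (c (n 2317144898) (n 0)) (n 0)) (n 0)) (c (n 4028425090) (n 0))) (e (c (n 3173049218) (n 0)) (n 0))) (f (f y (n 0)) (n 0))) (f y (f y (e (n 0) y)))) (a (e (e (a (e (a (f (b (n 2853741826) (n 3843593666)) (b (n 4263024130) (n 4867000066))) (f (n 3021513986) (n 4330137090))) (f (n 2987963650) (n 4229473730))) (n 0)) (n 0)) (n 0)) (n 0))) (a (e (c (e (f (n 0) (f (n 4364211714) (b (n 6494918274) (n 6360430850)))) (n 0)) (f (e (f (a (n 0) (n 4095783938)) (b (n 3457983746) (n 3777009090))) (n 0)) (a (e (f (b (n 4900558466) (n 1326019331541110561391282242)) (b (n 1306751781143097229851527298) (n 1326019331545614161471371842))) (n 3491538562)) (b (n 5420922242) (n 5337294402))))) (n 0)) (e (n 0) (n 0))))) (a (e (f (b (f y (n 0)) (n 0)) (b (f (n 0) (n 0)) (c (n 0) (b (n 0) (c (e (n 0) (n 5605725443)) (n 1403352140981797212798320640)))))) (b (a (f (n 0) (n 0)) (n 0)) (n 0))) (b (e (f (n 0) (n 0)) (f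 (f y (n 0)) (n 0))) (n 0)))) (f (d (b (e t8 (f y (f y (e (f y (a (b (a (n 1440454003833999715649716224) (n 1421111338294118238530830336)) (n 0)) (e (a (d (n 3994387266) (n 3189064450)) (d (n 1305131198345688049018848002) (n 4514742978))) y))) y)))) (e (a t9 (d (e (a (f (n 1383029289532541933008715776) (n 1286768497075023962070581248)) (n 1305432470425780282711867392)) (a (n 1305394691493917325550157824) (n 1305545954795321743873409024))) (n 1286693160576730531889152000))) (f y (a (f y (b (e (n 0) y) (c (n 0) (n 1460928044802186770091343872)))) (n 1247630999967476192724910080))))) (f y (f y (b (a (e (n 1479742322084044122070450176) (n 0)) (n 1363271941320991402451009536)) (e (n 1576568322208023332274569216) (n 0)))))) (d (e (a t11 (b (d (b (f (a (e (d (n 1402183281774037491653804032) (n 0)) (n 0)) (e (n 1363385130407519695438610432) (n 1305357429070888435579192130))) (c (n 0) (e (n 1383556423407465429091745792) (n 2819961922)))) (c (a (n 3105420546) (n 2937656386)) (a (n 1383782580494312707821928448) (n 0)))) (f (n 1344268474524648112629219328) (n 0))) (c (f (n 1267727325120283193863307264) (n 1268028671135974912725876736)) (n 1403351476903514158881832960))))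 (a (b (b (f (a (e (c (n 3390112770) (n 1653034503751738754003369984)) (n 1344042465002746207140839424)) (e (n 1286165288962648425078194176) (d (n 4581331778) (n 4480914178)))) (c (n 0) (a (n 1422091597990468387579363328) (n 3289461762)))) (e (c (n 0) (a (n 1422317828873299160402493440) (n 2299856002))) (n 0))) (b (c (f (n 3289969858) (n 5621732738)) (n 1461267317319190436164665344)) (c (a (n 1345513186599923759827175042) (n 5739435394)) (n 1519597102671880755785760768)))) (b (b (f (d (c (a (n 5923775298) (n 6158672578)) (a (n 1420923035074545713195107074) (n 1440039691106044897819497154))) (n 1286127805322805835345166336)) (e (n 0) (n 3289748290))) (e (n 0) (n 1208945668887713238487138304))) (n 0)))) (b (a (e (b (d (n 1499461596067207659690917888) (n 1479742322088547687338082304)) (n 1480307530038735771847884800)) (n 0)) (e (n 0) (n 0))) (e (b (n 1499801089949643827086098432) (n 1538674946749336458954276864)) (n 0)))))) (c (b (e (f t12 (a (d (a (a (c (a (b (f (d (e (n 1152989093490657150324731138) (n 1055974788728458214642846083)) (n 1075203969889791030926276803)) (n 1075731132290510287778376643)) (f (d (n 1191486655167001710101032322) (n 1133006547305870727379712579)) (n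 1172520082273136987853582146))) (f (b (d (n 1094697824953107881602873859) (n 1055861378145893048084891715)) (n 1133194925456351448163187395)) (d (n 959035499097275729099648514) (n 882116042838327289600567939)))) (f (b (f (n 1210339504320501312914492034) (n 1210603090269908776785050562)) (n 1268593510439538344720367042)) (d (n 1036330972327957009118556098) (n 1230133773811921171384397250)))) (d (f (c (b (n 1055974641154505623339043011) (n 1114040416697005813374417602)) (e (n 1249702435029771257090440834) (n 1113927448845305615469283842))) (e (w 11952352) (n 939692759770417767711275842))) (e (c (f (n 1036518712606011570060032259) (n 882379194856753991888431810)) (n 1171842034873667950522432066)) (n 1094321290013493082614696067)))) (a (f (d (b (n 1075279749123461856501991490) (n 1133345524665962012546726402)) (n 1094208174578410883414001603)) (c (n 998360395767560456876615874) (n 1114341200658969231220570818))) (b (n 1017289088714077901988823040) (n 1075317306694369571084697600)))) (c (f (b (n 1036555975011008471434298819) (n 1113964563680853527499404931)) (e (n 1036255219331659502754725888) (n 882115775342218089418225284))) (b (d (a (n 1132780390223949258477041731) (n 881589083914857143197796035)) (n 1151934677612901407590973440)) (n 1248911572391634006798499840)))) (d (a (n 997946496961172530729582592) (n 882680467071800280828870656))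 (n 882754918126378172951822336)))) (f (a (d (c (a (n 5068342659) (n 5907207363)) (f (n 4480886019) (d (n 1113626545542449071306102275) (n 7131678083)))) (n 0)) (n 0)) (a (c (b (f (n 978830062272315107107714308) (n 978830062281322318960525312)) (a (n 1075016550978991746433980036) (n 883208265308733663105033604))) (b (b (f (n 1094811014161215718203635012) (n 1094811014165719314037997568)) (n 1132969211095839280822484992)) (n 1152387286925494082588377088))) (n 0)))) t13) (e t14 (f (a (d (b (a (c (b (n 1210264389165104637502608835) (n 1268405575006387550513579715)) (f (n 1403163615270874700062916608) (n 1325642427697721720155668480))) (n 1152161129834143066791870464)) (f (b (d (n 1287258811546013964426331970) (n 5521065539)) (n 1384499937477851193584648192)) (n 1306902896884059989465890816))) (n 1171164744226956961606795264)) (c (n 1113400462260590282000039936) (n 1190620303840569541181571072))) (b (d (a (n 1210264389178615535453077504) (n 1093681188012558774114975744)) (n 1093681188012558774114975744)) (d (n 1229494603385200924529000448) (n 1132366815681378788464132096)))))))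
def t16 : CT := (c (e (b (c (a (d (e (f (f (n 4833969921) (d (n 5672834882) (n 6142854786))) (f (b (n 6327146306) (n 6058703233)) (b (n 6393985474) (c (n 6595312322) (a (n 1423261269134190569678732289) (n 7199557698)))))) (n 4565542402)) (f (n 4230518082) (n 5706647042))) (d (n 3559171458) (n 5656847554))) (a (d (e (f (a (c (b (n 5806790465) (f (n 5806786753) (b (n 6142330945) (n 6041664193)))) (d (e (b (f (n 5538089089) (b (n 5823301889) (n 1480798656148452820118964865))) (a (f (c (e (n 1519597324023802481111234945) (n 5991336193)) (e (n 1577625173074000189960256001) (n 5789747521))) (n 1539090736356258813828430529)) (n 1461456359543452817157818689))) (n 5588424705)) (e (n 1461305170029022494146201601) (n 6142334785)))) (n 5203072769)) (a (d (e (c (a (b (f (n 6309841409) (n 1442415040014761658951433153)) (f (n 1481176076532201055353076545) (n 1481176076536706716682190209))) (n 1403654372436701013572618817)) (f (b (n 1519634734020788431049230977) (n 1500330068778206793297329089)) (n 1500329847417277908765932801))) (b (n 1384274149325887525558454594) (n 1422959849340531970965801537))) (b (n 1403541257002043087985084610) (n 1442377408661352691449756098))) (b (n 6226221058) (n 1403767561658339356932081858))))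 (f (n 4900824578) (n 5639018498))) (f (e (n 3860891138) (n 6008382786)) (b (n 5370844802) (n 1364705326703660169408051329)))) (f (d (n 3978343810) (n 4968457410)) (d (n 5404403330) (n 6377743746))))) (a (e (d (c (b (c y (f (b (f (n 5958305537) (n 6108772865)) y) (f (f (n 1462022453225584617190091649) (n 1462022453230088216851016833)) (n 1481402750127884459468156289)))) y) (f (a (d (e (c (a (b (f (b (n 5806782913) (c (n 5806782849) (n 1539279926163474243471047425))) (d (n 1520012597130895732435090305) (n 6058441345))) (c y (f (n 1597496743659965266349812481) (n 1597572227741222780882414785)))) (f (n 1442453483033910470499924289) (n 1442453483033912669674175105))) (b (d (f (b (c (n 1558433770831017229585775361) (n 1539015621218898631680621185)) (n 1597307849000650480574560961)) (n 1558546960057165958788709441)) (n 1519635250534126059765136001)) (n 1616763851340628860943756353))) (b (n 1461871706437517861841570049) (n 1500670448099850448682121665))) (c (n 1461720590710066033111103617) (n 1539090883934710518364535105))) (b (n 1423110743707052698425657281) (n 1481402897701832650142021697))) (a (b (c (f (n 1558810896066864545990733121) (n 1461833779936214711344328641)) (n 1519823923837019993276972097)) (c (n 1520088376360060693409197121) (n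 1597458743371690115478351361))) (e (n 1423110743711565162563271361) (n 1384350149915981405272963457))))) (c (f (n 4901598722) (n 5639534594)) (f (f y (n 1403541625941425961723524929)) (n 1461720369349139346545997954)))) (c (b (f (n 5069116802) (n 5890934402)) y) (d (f (f y (n 1403768299532603704693524289)) (n 1461984821872180046677706882)) (n 3911222914)))) (e (d (c (f (n 5539141122) (n 6209963778)) (f (n 4582577857) (n 1345589113398531150607058946))) (n 0)) (f (n 0) (n 3894711810))))) (b (c (n 0) (n 0)) (c (n 0) (f y (d (n 1365083042239817074870321152) (n 3105924354)))))) (e (e (d (a (b (f (d (c (c (e (a (b (c (a (n 1616159093278403936889899393) (n 5605198017)) (n 1596552713089757069129845057)) (d (f (n 1577436425993148190307158593) (n 1616272725226410280905636801)) (n 1577398720848261424854104577))) (n 1461040865079934435129333825)) (f (n 1499915090819012123736708993) (n 1441924946922712743298767169))) (e (n 1654542709417177075026266497) (n 1538449379976327136277731457))) (a (n 1557263850977456987374123649) (n 1460550670850595158979020993))) (c (c (b (n 1577285236474209766357899009) (n 1577209899975916336327456961)) (n 1576983669106607391208146881)) (a (n 1576455548363839225019263105) (n 1479780147168822418438653825))))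 (c (c (e (d (n 1538864136561073326281751553) (n 1499990205969900662542596609)) (n 1519408650734428142137805441)) (n 1596703386095359890145180417)) (n 1460739344150388126388354113))) (c (f (c (e (d (b (n 1577625320652463061729835713) (n 1635992958724419055219407937)) (n 1558207318609788763836807617)) (d (n 1519710882189340663992584641) (n 1480836951598159238822398081))) (d (n 1674413920291349040180001729) (n 1635502362953670518164191745))) (c (n 1577851625308768040568519937) (n 1713249998159178612528672513))) (n 1460852681090049712781787136))) (c (d (b (f (n 1383670719433746138089170625) (n 1383859097588734858274314305)) (f (n 1422695691969897831950227457) (n 1442226735660277624437770753))) (b (n 1364327906319912069985248769) (n 1480987255664366023618627585))) (e (n 1635124559944648174052835328) (n 1538411674975542480371449856)))) (a (d (a (b (c (f (n 1557791750359291869928126209) (n 1557791750359296234789304577)) (n 1576455548363795926999891968)) (f (c (n 1577285531626629539833608449) (n 1538109932667052895234972097)) (n 1616197107699005298029652801))) (b (f (n 1441698199832786945833959424) (n 1441698199832813269170026561)) (f (n 1500065985482772775478231040) (n 1500065985482799031118232193)))) (f y (b (n 1557904866082173502151983104) (n 1577323163272757274331840512)))) (n 1383858950014777899725357056))) (d (a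 (c (a (b (f (n 1441962725854573500430853953) (n 1441962725859079299786119362)) (f (b (n 1480761688882334105586931777) (n 1519711177337241376109660417)) (n 1539166736950862752180112129))) (b (n 1364290422535954293384062722) (f (n 1422733692262689673861175169) (n 1442264809740036965010016577)))) (c (b (n 1538374191047469926803570688) (n 1596855018341057752180195328)) (n 1693228427887559509096267776))) (b (n 1345287177091532667127595008) (n 1403617036231199281586896896))) (b (c (n 1422582355169805356490555392) (n 1499349292320812096152403968)) (a (n 1480912140526999378818236416) (n 1229005321926812503919034368))))) (f y (b (c (e (n 1345098798936548348882896322) y) (n 1480346268214801360788389888)) (c (n 1461796222365271836428599296) (n 1577588132016401473200979968))))))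
def t17 : CT := (f t16 (c (e (a (f (c (b (d (e (c (f (b (n 6897567874) (n 6612085826)) (b (n 6846971074) (n 1384651274561737041070812802))) (b (f (n 6611827778) (n 1384500158834285212423716482)) (f (n 1423261269138694169205173761) (n 1462059568079173317064945601)))) (n 6612092866)) (n 6243256130)) (b (c y (b (f (n 1500858309741494840136855489) (n 1539732018967237115829051329)) y)) y)) (d (b (e (c (b (b (n 1520124827117338643656113665) (n 1461833042061948163519446785)) (n 1500669415082186651280633793)) (b (n 1539127998783795567491579841) (n 1461720148001732257656369089))) (n 1345513629321790327667329538)) (e (b (d (n 1500707267805533917832310593) (n 1461795853430407960766999746)) (n 1558886453939610853439991745)) (n 1423148670217389436774677122))) (b (n 1403578666999022371211085826) (e (n 1422959775558074650966387330) (n 6796638338))))) (e (c (b (d (f (b (c (n 1365270682516035619285135106) (n 1423336162919646624610807746)) (n 1423487278647094054842036162)) (b (n 1384763873487567362488561602) (n 1365270756307528708158676930))) (n 1287523042699127379784919682)) (d (b (n 1404069424182880601829568194) y) (n 1345739933978090994996898562))) (b (d (c (n 1403842750591702858859052738) (n 1481250896535186476356628418)) (n 1364818073207959874688547586)) (d (n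 1597759868017445768422252481) (n 1461795632078495071835286978)))) (b (c (n 1307242612109414892788549762) (n 1384425043696920666220038594)) (c (n 1404107572049620565745236418) (n 1403805783325581876919827394))))) (e (d (f (b (c (n 6830458754) (n 1306752519017363778750421122)) (c (n 1307054750472267436044613762) (n 1365007189228194749052910082))) (b (n 1268594617244160725287209410) (n 1326623277946596207949020098))) (f (n 1210039338900920577818920706) (n 1210039338900920578556852354))) (b (n 1229645792872044503788197570) (d (n 1307318391338568889734825858) (n 5807310594))))) (b (c (e (n 4414547458) (n 4733056323)) (e (n 1326397047077269636032276098) (n 5454476738))) (a (e (c (n 1365422240969844415270782786) (n 1365083042239834636238227522)) (n 1307168161054832596124434432)) (n 1229307258233810981859885056)))) (e (d (e (a (c (b (f (c (n 1519672365387719139650731393) (n 1655070738242633362660687681)) (n 1655409858708965706574360513)) (f (n 1732932079317801229503197121) (n 1364818489729308776381571009))) (n 1461003428891425352976433152)) (b (c (f (n 1403352583717178980521511362) (n 1422958890123366313571683522)) (n 1596891616811921788561034561)) (c (n 1481175707606773043826294273) (n 1364441289841798433471758273)))) (c (a (b (f (n 1442113694021587937185270338) (n 1481025108396740266993945986)) (n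 1558697780641515222494117698)) (f (n 1345287177100548667745015938) (n 1364855925935815122321181314))) (n 1577662878223810648826970112))) (a (e (c (f (b (n 1519333019083739126864312834) (n 1597005543907402407407545601)) (e (n 1655146001098070084059160513) (n 1519559116502403740249386498))) (n 1441472162831327781072142336)) (f (n 1442113399152901668768579584) (n 1442113399306067903740410882))) (n 1442376597004611346512216064))) (b (f (b (c (n 4464363010) (n 1519333461805579298874064896)) (d (n 1442453261677485197136756736) (n 1306338131367516754998244930))) (d (n 1442528450606329757528227840) (n 1306413467870313785394243330))) (n 1461796222374279138762555392)))))
def t18 : CT := (a (d (b t17 (f (e (c (c y (c y (c y (e (c y (b (c y (c y (c y (c y (a (d (f (n 1655713639555404303232166849) (n 1403579866070363715877232577)) (n 1539129326963310680443218369)) (d (n 1461871927811975136619297089) (n 5538871105))))))) y)) (f (d (f y (e (n 1559114095984852464467474625) y)) (n 1500444364808982192210313216)) (c y (n 1500784089280223207019773952))))))) (d (d (b (e (c (f (b (n 1578002962397993263703816897) (n 1675131489409066570450758721)) (a (n 1442416120051456854088507329) (n 1345438754591112674601106561))) (n 1403202400146173746279874560)) (f (c (n 1520051113946030524021604352) (n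 1655336066987130367388942336)) (n 1636257632603872184359714816))) (e (n 1423262764799049273530384384) (n 1384539876148353105638981632))) (b (f (c (a (e (n 1713514888792391096850738241) (n 1558698675317319725491976449)) (n 1442303031402756191702482944)) (n 1693757028553215876668588032)) (c (e (n 1616763629976612410138062081) (n 1500595037824172794853489025)) (e (n 1403277811300680640404680641) (n 1345174625175731015018642369)))) (a (n 1462061607918469455896641536) (n 1655826976639210351929327616)))) (f (f y (f y (n 1577776814538159651867852800))) (b (d (n 1577738878808972016635346944) (n 1538864948226806534937509888)) (n 1694247924366719317178318848))))) (c (c y (n 1578645278021274020557619200)) (n 1578381342011571172899028992))) (d (c (c y (b (b (c y (c y (e (n 1539619346264027138662887233) (n 1384501413244987962140690498)))) y) y)) (e (a (e (w 19024608) (d (n 1403730863335087475177553920) (n 1364894618865597266190663680))) (b (f (n 1597496310449705592691884032) (n 1675206023616704919958220737)) (w 17714415))) (n 1597799058129716365529972736))) (e (a (e (c (c y (b (n 1558811117437104093979762498) y)) (e (n 1403466410812046775045586944) (n 1364743503138145437543825408))) (c (f (n 1442793428861576558382415872) (n 1442793433482313623706295298)) (n 1636144231537272052663713792))) (c (f (n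 1365233715245411151667789824) (n 1365233729089476371844956160)) (n 1519861343345595001589465088))) (n 1404108014780472334267449344))))) (c (b (e (f (c (b (n 0) (n 0)) (b (n 0) (f y (e (n 1364743031853050460414935040) (n 3106440450))))) (c (b (d (n 4415063554) (n 4734088515)) (d (n 1326321489213543721709631106) (n 5455508930))) (a (d (b (n 1364855556991900057845397314) (n 1364743031853068021800134722)) (n 1267765768148443603450986496)) (n 1229156142506359153213046784)))) (n 0)) (b (f (c y (f y (n 1461720664501545922105180160))) (c y (n 1461720664510553121359921152))) y)) (b (d (f (b (n 1538411379670011331240525824) (n 1577398573269796434221203456)) (e (e (n 1519182051227460106799022080) (n 1364365685265285822722080768)) (n 1190357474649021725999628288))) (n 1519257092280610541703004160)) (e (f (n 1577361310851271243633524736) (n 1538902653659923504693248000)) (n 1364706212160886501044912128))))) (b (c (f (d (f (e (n 0) y) (e (n 0) (n 0))) (n 0)) (d (e (c (b (n 2603132226) (n 1268594986174534196333117440)) (b (n 1268406091515219410524569600) (n 1326698097936046772983955456))) (n 0)) (n 0))) (f (e (c (b (n 1325906585041332043543216128) (n 1364855999713757823349293056)) (n 1441848872554654160207740928)) (n 0))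 (f (c (n 1326132446980274142920572928) (n 1441848872554654160207740928)) (n 1326132446989281359355183104)))) (f (c (c y (e (d (n 1365196010100524437804679168) (n 0)) (n 0))) (e (d (n 1384237034490319815590281216) (n 1248499250786112797870653440)) (n 1248499250786112797870653440))) (c (c y (e (n 1365196010109531654239289344) (n 1209926961354033535765184512))) (d (n 1345551869449267923247955968) (n 1229156466207085970094817280))))))
def t19 : CT := (a (d (e (e (d (a (f (b (c (a (f (b (c (n 1423675140288745213772984258) (n 1597796766256886396707168194)) (c (n 1598136776643653011162554306) (n 1365120130888402075993001921))) (b (n 1229683305218438155383889858) (w 17454300))) (f (b (n 1326735582012764989125324738) (n 1481929663213849469424787394)) (d (n 1210415976181353672539660226) (n 1346266418321652955080843202)))) (n 1345475455254503383260725248)) (d (w 17719514) (n 1345928802436858353805164544))) (w 16146640)) (f (c (b (f (b (n 1268594617244165123551558722) (n 1365609660177890071211962242)) (n 1307769313057831850607927234)) (c y (n 1307054724271776157723283393))) (e (d (n 1306827681169213233970544640) (n 1287371973981648064719355904)) (n 1462021139192870228266582016))) (n 1152387629650833650122489856))) (a (f (c (b (b (c (n 1307091496386488653632269634) (n 1442565417881761203462107074))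 (f (n 1423449426221006370303926210) (n 1520576920213844287500607426))) (c y (n 1326284274376954349986250752))) (a (n 1345324634674956733966712832) (b (n 1558545424658754813014597569) (w 20332762)))) (d (n 1191035403159662875310555136) (n 1171579695971535271502020608))) (b (c (f (f (n 1229570235017334586573879874) (n 1249138614917737158994062594)) (n 1268932797224244661932285890)) (n 1442376611141973767299792896)) (n 1404144917924900544924614656)))) (d (a (f (b (c (c (b (n 1307242612113940482279107906) (n 1443056543995979646530777026)) (f (n 1423411656224285073845022658) (n 1520614708080848905365123010))) (e (f (n 1617026542483627466059444161) (w 16138470)) (n 1520087426641428669164187586))) (a (n 1345929097584764048554065920) (c (n 1559565451351483826180476865) (w 20335834)))) (e (n 1191073182091525832472264704) (n 1171655253835261185825439744))) (c (b (f (f (n 1229645792881060500897299010) (n 1249289730645188987640642818)) (n 1269159470815422404902543298)) (n 1443169964243525037344161792)) (n 1403804912005704760820760576))) (f (c (a (b (b (n 1248875416773293470507367170) (n 1345853049422211179777387842)) (n 1481666843376726680398225346)) (n 1307092174313314167308681216)) (b (n 1481062371099388343922720768) (w 17447155))) (c (n 1307468118957818083465494528) (w 16138480))))) (c (f (b (a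 (b (f (n 1268595059966018492890126339) (n 1248913343279109017328716163)) (c (n 1365422240978878003139868994) (n 1345777786723982629726878402))) (n 1190809936369647275372183552)) (n 1462324841495827310629093376)) (f (b (n 1268482092132328342808428544) (n 1520729373330223930162544640)) (b (n 1288125974970520537374130176) (w 15350016)))) (e (d (f (n 1442528464450817379149021184) (w 16138480)) (n 1364818387262521710238236672)) (n 1345551426727973155711746048)))) (e (b (f (c (a (c (f (n 1268330607442977792758933507) (n 1248800006483520145844103555)) (b (n 1364855557000933645714483522) (n 1345513334200941929578650306))) (n 1190696599574058403887054848)) (n 1461418138195974660865130496)) (f (c (n 1268255418541150599838171136) (n 1519784900033650001119805440)) (c (n 1287861517979909006890631168) (w 15347958)))) (d (e (f (n 1442641787843693759579553792) (w 16138480)) (n 1365158393181717494342090752)) (n 1345626966721415748629037056))) (n 1287485780303111281667211264))) (f (b (c (f (b (c (n 1210754556053134843324661760) (n 1268406091519723010151940096)) (n 1268594986179037830320226304)) (n 1210754556053134843324661760)) (e (n 1287334296073123543056908288) (n 1151747406285079506732449792))) (a (n 1326322153899810710995599360) (n 1268595355122926469406261248))) (f (n 1248950846104242136786403328) (c (n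 1210453597432579505604526080) (w 15347968)))))
def t20 : CT := (b (c (d t4 (e (f (f y (d (f y (d (a (b (c (n 5170827973) (n 4700279556)) (n 0)) (c (n 0) (n 0))) y)) y)) (a (c (e (b (d (f (n 0) (a (n 552800220485142881180319744) (n 3878183813))) (f (c (n 687974714430751715006349312) (n 726622635513533190152675973)) (n 552800220485142881180319744))) (f (n 0) (n 0))) (f (n 707241379384768033795866624) (n 707241379385612458725998592))) (b (c (n 861833285077667228308996096) (n 804067896305670980890525696)) (f (n 0) (n 900931380510423331844915200)))) (c (b (a (n 861833211290690933470789632) (n 552800220485142881180319744)) (d (n 0) (n 958623674049035160671748096))) (n 0)))) (f (f y (f y (e (d (n 745625659601529523127975936) y) y))) (c (e (n 745625659602092576160612352) (n 494470804068319198168743936)) (n 707278936955702106442956800))))) (d (e t15 (f (e (f y (f y (f y (b (e (a (c (n 0) (n 0)) (n 1170260485670133250077491200)) y) (n 1054203902135034028658524160))))) y) (a (e (b (f (b (d (n 0) (n 0)) (n 0)) (d (n 1074413932761606196712964096) (n 881401074698831280421732352))) (f (n 1171014661517173260694847488) (n 1055297498091044693535096832))) (b (c (n 976870723759465897991864320)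 (n 1092889381366054749806264320)) (n 881288106838686833081057280))) (f (e (c (n 0) (n 1189640782567925094681673728)) (d (n 1054053229705900721344348160) (n 880798235085895428648992768))) (n 1074150293337863995443380224))))) (e (f (f y (c (a (n 842680399639971650127003648) (n 0)) (d (n 1595797724743795832373903360) y))) (c (d (e (a (f (c (n 0) (n 0)) (b (d (n 1035879200882446608745103360) (n 0)) (n 1074602237125110623815860224))) (n 881626346328452222211325952)) (n 0)) (n 0)) (f (n 1364326799528778442987274240) (n 1345548825704970580960215040)))) (b (f (f y (n 1054203902135034028658524160)) (n 842565144382999112848506880)) (n 1131575007592878458466729984))))) (c (b (c y (b (c y (c y (f (b (d (e (b (b (a (d (e (f (d (n 4800947522) (n 6428595330)) (f (n 6864009730) (f (n 7165734146) (n 1326660540365112707334565762)))) (n 0)) (n 0)) (n 0)) y) y) (e (n 0) y)) (f y (n 881176024404525000266088448))) y) (b (b (b (b (d (e (b (b (b (a (f (a (d (e (f (n 1365571954740251841980293058) (n 1229796244525743270652043202)) (n 8239482627)) (n 8307111491)) (d (n 1229871654806483005517622210) (n 9347302723))) (a (e (d (n 1269159087608466571194032066) (n 1152236761512333076296653187))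 (n 1113476389059241660141565956)) (n 1113551578006100495578714050))) (f (d (n 1153441260072371419026068803) (n 8659965059)) (n 1153441260076875015581073408))) y) y) y) (n 881890798851492922343292928)) (n 881626346328452222211325952)) y) y) y) y)))) y)) y) (d (e (f t18 t19) (d (f (f y (b (b (c (n 0) (n 1170260338672641412704501760)) (n 1248951638719762052405002240)) (n 1462476243147812264594112512))) (f (b (n 1190998388307104292151492608) (n 1462476243147812264594112512)) (n 1190998415995234801225302016))) (f (b (n 1054203902711494780961947648) (n 1190659706103925383293304832)) (n 1113551725580009098832773120)))) (e (e (f (f y (c (c (b (n 0) y) (n 1248498291537406566464487424)) (n 1461078422668882849610858496))) (f (c (n 1190696156852200634857816064) (n 1461078422668882849610858496)) (n 1190696157734906161822433280))) (f (c (n 1055412873206817713651974144) (n 1190357474649021725999628288)) (n 1113476167716283184509353984))) (n 1209813624558444664280055808)))))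
def t21 : CT := (c (a (e (f (f (d (e (a (b (c (a (f (f (n 2038616319603141929912549569) (n 2057883796214178932455424193)) (n 2096418675649276660016787649)) (n 1710692856052795584188817537)) (n 1941901737525137446353555649)) (c (n 1942355084707492932294586561) (n 1729960380247445525971128577))) (n 1614242597947093158216372353)) y) y) (f (d (b (a (b (f (f (f (f (a (n 1903328933818009586743697601) (e (n 1691161018864207718972170433) y)) (a (n 1903329007604985881581904065) (e (n 1691161018864207718972170369) y))) (f (a (n 1903291228673122890060452033) (e (n 1691161018864207718955393153) y)) (a (n 1903291228673122890060452033) (e (n 1691161018864207701775523969) y)))) (f (f (a (n 1903291228673122890060452033) (e (n 1691161018864207701775523969) y)) (a (n 1903291302460099184898658497) (e (n 1691161018864207701758746753) y))) (f (a (n 1903291302460099167702012097) (e (n 1691161018864207701758746753) y)) (a (n 1922596336642070277369155777) (e (n 1691161018864207684562100353) y))))) (a (n 1922558631497183614927950017) (e (n 1691161018864203303577755777) y))) (n 1922672042151806392318349505)) (n 1652512802921760275006521473)) (b (n 2115648225754493749045493760) (n 1961471224230144854697443328))) y) (f (f (f (f (e (a (d (n 2038578688245231527194833089) y) (c (n 1672497987580933796307951745)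 (n 1537248506421696948066058240))) y) (e (a (d (n 2038540909313368570049900737) y) (d (n 1652815182527077206030315649) y)) y)) (f (d (a (e (n 2038540983100344864837775553) y) (e (n 1652815182527077206030315649) y)) y) (d (a (e (n 2038540983100344864854552769) y) (e (n 1652815182527077188850446465) y)) y))) (f (f (d (a (e (n 2038540983100344830494814401) y) (e (n 1652815182527077188850446465) y)) y) (e (a (d (n 2057846091069292269192130753) y) (d (n 1652815182527077188850446464) y)) y)) (f (d (a (e (n 2057846091069292234849169601) y) (e (n 1652815182527077188850446464) y)) y) (e (a (d (n 2057846164856268529637044417) y) (d (n 1652815182527077188850180224) y)) y)))) (f (f (f (d (a (e (n 2057808385924405572492112065) y) (e (n 1652815182527077188850180224) y)) y) (d (a (e (n 2057808385924405572492112065) y) (e (n 1652815182527077188850180224) y)) y)) (f (d (a (e (n 2077151272825211516748824576) y) (e (n 1652815182527077188850180224) y)) y) (d (a (e (n 2077113493893348559587115008) y) (e (n 1652815182527077188850180224) y)) y))) (f (f (d (a (e (n 2077113567680329254689353921) y) (n 1556251382937148070127730688)) y) (e (a (d (n 2077113567680324854425321472) y) (n 1556553614392051727421407232)) y)) (f (d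 (a (e (n 2077075862535442592349073601) y) (n 1556251382937148070127730688)) y) (c (a (d (n 2077151125251258927072411648) (n 1788064527332469290338660609)) (e (n 1691765390404994521343221888) (n 1556553540603667714102263808))) (n 1942052705678632335441920000)))))))) (b (a (b (f (n 2038465130088709370830389248) (d (e (n 1594219347664477354673045504) (n 0)) (n 0))) (n 1922823081786434550455336960)) (e (n 1652890592816868121470058560) (n 1556289088080627099869642752))) (f (b (n 2077226683114984824215961600) (n 1923011976445749267544408064)) (n 2115837046626832205656096768)))) (f y (f y (d (n 1845262123087101796743643136) (n 0))))) (e (n 1652890445242871531933007872) (e (n 1575556381423631897864724544) y))) (a (e (f (b (d (e (c (f (n 1903027142851178231763628225) (n 1999439714835207805355745473)) (a (n 1652286303807614260070916353) (n 1555949147445624625391009985))) (f y (n 1845073671077591587112952065))) (f y (n 1671855647550359497933394177))) (a (n 1787573913043339048813392129) (e (n 1806916654820157268220244225) (n 1691085345229533544405078273)))) (c (d (n 1941675137720931579619966976) (n 0)) (d (n 1768041767304131465728491520) (n 0)))) (f y (f y (b (n 1632942978796632164461265153) (n 2167222593))))) (e (n 1517565388972555791427960832) (e (n 1498146722847090545057071104)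 y))))
def t22 : CT := (c (f (d (b t21 (c (c y (e (c y (e (a (n 1653079665988413596605874176) (n 1634114316107025790112391297)) (n 1614129439663752156027027456))) (f y (n 1421001921422637831070679040)))) (e (b (e (a (n 1556364936336456591905652736) (n 1498524811925310988036866048)) (n 1556176115464118169654788096)) (a (n 0) (n 1595806081249465646354268160))) (f y (n 1421001921422637831070679040))))) (f y (f y (d (b (b (f y (e (n 1595806219600046250715512832) (n 1421719430591814959296937984))) (e (n 1557120224437496642933882880) (n 1363350755035046326510288896))) (b (n 1749945437436730929859002368) (n 1672838194782577610960404480))) y)))) (e (c (b (a (f (d (a (n 2077151199038235187550879744) (n 1517829914083207824734683136)) (n 1518434376704784385213202432)) (d (n 1517225441950028043795824640) (n 0))) (n 1556742325781882607000092672)) (d (n 1692520727891074319361507328) (n 1595806219600046216355774464))) (d (b (n 1690442882171040845115949056) (n 1421001921422637831070679040)) (n 1479748455617441431241621504))) (b (d (c (a (n 1884023528539424694812540928) (n 1556175641803938232394579968)) (n 1594143942130505270889021440)) (n 1652890328607241024588218368)) (d (n 1478766203389004545037172736) (n 1324853806717450112641007616))))) (c (f (a (b (d (e (f (b (a (d (e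 (c (n 1594143937374708414519267649) (n 1594143937374708397859504449)) (c (n 1555684615803336533064909121) (n 1574763123968082489807061313))) (n 4381827393)) (c (d (n 1748131753991758256271610113) (n 1594257052953487970751303937)) (d (n 1748131753991758222633308417) (n 1459611980563216813487915265)))) (a (n 4197536065) (n 1575140987073692804943008065))) (a (b (n 1709975249127064289285579009) (n 3895275905)) (d (n 1671175548810500789889925120) (n 0)))) (f y (f y (c (n 1497882481262254585073463617) (n 1497844480969462743883424065))))) (f y (n 2889171266))) (e (d (n 0) (n 4601217410)) (n 3660673409))) (e (d (c (d (n 1825050247111426824457945088) (n 1651983634676283026178048000)) (n 1728902127795116089093914624)) (f y (n 1517413972862608126144151552))) (f y (n 1594294758386596398166441984)))) (b (d (e (n 1594143942130505253709152256) (e (n 1594143942130505305248759808) (a (f (n 1497882333688301995380015425) (n 0)) (n 1478841614876735336204992512)))) (n 1421115036857297818041188352)) (n 1421115036857297818041188352))) (e (f (b (d (a (a (f (b (d (c (e (e (n 1574763050181106194868183361) (n 1574725197462266943069602113)) (a (n 5270528321) (n 1555382237206830352186077505))) (e (a (n 5068947777) (d (n 1593879190136112584448930113) (n 5119533377))) (f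 y (n 1536114538946629553726034241)))) (n 4901683585)) (n 4817789313)) (e (n 1574801050473898036108554625) (n 1555420163424411021377642881))) (f (c (d (n 1651832661765584229650248001) (n 1536454770694329450105508161)) (d (n 1632413921997257773672689985) (n 1517036178644070960892330305))) (c (n 1594219348096831684578996545) (n 1574838460903229481604718913)))) (b (n 1575102849773835710111785153) (d (n 1555722405302091173272322305) (n 1478841614255264979550040321)))) (f y (n 1478879171249711976691007488))) (d (a (n 3190907329) (n 1594219352708508937328001024)) (n 0))) (d (c (b (n 1594143942130505305248759808) (n 0)) (b (e (n 1574838612800628964722737152) (a (n 1497882186114349439224213889) (n 1478841614876761727019073793))) (n 0))) (n 1401771993303278017952350208))) (f (f y (e (f y (a (d (n 1555420015850458499884097921) (n 5791375746)) (n 1594256979454733320745648128))) y)) (a (d (f (e (n 1555457868569297682509955457) (n 1536039350017789510482764162)) (n 1555495721288132550302105600)) (n 3861729730)) (n 1594294758386596312267096064))))))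
def t23 : CT := (a (f (f (d (e (b (c (b (d (c (e (a (f (b (c (n 4416401794) (n 4986573186)) (n 4953534914)) (n 4063814082)) (f (a (b (d (e (c (f (n 3745046849) (n 3426279745)) (n 4164223297)) (n 4264890690)) (n 4215075138)) (n 4047565186)) (c (b (d (e (f (c (f (e (d (a (b (d (n 3241197761) (n 3459567873)) (n 3610824961)) (b (n 2019273506489307777351856321) (n 1865058871229147860778139841))) y) y) (e (a (n 3090465025) (n 1903669087239100297884250305)) (n 1729809335929069388558291201))) (a (n 3426017537) (d (n 1980549951377923476441583873) (n 3224686849)))) (f (d (n 1864945610526378327167516929) (n 2553327873)) (n 1903480487655633062779207937))) (f y (n 2838556929))) (f y (n 2771955969))) (c y (n 3258503425))) (e (f (d (a (n 3795382593) (b (n 1845451458018320504190988545) (n 3929596225))) y) (n 2771177729)) (n 3677946177)))) (b (d (a (n 2737889601) (e (n 1980663361960484241443651584) (n 0))) (n 0)) (n 0)))) (f y (f y (n 2922447234)))) (a (e (n 4801761730) (n 5623599554)) (e (f (c (e (d (n 3526693185) (n 4366074242)) (n 4130677122)) (n 3962651009)) (n 2771190081)) (f y (n 4230828418))))) (f y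 (f y (c (e (n 2923479426) (n 5171376514)) (n 4634247618))))) (c (c y (d (c y (e (n 3745833410) (n 5238493634))) (n 4266451394))) (d (e (n 3392991682) (n 4986577346)) (n 3980718530)))) (b (d (b (a (e (c (n 5422010882) (n 5639864834)) (c (n 6008967618) (n 6193271298))) (c (e (c (f (n 4583416194) (n 4247601538)) (n 4348277122)) (f y (n 5035893122))) (e (f (c (n 5052670337) (e (n 5354664385) (n 5639639489))) (n 4616196546)) (f y (d (n 5370937730) (n 6394597826)))))) (e (c (n 4012982722) (n 4029510146)) (f y (n 3576267202)))) (f y (n 0))) (e (d (n 0) (n 0)) (c (n 3929358850) (n 3140575746))))) (c (c y (c y (n 0))) (n 0))) y) y) (d (b (e (c (b (d (c (e (a (n 2318717378) (n 0)) (n 0)) (n 0)) (a (n 4030259650) (n 0))) (d (a (n 3174621698) (n 0)) (n 0))) (d (b (e (c (n 0) (n 0)) (c (n 3056161218) (n 3693445634))) (n 0)) (n 0))) (e (f y (f y (c (n 0) (c (n 4767433218) (n 4263866882))))) y)) (e (c (c y (n 0)) (n 0)) (n 0))) (d (f y (f y (b (e (n 0) (n 0)) (d (e (n 0) (n 0))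 y)))) y))) (b (d (e (c (d (a (n 0) (n 0)) (n 0)) (n 0)) (c (e (n 0) (n 0)) (d (c (a (n 0) (n 0)) (e (n 0) (f (b (n 5269996034) (n 7065403970)) (n 3877462594)))) (n 0)))) (c (b (e (n 0) (n 0)) (n 0)) (n 0))) (c (c y (n 0)) (n 0)))) (f (b (d (e t22 (f y (f y (e (c (c (n 1594143937518819200922025984) (n 1594143937518819218101895168)) (f y (c (n 1555495795075108827960442880) (d (n 1516809804668360564121010176) (n 1343705332452196671843565954))))) y)))) (f y (f y (d (c (e (b (n 1595806219455930976740311040) (n 1595806219455930993920180224)) (n 0)) (e (n 0) (n 0))) y)))) (d (e (c (c y (b (c y (e (d (n 1363690912851650342566232064) (n 1344574556579751169833828352)) (n 0))) y)) (d (b (e (f (n 1363464313047448963153657856) (n 0)) (n 1363275049453252634434600960)) (n 1325118185021168953707200512)) (b (f (n 1305813150839197844073611264) (n 0)) (n 1306115160933172616852668416)))) (f y (f y (c (n 0) (n 0))))) (f y (d (f y (d (b (e (n 1557346897884559111928938496) (n 0)) (c y (n 0))) y)) y)))) (e (c (f (d (b (e (c (a (n 1518434376704784333673594880) (n 1498977969019733298844270592))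 (n 1421719725739720069930287104)) (n 1594143937518819218101895168)) (e (n 1595806219600046164816166912) (n 0))) (b (b (n 1595806219455930976740311040) (d (n 1479748312655174825632858112) (n 1538004084770725027953770496))) (c y (n 1364068342170540100695359488)))) (b (d (e (n 1478841613822893023400296448) (n 0)) (n 1479748312655174825632858112)) (d (n 1479748312655174825632858112) (n 1421983887438311198625366016)))) (d (b (e (n 1594143937518819183742156800) (n 1594143937518819235281764352)) (n 0)) (n 1286545383691941646161674240))) (c (b (d (e (f (n 1594143937518819183742156800) (n 0)) (c (n 1594143937518819183742156800) (n 1536190687250276611564503040))) (n 0)) (d (n 0) (n 0))) (e (c (d (n 1574838681975919189593948160) (n 0)) (d (n 1516847578988537416955985920) (n 0))) (c (d (n 1497466987086955581074833408) (n 0)) (d (n 1516658610686361472845479936) (n 0))))))))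
def t24 : CT := (d (f (e (a (c (b (d (f (e (e (n 4834050561) (f (n 5673177602) (n 6142665282))) (f y (n 6008463874))) (n 4565598850)) (e (n 4230566466) (n 5706711554))) (d (n 3559219842) (n 5656883842))) (b (e (f (d (b (f (d (c (e (n 5622333953) (f y (n 6142439937))) (b (a (e (n 5554971137) (f y (n 6058299905))) (f (e (d (c (n 5739545025) (n 1535885725677250239740416449)) (n 5638869441)) y) (n 1478235075510264536204210689))) (e (n 5655892481) (n 1439700343649119243800826369)))) (f y (n 5538439681))) (e (n 5555208769) (n 5840433729))) (n 5203149377)) (n 3860955650)) (d (n 4900881026) (n 6008427138))) (d (f (f y (e (f y (n 6175982146)) y)) (n 5639111234)) (a (n 5370913346) (n 1362706954443501831607951809)))) (e (d (n 3978388162) (n 4968493698)) (d (n 5404467842) (n 6377792130))))) (c (b (e (d (f (b (d (f (a (e (n 5622596033) (f y (n 6075593153))) (b (c (e (n 5555495297) (f y (n 5907829121))) (d (e (f (a (n 5739807105) (n 1535887348990728726181220737)) (n 5639131521)) (n 1535887201416780483246608769)) (n 1478236182314908958777831809))) (e (n 5656154561) (n 1439701671814692550889066881)))) (e (n 5320593857)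 (n 5555491265))) (e (n 5555732929) (n 5840957889))) (n 5203411457)) (n 3860955650)) (f (n 4901667266) (n 6008951298))) (f (f y (e (f y (n 5622337985)) y)) (c (n 5371175426) (n 1362707766100241074827960833)))) (e (f (n 3979174402) (n 4968755778)) (f (n 5404992002) (n 6378054210)))) (b (e (d (f (b (a (c (e (a (n 5806911937) (c (n 5806920129) (d (n 1535848758258011148929384897) (n 6125912513)))) (a (e (n 5957931457) (n 1497276468825931887142703553)) (d (n 1516506166649225552888529281) (n 6327251393)))) (d (e (c (a (n 1555153423505100784338125249) (n 1593612745220592235204768193)) (n 1612879631535818913351393729)) (n 1574232079387918916459901377)) (n 1497502404691461869320155585))) (c (f (e (a (c (n 1555154235161840027558658433) (n 1593613114155473709396062593)) (n 1612880885914415925601165697)) (n 1574232743470705570004021633)) (n 1497503437709129997055046081)) (a (d (n 1632034287860101245665198529) (n 1497578257847210350179410369)) (n 1555229424378919584882667969)))) (c (e (n 5807133185) (n 6042046977)) (e (n 1420660057282207002335789569) (n 1420509089272822951659319809)))) (c (n 4867351041) (n 1420584720923525159679824385))) (f (f y (n 5153071617)) (n 5085692418))) (d (f (f y (f y (n 1420396047625148106673127873)))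 (d (n 1401166645093872608627802626) (n 1362820660318089564802384386))) (a (n 1401166202372012589338190338) (n 1458930558125355563497947586)))) (d (e (f (n 4582650433) (n 5823881858)) (n 1343326805263777763732636161)) (n 0))))) (e (f y (f y (a (c (n 6494982722) (n 6142177858)) (c (n 1304943779425894762683441602) (n 1362669913525525806661366274))))) y)) (e (f (a (n 0) (e (n 0) (c (n 3005305410) (n 1343629110505657714690060930)))) (n 0)) (a (e (f (n 4615664258) (n 4028449474)) (f (n 1227798684341132550555177474) (n 5202866819))) (f (d (e (b (n 1304943779714125137392034306) (n 6293393986)) (n 1343327395847844886365475330)) (n 3407979010)) (c (n 0) (n 1305094526506721878550090370)))))) (e (f (f y (n 0)) (n 0)) (c (f (f y (n 2234081795)) (n 2133406275)) (d (f (f y (n 3407979010)) (n 4347482691)) (f y (n 6528774723))))))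
def t25 : CT := (f (c (c (f (a (b (d (e (a (c (f (b (d (e (f (c (n 1574498155080323051892646273) (n 1593689778823844149019693441)) (n 1536114465159653258720055681)) (n 1555230604970544494450733377)) (n 5606084993)) (n 5522186625)) (e (n 1555344310412777728845918593) (n 1439890861766029902343975297))) (f (b (a (c (d (n 1612881476210224136739520897) (n 5941637505)) (n 1651415912923466294362034561)) (n 1574573122936468880482271617)) (n 1439815082541372905053622657)) (n 1574498007794598501519602049))) (f (d (n 1651529840159552646714384705) (n 1536152023307056879445090625)) (n 1574724755172763568150016385))) (f y (d (n 1574422449930883582497038721) (n 1459120412303610150926832001)))) (f y (e (n 5002338689) (n 1401469097909705099920667010)))) (e (c (n 4113658305) (n 1382202137663384738025279937)) (n 1401167382963633306078925250))) (a (a (f (d (e (n 1574687124104495383687070017) y) y) (d (n 1574687050317501716324417536) (n 1420850059754998913062252929))) (d (d (n 1728524114953829966443184128) (n 1593954453141562269494149120)) (n 1478614415509159921168941056))) (e (d (n 1440344661948862024980103168) (n 1555759657880233687858913601)) (d (n 1440306740054732496569368576) (n 1555532762928127062571618625))))) (e (a (b (d (a (e (n 1555457720995345093034602945) (n 1555382015557670987836268993))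 (d (n 1632527258792850938815947137) (n 1517149368153942016076644737))) (n 3861471682)) (n 3089711618)) (n 1594256979454733355105386496)) (d (b (a (a (n 1555268605263336197798621633) (n 1555381868560183548828320129)) (n 1459498511228133467726942465)) (n 1363010454112060602669072384)) (b (n 1401507112037552929588117504) (n 4079579586))))) (f (d (b (a (e (f (a (d (c (n 1574421859635069014790549889) (n 1632034656939528813428019585)) (n 1516732766597551052936081793)) (n 1670607462745193549741879617)) (d (n 1612994444215057733499392385) (n 1497730259306623536581460353))) (f y (n 1612843180913657645157527937))) (n 1459384879284596978718081024)) (a (e (n 1439777156179670345405817281) (n 1401242645967693213578973633)) (n 1593727488724949827028254720))) (f y (b (f y (e (n 1440003548458027420750311809) (n 1459157540699522929768165761))) (n 1324550676416118426234257408)))) (b (d (a (e (c (n 1574535639152515481945887169) (n 1536189359517066464650461633)) (n 1536000685930450187741458817)) (n 1459498363654137924483547136)) (e (n 1478613981145138773048164352) (n 1459157540699496605122822144))) (n 1401469245771886049997357056)))) (d (c (f (b (a (e (a (d (n 1689950059254181413737169281) (n 1593877419258260350603813249)) (n 1420773782496700879823683969)) (n 1401392895294091288766837057)) (w 20300070))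 (e (n 1535848767769613985743110144) (n 1478160486690598127635739009))) (a (b (e (n 1593839861677756178962735553) (n 1612994379660465004718268801)) (n 1401544360913754006312976384)) (n 1747715000683472755212943360))) (b (f (w 20300058) (n 1401619006259531828502200320)) (n 1459232513758144497075617792))) (f (f y (n 1593876902749268244202258432)) (n 1516921145036248952055267328)))) (d (f (b (c (a (c (n 1478614635860438081402306560) (n 1478500930562313334313451520)) (d (n 1555722409913733207138762752) (n 1478841619443385787855405056))) (n 1574648542737840283773304832)) (n 1440041756564894007638884352)) (n 1497881817755915589162893312)) (c (n 1382504147901474712030543872) (n 1420886952666659188593655808))))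
def t26 : CT := (a (c t24 (f (d (e (a (c (b (d (f (e (c (a (d (b (f (e (d (a (n 1574495056027318668687450625) (n 1593686974918744945167323649)) (n 1536111587467577760029479425)) (n 1555228022426374175112720897)) (n 5605298753)) (n 5521400385)) (e (n 1555340768637915576611222081) (n 1439888648156741057197519297))) (d (b (c (a (f (n 1612878967453030112239976961) (n 5940851265)) (n 1651413773101153744037007809)) (n 1574571130688113335076553217)) (n 1439813459227894418612294209)) (n 1574495130102523002829287873))) (d (f (n 1651526298384690442940080641) (n 1536149366975910265235055169)) (n 1574721360971854005591994881))) (f y (d (n 1516731586005934767980589569) (n 1420697172275416137268351489)))) (e (a (n 4883862145) (n 1439889090878594427962114689)) (a (n 1401467622026064014979236482) (n 1420621909559579958132224578)))) (f (f y (e (n 1459306576412452063517966849) (n 1401505253528104962243551745))) (n 1363046153317644388502434369))) (d (e (a (n 4112347905) (n 1401278727366747028570608321)) (n 1401165538289225935122977410)) (n 1382275260556892918658367488))) (d (c (f (e (b (n 1690437814510504883917300225) (n 1478762284608827948168491649)) (n 1612954008953459968797209089)) (b (n 1536338114061259692025315328) (n 4514747137))) (b (n 1613746159130022785620901888) (n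 1555642659980973171162480640))) (e (n 1594252035727321600945553408) (n 1459457619361720716562006016)))) (c (b (f (d (e (c (f (d (a (n 1574420383895543118026158529) (n 1632033919069765865045692865)) (n 1516807217656632493163311553)) (d (n 1516732176301740694229905921) (n 1459232051710505068904980993))) (d (n 1593876400066643113138385345) (n 1555492567471937227864048065))) (f y (n 1535924095058063345760022977))) (f y (e (n 1420735024994255353449140673) (n 1459156494135027123154211265)))) (d (e (c (n 1497615815418142222427222593) (n 1497766636285928095069377089)) (n 1535924095049056145649598977)) (e (n 4296909313) (n 1363009038756800662375105026)))) (f (d (e (n 1439775901801073333155783233) (n 1382087620708547102255239681)) (n 1382200440995275516944580608)) (n 1362971186037959274868506624))) (b (f (d (n 1459382181416751001304563712) (n 1459495149277457883202584576)) (n 1536376409511526621744463872)) (n 1497728193271269667297558528)))) (f y (e (f y (f y (a (d (n 1362820217884477563325526658) (n 1228288703650706570295759426)) (n 1458930632209569669560926208)))) y))) (f y (e (n 1382501934292185866884349952) (n 1362895185452375522796371968)))) (e (a (b (f (d (b (c (e (n 4246299330) (n 5924037250)) (e (n 1478913473123439461292572672) (n 1478762874913630112412193410))) (n 1286128026683734822939000832))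 (n 0)) (n 1286278847263281369153798144)) (n 0)) (c (e (a (c (n 0) (n 1459345388506085139194839040)) (n 1459195084435372553768271872)) (e (d (n 1420622426068411817471770624) (n 0)) (n 1439776565883859982973140992))) (d (n 1536376409501956317917478912) (n 0)))) (d (a (e (c (f (n 1285939648533254003171635906) (n 6326678274)) (n 1516920333091279263963807744)) (c (n 1381785684401522235179389570) (n 1362933186321628116776124416))) (n 1458930632200562332867231744)) (n 1228288704227167318252191744))))) (d (e t25 (d (c (f (f y (f y (f y (e (n 1536001064088686291283083264) y)))) (f (n 1516771514271695228826025984) (n 1478387971924977922334523392))) (f (f y (b (d (n 1401317734062341086473355264) (n 1362896246745050516838940672)) (n 1439701539247294681897238528))) (n 1497692715571292958435049472))) (f (f y (f y (n 1478236035330925749933703168))) (n 1420736279661065128976056320)))) (f (f y (f y (e (n 1343968752245773228000149504) (n 1362971702564807668525957120)))) (c (n 1286204913001264317422632960) (n 1363198007203089538795700224)))))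
def t27 : CT := (b (c (d (f (e t23 (e (f y (f y (f y (a (e (d (n 0) (n 0)) y) (c (n 1613411340342879943070318592) (n 1459007813377766630551977984)))))) y)) (e (a (f (d (c (e (n 0) (n 0)) (n 0)) (n 0)) (e (n 882680467071800298008739840) (n 552800220485283618668675072))) (d (b (c (f (n 1478841613822893023400296448) (n 552800220485283618668675072)) (n 1478841613822893023400296448)) (n 1595806224067616977987829760)) (f (n 1595806224067616995167698944) (n 552800220485283618668675072)))) (b (f (a (d (e (a (n 0) (n 0)) (f y (n 976833239975508120182980608))) (n 0)) (d (e (n 1343705554677790292421115904) (n 1285412662236786639599828992)) (n 1151069748090903597129138176))) (n 1131575671675665112010588160)) (n 1054204493007305139667599360)))) (f (d (f y (f y (f y (d (a (b (n 0) (n 0)) (b (n 1595806219455930959560441856) (n 1460783440757378562406744064))) y)))) y) (c (e (f (a (e (d (a (n 0) (n 0)) (f y (n 977891076873095902820040704))) (n 0)) (e (d (n 1344763409445661396464304128) (n 1287074980490925810533793792)) (n 1151409803153378515099844608))) (n 1132369073920495515921809408)) (n 0)) (n 1132369073920495515921809408)))) (d (e (f (b t26 (d (f (b (d (f (e (c (a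 (n 0) (e (n 1363085776779799525656100864) (n 1362896882264599945103278080))) (d (e (a (n 1305281945138254035206275072) (n 1343742170888315870757519360)) (n 1401166068633118238937448448)) (n 1382162883136111068145778688))) y) (e (a (n 0) (n 1363009924200513996207423488)) (n 1304943336992267416008392704))) (e (a (n 1247631664338493222420480000) (n 1324550528842165836557844480)) (f y (n 1189603668295309543367245824)))) (e (c (a (n 0) (n 0)) (n 1305433503875793974674325504)) (f y (n 1189603667718848791063822336)))) (e (c (n 0) (n 1266974404241811746680995840)) (n 1247594328128488034288009216))) (e (c (a (n 0) (n 0)) (n 1267049887742100613862785024)) (a (n 1189603667718848791063822336) (n 1247632255210764333429555200))))) (f (b (a (e (a (f (n 0) (n 882680467067296681201500160)) (c (n 882680467067296681201500160) (n 1093681187993699950675361792))) (c (n 0) (n 1228288703650706565948768256))) (d (c (n 1401733919655855445665382400) (n 1382390368672258430488018944)) (n 1247707739287513952914767872))) (a (c (n 0) (n 1056313101996738049589903360)) (n 882680467067296681201500160))) (e (a (n 1055372318085007711016058880) (n 1093794451020326925831766016)) (f (n 1189603667718848791063822336) (n 1074451712558160282329808896))))) (f (f y (c (a (e (f y (a (f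 y (n 1170034549948718455489298432)) (n 1304755032628762937365889024))) y) (f y (d (n 1323871467876348142800601088) (n 1189603917327198963376324608)))) (f y (n 1304905484850451917804929024)))) (d (b (f (b (e (n 1305019061453150797560807424) (n 1188924634449605855681708032)) (n 1189603668295309543367245824)) (n 1150918115855462129544986624)) (n 1112496573261552168122449920)) (n 1151106835315744211386499072)))) (f (f y (f y (e (n 1055111213600980341354397696) (n 1054694927370028193545191424)))) (n 1208946407622167315324338176)))) (c (b (c y (b (d (c y (e (f (c y (d (a (n 0) (n 0)) (n 1190510388888984745054044160))) (f (n 882680467067296681201500160) (n 882680467071800280828870656))) (a (f (n 1112081669047402921730244608) (n 881890798855996521970663424)) (n 1189113427048345886020075520)))) (c y (c y (a (d (n 1152089731693191375462858752) (n 1056511229242454527774294016)) (n 1229423869299451339026202624))))) y)) y) (d (e (f (f (d (e (a (b (n 0) (n 1229420816390328737859633152)) (c (n 1267541630957554397779853312) (n 0))) (b (n 1189603667718848791063822336) (n 0))) (f y (n 1171015963426760740212572160))) (a (d (n 1152011342281271744487489536) (n 0)) (n 1190245218429113047281827840))) (f (c (n 1152011342281271778847227904) (n 1210001191052186143000887296))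 (d (n 1152199600545930385825988608) (n 1035917248752109338893484032)))) (f (f y (n 1131801801116321653196849152)) (n 1017101817358952687871197184))) (e (f (f y (n 1132444042957991924945911808)) (n 1016875143767774944900939776)) (n 1132104032589239709000007680)))))
def t28 : CT := (a t20 t27)

end CT

theorem chk_root : CT.t28.chk root = true := by decide +kernel

theorem cast_sub_ge (A B : ℕ) : (A:ℝ) - B ≤ ((Nat.sub A B : ℕ):ℝ) := by
  have : A ≤ Nat.sub A B + B := by simp only [Nat.sub_eq]; omega
  have h : (A:ℝ) ≤ ((Nat.sub A B + B : ℕ):ℝ) := by exact_mod_cast this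
  push_cast at h
  linarith

theorem cast_sub_pos (A B : ℕ) (h : 1 ≤ Nat.sub A B) : ((Nat.sub A B : ℕ):ℝ) = (A:ℝ) - B := by
  have hBA : B ≤ A := by simp only [Nat.sub_eq] at h; omega
  simp only [Nat.sub_eq]
  exact Nat.cast_sub hBA

theorem nmax_eq (x y : ℕ) : nmax x y = max x y := by
  unfold nmax nite
  by_cases h : x ≤ y
  · have : Nat.ble x y = true := Nat.ble_eq.mpr h
    rw [this]; simp [h]
  · have : Nat.ble x y = false := by
      by_contra hc
      exact h (Nat.ble_eq.mp (by simpa using hc))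
    rw [this]; simp; omega

theorem pick_mem (l h n p : ℕ) (hl : l ≤ h) : l ≤ pick l h n p ∧ pick l h n p ≤ h := by
  unfold pick nite
  cases Nat.ble (Nat.mul 2 n) p <;> cases Nat.ble (Nat.mul 2 p) n <;> simp [hl]
  have : Nat.div (l + h) 2 = (l + h) / 2 := rfl
  omega

theorem er_spec (l h n p t : ℕ) (e G : ℝ) (hlt : l ≤ t) (hth : t ≤ h) (he1 : (l:ℝ) ≤ e)
    (he2 : e ≤ h) (hn : -(n:ℝ) ≤ G) (hp : G ≤ p) : -((er l h n p t : ℕ) : ℝ) ≤ (e - t) * G := by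
  have h1 : (((h - t) * n : ℕ):ℝ) ≤ er l h n p t := by
    exact_mod_cast (by unfold er; rw [nmax_eq]; exact le_max_left _ _)
  have h2 : (((t - l) * p : ℕ):ℝ) ≤ er l h n p t := by
    exact_mod_cast (by unfold er; rw [nmax_eq]; exact le_max_right _ _)
  rw [Nat.cast_mul, Nat.cast_sub hth] at h1
  rw [Nat.cast_mul, Nat.cast_sub hlt] at h2
  have hn0 : (0:ℝ) ≤ n := Nat.cast_nonneg n
  have hp0 : (0:ℝ) ≤ p := Nat.cast_nonneg p
  rcases le_total (t:ℝ) e with h3 | h3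
  · nlinarith [mul_le_mul_of_nonneg_left hn (sub_nonneg.mpr h3),
      mul_le_mul_of_nonneg_right he2 hn0]
  · nlinarith [mul_le_mul_of_nonneg_left hp (sub_nonneg.mpr h3),
      mul_le_mul_of_nonneg_right he1 hp0]

/-- continuation form of the coordinate step -/
theorem coord_spec (l h n p : ℕ) (k : ℕ → ℕ → ℕ) (hl : l ≤ h) :
    ∃ t e : ℕ, coord l h n p k = k t e ∧ l ≤ t ∧ t ≤ h ∧ (l:ℝ) ≤ t ∧ (t:ℝ) ≤ h ∧
      ∀ x G : ℝ, (l:ℝ) ≤ x → x ≤ h → -(n:ℝ) ≤ G → G ≤ p → -(e:ℝ) ≤ (x - t) * G := by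
  refine ⟨pick l h n p, er l h n p (pick l h n p), ?_, (pick_mem l h n p hl).1,
    (pick_mem l h n p hl).2, by exact_mod_cast (pick_mem l h n p hl).1,
    by exact_mod_cast (pick_mem l h n p hl).2, ?_⟩
  · simp only [coord, force_eq]
  · intro x G h1 h2 h3 h4
    exact er_spec _ _ _ _ _ _ _ (pick_mem l h n p hl).1 (pick_mem l h n p hl).2 h1 h2 h3 h4

theorem g_bound (kp kq ko Lp Ln el eh fl fh gl gh ol oh : ℕ) (e t f g o : ℝ)
    (he1 : (el:ℝ) ≤ e) (he2 : e ≤ eh) (ht1 : (el:ℝ) ≤ t) (ht2 : t ≤ eh)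
    (hf1 : (fl:ℝ) ≤ f) (hf2 : f ≤ fh) (hg1 : (gl:ℝ) ≤ g) (hg2 : g ≤ gh)
    (ho1 : (ol:ℝ) ≤ o) (ho2 : o ≤ oh) :
    -((gN kp kq ko Lp Ln el eh fl gl oh : ℕ):ℝ) ≤
      kp * (f * (e + t + f) - o * o) + kq * (g * (e + t + g) - o * o) - ko * (o * (e + t))
        + ((Lp:ℝ) - Ln) * (e + t) ∧
      kp * (f * (e + t + f) - o * o) + kq * (g * (e + t + g) - o * o) - ko * (o * (e + t))
        + ((Lp:ℝ) - Ln) * (e + t) ≤ ((gP kp kq ko Lp Ln el eh fh gh ol : ℕ):ℝ) := by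
  have hel : (0:ℝ) ≤ el := Nat.cast_nonneg _
  have hfl : (0:ℝ) ≤ fl := Nat.cast_nonneg _
  have hgl : (0:ℝ) ≤ gl := Nat.cast_nonneg _
  have hol : (0:ℝ) ≤ ol := Nat.cast_nonneg _
  have hs1 : 2 * (el:ℝ) ≤ e + t := by linarith
  have hs2 : e + t ≤ 2 * (eh:ℝ) := by linarith
  have hs0 : 0 ≤ e + t := by linarith
  have hf0 : 0 ≤ f := by linarith
  have hg0 : 0 ≤ g := by linarith
  have ho0 : 0 ≤ o := by linarith
  generalize e + t = s at *
  constructor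
  · have h := cast_sub_ge ((kp + kq) * (oh * oh) + (ko * oh + Ln) * (2 * eh))
      (kp * (fl * (2 * el + fl)) + kq * (gl * (2 * el + gl)) + Lp * (2 * el))
    have h' : ((gN kp kq ko Lp Ln el eh fl gl oh : ℕ):ℝ) = ((Nat.sub ((kp + kq) * (oh * oh) + (ko * oh + Ln) * (2 * eh))
      (kp * (fl * (2 * el + fl)) + kq * (gl * (2 * el + gl)) + Lp * (2 * el)) : ℕ) : ℝ) := rfl
    rw [h']
    push_cast at h
    have a1 : (kp:ℝ) * (fl * (2 * el + fl)) ≤ kp * (f * (s + f)) := by gcongr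
    have a2 : (kq:ℝ) * (gl * (2 * el + gl)) ≤ kq * (g * (s + g)) := by gcongr
    have a3 : (Lp:ℝ) * (2 * el) ≤ Lp * s := by gcongr
    have a4 : ((kp:ℝ) + kq) * (o * o) ≤ (kp + kq) * (oh * oh) := by gcongr
    have a5 : ((ko:ℝ) * o + Ln) * s ≤ (ko * oh + Ln) * (2 * eh) := by gcongr
    linarith
  · have h := cast_sub_ge (kp * (fh * (2 * eh + fh)) + kq * (gh * (2 * eh + gh)) + Lp * (2 * eh))
      ((kp + kq) * (ol * ol) + (ko * ol + Ln) * (2 * el))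
    have h' : ((gP kp kq ko Lp Ln el eh fh gh ol : ℕ):ℝ) = ((Nat.sub (kp * (fh * (2 * eh + fh)) + kq * (gh * (2 * eh + gh)) + Lp * (2 * eh))
      ((kp + kq) * (ol * ol) + (ko * ol + Ln) * (2 * el)) : ℕ) : ℝ) := rfl
    rw [h']
    push_cast at h
    have a1 : kp * (f * (s + f)) ≤ (kp:ℝ) * (fh * (2 * eh + fh)) := by gcongr
    have a2 : kq * (g * (s + g)) ≤ (kq:ℝ) * (gh * (2 * eh + gh)) := by gcongr
    have a3 : Lp * s ≤ (Lp:ℝ) * (2 * eh) := by gcongr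
    have a4 : ((kp:ℝ) + kq) * (ol * ol) ≤ (kp + kq) * (o * o) := by gcongr
    have a5 : ((ko:ℝ) * ol + Ln) * (2 * el) ≤ (ko * o + Ln) * s := by gcongr
    linarith

/-- the real edge lengths lie in the box -/
structure Bx.Mem (B : Bx) (a b c x y z : ℝ) : Prop where
  al : (B.al:ℝ) ≤ a
  ah : a ≤ B.ah
  bl : (B.bl:ℝ) ≤ b
  bh : b ≤ B.bh
  cl : (B.cl:ℝ) ≤ c
  ch : c ≤ B.ch
  xl : (B.xl:ℝ) ≤ x
  xh : x ≤ B.xh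
  yl : (B.yl:ℝ) ≤ y
  yh : y ≤ B.yh
  zl : (B.zl:ℝ) ≤ z
  zh : z ≤ B.zh

/-- `2 D` at a vertex with edges `a, b, c` and opposite edges `x, y, z` -/
def dd (a b c x y z : ℝ) : ℝ :=
  (a + b) * (b + c) * (c + a) - (a * (x * x) + b * (y * y) + c * (z * z))

/-- value of the linear constraint, in terms of the squared edges -/
def Lm.val (L : Lm) (a b c x y z : ℝ) : ℝ :=
  ((L.ap:ℝ) - L.an) * a + ((L.bp:ℝ) - L.bn) * b + ((L.cp:ℝ) - L.cn) * c +
  ((L.xp:ℝ) - L.xn) * x + ((L.yp:ℝ) - L.yn) * y + ((L.zp:ℝ) - L.zn) * z + ((L.rp:ℝ) - L.rn)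

theorem lbD_spec (k0 k1 k2 k3 m : ℕ) (L : Lm) (B : Bx) (a b c x y z : ℝ)
    (hB : B.Mem a b c x y z) (h1 : 1 ≤ lbD k0 k1 k2 k3 m L B) :
    ((lbD k0 k1 k2 k3 m L B : ℕ):ℝ) ≤ k0 * dd a b c z y x + k1 * dd a x y z c b
      + k2 * dd b x z y c a + k3 * dd c y z x b a
      + m * L.val (a * a) (b * b) (c * c) (x * x) (y * y) (z * z) := by
  obtain ⟨al, ah, bl, bh, cl, ch, xl, xh, yl, yh, zl, zh⟩ := hB
  unfold lbD at h1 ⊢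
  obtain ⟨ta, ea, ha, -, -, ta1, ta2, ga⟩ := coord_spec B.al B.ah
    (gN k0 k1 (Nat.add k2 k3) (Nat.mul m L.ap) (Nat.mul m L.an) B.al B.ah (Nat.add B.bl B.cl) (Nat.add B.xl B.yl) B.zh)
    (gP k0 k1 (Nat.add k2 k3) (Nat.mul m L.ap) (Nat.mul m L.an) B.al B.ah (Nat.add B.bh B.ch) (Nat.add B.xh B.yh) B.zl) _
    (by exact_mod_cast al.trans ah)
  rw [ha] at h1 ⊢
  obtain ⟨tb, eb, hb, -, -, tb1, tb2, gb⟩ := coord_spec B.bl B.bh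
    (gN k0 k2 (Nat.add k1 k3) (Nat.mul m L.bp) (Nat.mul m L.bn) B.bl B.bh (Nat.add B.al B.cl) (Nat.add B.xl B.zl) B.yh)
    (gP k0 k2 (Nat.add k1 k3) (Nat.mul m L.bp) (Nat.mul m L.bn) B.bl B.bh (Nat.add B.ah B.ch) (Nat.add B.xh B.zh) B.yl) _
    (by exact_mod_cast bl.trans bh)
  rw [hb] at h1 ⊢
  obtain ⟨tc, ec, hc, -, -, tc1, tc2, gc⟩ := coord_spec B.cl B.ch
    (gN k0 k3 (Nat.add k1 k2) (Nat.mul m L.cp) (Nat.mul m L.cn) B.cl B.ch (Nat.add B.al B.bl) (Nat.add B.yl B.zl) B.xh)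
    (gP k0 k3 (Nat.add k1 k2) (Nat.mul m L.cp) (Nat.mul m L.cn) B.cl B.ch (Nat.add B.ah B.bh) (Nat.add B.yh B.zh) B.xl) _
    (by exact_mod_cast cl.trans ch)
  rw [hc] at h1 ⊢
  obtain ⟨tx, ex, hx, -, -, tx1, tx2, gx⟩ := coord_spec B.xl B.xh
    (gN k1 k2 (Nat.add k0 k3) (Nat.mul m L.xp) (Nat.mul m L.xn) B.xl B.xh (Nat.add B.al B.yl) (Nat.add B.bl B.zl) B.ch)
    (gP k1 k2 (Nat.add k0 k3) (Nat.mul m L.xp) (Nat.mul m L.xn) B.xl B.xh (Nat.add B.ah B.yh) (Nat.add B.bh B.zh) B.cl) _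
    (by exact_mod_cast xl.trans xh)
  rw [hx] at h1 ⊢
  obtain ⟨ty, ey, hy, -, -, ty1, ty2, gy⟩ := coord_spec B.yl B.yh
    (gN k1 k3 (Nat.add k0 k2) (Nat.mul m L.yp) (Nat.mul m L.yn) B.yl B.yh (Nat.add B.al B.xl) (Nat.add B.cl B.zl) B.bh)
    (gP k1 k3 (Nat.add k0 k2) (Nat.mul m L.yp) (Nat.mul m L.yn) B.yl B.yh (Nat.add B.ah B.xh) (Nat.add B.ch B.zh) B.bl) _
    (by exact_mod_cast yl.trans yh)
  rw [hy] at h1 ⊢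
  obtain ⟨tz, ez, hz, -, -, tz1, tz2, gz⟩ := coord_spec B.zl B.zh
    (gN k2 k3 (Nat.add k0 k1) (Nat.mul m L.zp) (Nat.mul m L.zn) B.zl B.zh (Nat.add B.bl B.xl) (Nat.add B.cl B.yl) B.ah)
    (gP k2 k3 (Nat.add k0 k1) (Nat.mul m L.zp) (Nat.mul m L.zn) B.zl B.zh (Nat.add B.bh B.xh) (Nat.add B.ch B.yh) B.al) _
    (by exact_mod_cast zl.trans zh)
  rw [hz] at h1 ⊢
  rw [cast_sub_pos _ _ h1]
  clear h1 ha hb hc hx hy hz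
  have Ga := g_bound k0 k1 (Nat.add k2 k3) (Nat.mul m L.ap) (Nat.mul m L.an) B.al B.ah
    (Nat.add B.bl B.cl) (Nat.add B.bh B.ch) (Nat.add B.xl B.yl) (Nat.add B.xh B.yh) B.zl B.zh a ta (b + c) (x + y) z
    al ah ta1 ta2 (by push_cast [Nat.add_eq]; linarith) (by push_cast [Nat.add_eq]; linarith)
    (by push_cast [Nat.add_eq]; linarith) (by push_cast [Nat.add_eq]; linarith) zl zh
  have Ga := ga a _ al ah Ga.1 Ga.2
  have Gb := g_bound k0 k2 (Nat.add k1 k3) (Nat.mul m L.bp) (Nat.mul m L.bn) B.bl B.bh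
    (Nat.add B.al B.cl) (Nat.add B.ah B.ch) (Nat.add B.xl B.zl) (Nat.add B.xh B.zh) B.yl B.yh b tb (ta + c) (x + z) y
    bl bh tb1 tb2 (by push_cast [Nat.add_eq]; linarith) (by push_cast [Nat.add_eq]; linarith)
    (by push_cast [Nat.add_eq]; linarith) (by push_cast [Nat.add_eq]; linarith) yl yh
  have Gb := gb b _ bl bh Gb.1 Gb.2
  have Gc := g_bound k0 k3 (Nat.add k1 k2) (Nat.mul m L.cp) (Nat.mul m L.cn) B.cl B.ch
    (Nat.add B.al B.bl) (Nat.add B.ah B.bh) (Nat.add B.yl B.zl) (Nat.add B.yh B.zh) B.xl B.xh c tc (ta + tb) (y + z) x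
    cl ch tc1 tc2 (by push_cast [Nat.add_eq]; linarith) (by push_cast [Nat.add_eq]; linarith)
    (by push_cast [Nat.add_eq]; linarith) (by push_cast [Nat.add_eq]; linarith) xl xh
  have Gc := gc c _ cl ch Gc.1 Gc.2
  have Gx := g_bound k1 k2 (Nat.add k0 k3) (Nat.mul m L.xp) (Nat.mul m L.xn) B.xl B.xh
    (Nat.add B.al B.yl) (Nat.add B.ah B.yh) (Nat.add B.bl B.zl) (Nat.add B.bh B.zh) B.cl B.ch x tx (ta + y) (tb + z) tc
    xl xh tx1 tx2 (by push_cast [Nat.add_eq]; linarith) (by push_cast [Nat.add_eq]; linarith)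
    (by push_cast [Nat.add_eq]; linarith) (by push_cast [Nat.add_eq]; linarith) tc1 tc2
  have Gx := gx x _ xl xh Gx.1 Gx.2
  have Gy := g_bound k1 k3 (Nat.add k0 k2) (Nat.mul m L.yp) (Nat.mul m L.yn) B.yl B.yh
    (Nat.add B.al B.xl) (Nat.add B.ah B.xh) (Nat.add B.cl B.zl) (Nat.add B.ch B.zh) B.bl B.bh y ty (ta + tx) (tc + z) tb
    yl yh ty1 ty2 (by push_cast [Nat.add_eq]; linarith) (by push_cast [Nat.add_eq]; linarith)
    (by push_cast [Nat.add_eq]; linarith) (by push_cast [Nat.add_eq]; linarith) tb1 tb2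
  have Gy := gy y _ yl yh Gy.1 Gy.2
  have Gz := g_bound k2 k3 (Nat.add k0 k1) (Nat.mul m L.zp) (Nat.mul m L.zn) B.zl B.zh
    (Nat.add B.bl B.xl) (Nat.add B.bh B.xh) (Nat.add B.cl B.yl) (Nat.add B.ch B.yh) B.al B.ah z tz (tb + tx) (tc + ty) ta
    zl zh tz1 tz2 (by push_cast [Nat.add_eq]; linarith) (by push_cast [Nat.add_eq]; linarith)
    (by push_cast [Nat.add_eq]; linarith) (by push_cast [Nat.add_eq]; linarith) ta1 ta2
  have Gz := gz z _ zl zh Gz.1 Gz.2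
  clear ga gb gc gx gy gz
  simp only [Nat.add_eq, Nat.mul_eq, Nat.cast_add, Nat.cast_mul, d2p, d2n] at Ga Gb Gc Gx Gy Gz ⊢
  unfold dd Lm.val
  linear_combination Ga + Gb + Gc + Gx + Gy + Gz

theorem cast_sub_max (A B : ℕ) : ((Nat.sub A B : ℕ):ℝ) = max ((A:ℝ) - B) 0 := by
  simp only [Nat.sub_eq]
  rcases le_total B A with h | h
  · rw [Nat.cast_sub h, max_eq_left]
    have : (B:ℝ) ≤ A := by exact_mod_cast h
    linarith
  · rw [Nat.sub_eq_zero_of_le h, max_eq_right]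
    · simp
    · have : (A:ℝ) ≤ B := by exact_mod_cast h
      linarith

theorem prod_lower (u v p1 p2 p3 p4 n1 n2 n3 n4 : ℝ)
    (hp1 : 0 ≤ p1) (hp2 : 0 ≤ p2) (hp3 : 0 ≤ p3) (hp4 : 0 ≤ p4)
    (h1 : p1 ≤ max u 0) (h2 : p2 ≤ max v 0) (h3 : p3 ≤ max (-u) 0) (h4 : p4 ≤ max (-v) 0)
    (g1 : max u 0 ≤ n1) (g2 : max (-v) 0 ≤ n2) (g3 : max (-u) 0 ≤ n3) (g4 : max v 0 ≤ n4) :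
    p1 * p2 + p3 * p4 - max (n1 * n2) (n3 * n4) ≤ u * v := by
  have m1 := le_max_left (n1 * n2) (n3 * n4)
  have m2 := le_max_right (n1 * n2) (n3 * n4)
  rcases le_total 0 u with hu | hu <;> rcases le_total 0 v with hv | hv <;>
    simp only [max_eq_left, max_eq_right, hu, hv, neg_nonpos, neg_nonneg] at h1 h2 h3 h4 g1 g2 g3 g4
  · have e3 : p3 = 0 := le_antisymm h3 hp3
    have e4 : p4 = 0 := le_antisymm h4 hp4
    subst e3 e4
    nlinarith [mul_le_mul h1 h2 hp2 hu, mul_nonneg g3 (hv.trans g4)]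
  · have e3 : p3 = 0 := le_antisymm h3 hp3
    have e2 : p2 = 0 := le_antisymm h2 hp2
    subst e3 e2
    nlinarith [mul_le_mul g1 g2 (neg_nonneg.mpr hv) (hu.trans g1)]
  · have e1 : p1 = 0 := le_antisymm h1 hp1
    have e4 : p4 = 0 := le_antisymm h4 hp4
    subst e1 e4
    nlinarith [mul_le_mul g3 g4 hv ((neg_nonneg.mpr hu).trans g3)]
  · have e1 : p1 = 0 := le_antisymm h1 hp1
    have e2 : p2 = 0 := le_antisymm h2 hp2
    subst e1 e2
    nlinarith [mul_le_mul h3 h4 hp4 (neg_nonneg.mpr hu), mul_nonneg g1 ((neg_nonneg.mpr hv).trans g2)]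

theorem pos_part_mul (o ol oh s p : ℝ) (ho : 0 ≤ ol) (h1 : ol ≤ o) (h2 : o ≤ oh) (hs : p ≤ s) :
    ol * max p 0 - oh * max (-p) 0 ≤ o * s := by
  rcases le_total 0 p with hp | hp <;>
    simp only [max_eq_left, max_eq_right, hp, neg_nonpos, neg_nonneg]
  · nlinarith [mul_le_mul h1 hs hp (ho.trans h1)]
  · nlinarith [mul_le_mul_of_nonneg_right h2 (neg_nonneg.mpr hp),
      mul_le_mul_of_nonneg_left hs (ho.trans h1)]

theorem w_bound (k Lp Ln ql qh ol oh fl fh gl gh hl hh il ih : ℕ) (q t o f g h i : ℝ)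
    (hq1 : (ql:ℝ) ≤ q) (hq2 : q ≤ qh) (ht1 : (ql:ℝ) ≤ t) (ht2 : t ≤ qh)
    (ho1 : (ol:ℝ) ≤ o) (ho2 : o ≤ oh) (hf1 : (fl:ℝ) ≤ f) (hf2 : f ≤ fh)
    (hg1 : (gl:ℝ) ≤ g) (hg2 : g ≤ gh) (hh1 : (hl:ℝ) ≤ h) (hh2 : h ≤ hh)
    (hi1 : (il:ℝ) ≤ i) (hi2 : i ≤ ih) :
    -((wN k Lp Ln qh ol oh fl fh gl gh hl hh il ih : ℕ):ℝ) ≤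
      k * (o * (f + g + h + i - q - t - o) + (f - h) * (i - g)) + ((Lp:ℝ) - Ln) ∧
      k * (o * (f + g + h + i - q - t - o) + (f - h) * (i - g)) + ((Lp:ℝ) - Ln)
      ≤ ((wP k Lp Ln ql ol oh fl fh gl gh hl hh il ih : ℕ):ℝ) := by
  have hol : (0:ℝ) ≤ ol := Nat.cast_nonneg _
  have hk : (0:ℝ) ≤ k := Nat.cast_nonneg _
  constructor
  · simp only [wN, force_eq]
    refine le_trans (neg_le_neg (cast_sub_ge _ _)) ?_
    simp only [nmax_eq, Nat.add_eq, Nat.mul_eq, Nat.cast_add, Nat.cast_mul, Nat.cast_max,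
      cast_sub_max, Nat.cast_ofNat]
    have A := pos_part_mul o ol oh (f + g + h + i - q - t - o)
      ((fl:ℝ) + gl + hl + il - (2 * qh + oh)) hol ho1 ho2 (by linarith)
    rw [neg_sub] at A
    have Bd := prod_lower (f - h) (i - g) (max ((fl:ℝ) - hh) 0) (max ((il:ℝ) - gh) 0)
      (max ((hl:ℝ) - fh) 0) (max ((gl:ℝ) - ih) 0) (max ((fh:ℝ) - hl) 0) (max ((gh:ℝ) - il) 0)
      (max ((hh:ℝ) - fl) 0) (max ((ih:ℝ) - gl) 0) (le_max_right _ _) (le_max_right _ _)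
      (le_max_right _ _) (le_max_right _ _)
      (max_le_max_right _ (by linarith)) (max_le_max_right _ (by linarith))
      (max_le_max_right _ (by linarith)) (max_le_max_right _ (by linarith))
      (max_le_max_right _ (by linarith)) (max_le_max_right _ (by linarith))
      (max_le_max_right _ (by linarith)) (max_le_max_right _ (by linarith))
    have E := mul_le_mul_of_nonneg_left (add_le_add A Bd) hk
    linear_combination E
  · simp only [wP, force_eq]
    refine le_trans ?_ (cast_sub_ge _ _)
    simp only [nmax_eq, Nat.add_eq, Nat.mul_eq, Nat.cast_add, Nat.cast_mul, Nat.cast_max,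
      cast_sub_max, Nat.cast_ofNat]
    have A := pos_part_mul o ol oh (-(f + g + h + i - q - t - o))
      (2 * (ql:ℝ) + ol - (fh + gh + hh + ih)) hol ho1 ho2 (by linarith)
    rw [neg_sub] at A
    have Bd := prod_lower (f - h) (g - i) (max ((fl:ℝ) - hh) 0) (max ((gl:ℝ) - ih) 0)
      (max ((hl:ℝ) - fh) 0) (max ((il:ℝ) - gh) 0) (max ((fh:ℝ) - hl) 0) (max ((ih:ℝ) - gl) 0)
      (max ((hh:ℝ) - fl) 0) (max ((gh:ℝ) - il) 0) (le_max_right _ _) (le_max_right _ _)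
      (le_max_right _ _) (le_max_right _ _)
      (max_le_max_right _ (by linarith)) (max_le_max_right _ (by linarith))
      (max_le_max_right _ (by linarith)) (max_le_max_right _ (by linarith))
      (max_le_max_right _ (by linarith)) (max_le_max_right _ (by linarith))
      (max_le_max_right _ (by linarith)) (max_le_max_right _ (by linarith))
    have E := mul_le_mul_of_nonneg_left (add_le_add A Bd) hk
    linear_combination E

/-- `144` times the squared volume, in terms of the squared edges -/
def ww (a b c x y z : ℝ) : ℝ :=
  a * z * (b + y + c + x) + b * y * (a + z + c + x) + c * x * (a + z + b + y) -
  (a * z * (a + z) + b * y * (b + y) + c * x * (c + x) + a * b * x + a * c * y + b * c * z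
      + x * y * z)

theorem lbW_spec (k m : ℕ) (L : Lm) (B : Bx) (a b c x y z : ℝ)
    (hB : B.Mem a b c x y z) (h1 : 1 ≤ lbW k m L B) :
    ((lbW k m L B : ℕ):ℝ) ≤ k * ww a b c x y z + m * L.val a b c x y z := by
  obtain ⟨al, ah, bl, bh, cl, ch, xl, xh, yl, yh, zl, zh⟩ := hB
  unfold lbW at h1 ⊢
  obtain ⟨ta, ea, ha, -, -, ta1, ta2, ga⟩ := coord_spec B.al B.ah
    (wN k (Nat.mul m L.ap) (Nat.mul m L.an) B.ah B.zl B.zh B.bl B.bh B.xl B.xh B.cl B.ch B.yl B.yh)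
    (wP k (Nat.mul m L.ap) (Nat.mul m L.an) B.al B.zl B.zh B.bl B.bh B.xl B.xh B.cl B.ch B.yl B.yh) _
    (by exact_mod_cast al.trans ah)
  rw [ha] at h1 ⊢
  obtain ⟨tb, eb, hb, -, -, tb1, tb2, gb⟩ := coord_spec B.bl B.bh
    (wN k (Nat.mul m L.bp) (Nat.mul m L.bn) B.bh B.yl B.yh B.al B.ah B.xl B.xh B.cl B.ch B.zl B.zh)
    (wP k (Nat.mul m L.bp) (Nat.mul m L.bn) B.bl B.yl B.yh B.al B.ah B.xl B.xh B.cl B.ch B.zl B.zh) _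
    (by exact_mod_cast bl.trans bh)
  rw [hb] at h1 ⊢
  obtain ⟨tc, ec, hc, -, -, tc1, tc2, gc⟩ := coord_spec B.cl B.ch
    (wN k (Nat.mul m L.cp) (Nat.mul m L.cn) B.ch B.xl B.xh B.al B.ah B.yl B.yh B.bl B.bh B.zl B.zh)
    (wP k (Nat.mul m L.cp) (Nat.mul m L.cn) B.cl B.xl B.xh B.al B.ah B.yl B.yh B.bl B.bh B.zl B.zh) _
    (by exact_mod_cast cl.trans ch)
  rw [hc] at h1 ⊢
  obtain ⟨tx, ex, hx, -, -, tx1, tx2, gx⟩ := coord_spec B.xl B.xh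
    (wN k (Nat.mul m L.xp) (Nat.mul m L.xn) B.xh B.cl B.ch B.al B.ah B.bl B.bh B.yl B.yh B.zl B.zh)
    (wP k (Nat.mul m L.xp) (Nat.mul m L.xn) B.xl B.cl B.ch B.al B.ah B.bl B.bh B.yl B.yh B.zl B.zh) _
    (by exact_mod_cast xl.trans xh)
  rw [hx] at h1 ⊢
  obtain ⟨ty, ey, hy, -, -, ty1, ty2, gy⟩ := coord_spec B.yl B.yh
    (wN k (Nat.mul m L.yp) (Nat.mul m L.yn) B.yh B.bl B.bh B.al B.ah B.cl B.ch B.xl B.xh B.zl B.zh)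
    (wP k (Nat.mul m L.yp) (Nat.mul m L.yn) B.yl B.bl B.bh B.al B.ah B.cl B.ch B.xl B.xh B.zl B.zh) _
    (by exact_mod_cast yl.trans yh)
  rw [hy] at h1 ⊢
  obtain ⟨tz, ez, hz, -, -, tz1, tz2, gz⟩ := coord_spec B.zl B.zh
    (wN k (Nat.mul m L.zp) (Nat.mul m L.zn) B.zh B.al B.ah B.bl B.bh B.cl B.ch B.xl B.xh B.yl B.yh)
    (wP k (Nat.mul m L.zp) (Nat.mul m L.zn) B.zl B.al B.ah B.bl B.bh B.cl B.ch B.xl B.xh B.yl B.yh) _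
    (by exact_mod_cast zl.trans zh)
  rw [hz] at h1 ⊢
  rw [cast_sub_pos _ _ h1]
  clear h1 ha hb hc hx hy hz
  have Ga := w_bound k (Nat.mul m L.ap) (Nat.mul m L.an) B.al B.ah B.zl B.zh B.bl B.bh B.xl B.xh B.cl B.ch B.yl B.yh
    a ta z b x c y al ah ta1 ta2 zl zh bl bh xl xh cl ch yl yh
  have Ga := ga a _ al ah Ga.1 Ga.2
  have Gb := w_bound k (Nat.mul m L.bp) (Nat.mul m L.bn) B.bl B.bh B.yl B.yh B.al B.ah B.xl B.xh B.cl B.ch B.zl B.zh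
    b tb y ta x c z bl bh tb1 tb2 yl yh ta1 ta2 xl xh cl ch zl zh
  have Gb := gb b _ bl bh Gb.1 Gb.2
  have Gc := w_bound k (Nat.mul m L.cp) (Nat.mul m L.cn) B.cl B.ch B.xl B.xh B.al B.ah B.yl B.yh B.bl B.bh B.zl B.zh
    c tc x ta y tb z cl ch tc1 tc2 xl xh ta1 ta2 yl yh tb1 tb2 zl zh
  have Gc := gc c _ cl ch Gc.1 Gc.2
  have Gx := w_bound k (Nat.mul m L.xp) (Nat.mul m L.xn) B.xl B.xh B.cl B.ch B.al B.ah B.bl B.bh B.yl B.yh B.zl B.zh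
    x tx tc ta tb y z xl xh tx1 tx2 tc1 tc2 ta1 ta2 tb1 tb2 yl yh zl zh
  have Gx := gx x _ xl xh Gx.1 Gx.2
  have Gy := w_bound k (Nat.mul m L.yp) (Nat.mul m L.yn) B.yl B.yh B.bl B.bh B.al B.ah B.cl B.ch B.xl B.xh B.zl B.zh
    y ty tb ta tc tx z yl yh ty1 ty2 tb1 tb2 ta1 ta2 tc1 tc2 tx1 tx2 zl zh
  have Gy := gy y _ yl yh Gy.1 Gy.2
  have Gz := w_bound k (Nat.mul m L.zp) (Nat.mul m L.zn) B.zl B.zh B.al B.ah B.bl B.bh B.cl B.ch B.xl B.xh B.yl B.yh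
    z tz ta tb tc tx ty zl zh tz1 tz2 ta1 ta2 tb1 tb2 tc1 tc2 tx1 tx2 ty1 ty2
  have Gz := gz z _ zl zh Gz.1 Gz.2
  clear ga gb gc gx gy gz
  simp only [Nat.add_eq, Nat.mul_eq, Nat.cast_add, Nat.cast_mul] at Ga Gb Gc Gx Gy Gz ⊢
  unfold ww Lm.val
  linear_combination Ga + Gb + Gc + Gx + Gy + Gz

theorem arctan_tangent (t s : ℝ) (ht : 0 ≤ t) (hs : 0 ≤ s) :
    Real.arctan t ≤ Real.arctan s + (t - s) / (1 + s ^ 2) := by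
  have hd : Differentiable ℝ Real.arctan := Real.differentiable_arctan
  rcases le_total s t with h | h
  · have := Convex.image_sub_le_mul_sub_of_deriv_le (convex_Icc s t)
      (f := Real.arctan) (C := 1 / (1 + s ^ 2)) hd.continuous.continuousOn
      hd.differentiableOn (by
        intro x hx
        rw [interior_Icc] at hx
        rw [Real.deriv_arctan]
        have : s ^ 2 ≤ x ^ 2 := by nlinarith [hx.1]
        exact one_div_le_one_div_of_le (by positivity) (by linarith)) s ⟨le_refl _, h⟩ t ⟨h, le_refl _⟩ h
    rw [one_div, inv_mul_eq_div] at this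
    linarith
  · have := Convex.mul_sub_le_image_sub_of_le_deriv (convex_Icc t s)
      (f := Real.arctan) (C := 1 / (1 + s ^ 2)) hd.continuous.continuousOn
      hd.differentiableOn (by
        intro x hx
        rw [interior_Icc] at hx
        rw [Real.deriv_arctan]
        have : x ^ 2 ≤ s ^ 2 := by nlinarith [hx.1, hx.2]
        exact one_div_le_one_div_of_le (by positivity) (by linarith)) t ⟨le_refl _, h⟩ s ⟨h, le_refl _⟩ h
    rw [one_div, inv_mul_eq_div] at this
    have e : (t - s) / (1 + s ^ 2) = -((s - t) / (1 + s ^ 2)) := by ring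
    linarith

theorem arctan_pade (t : ℝ) (ht : 0 ≤ t) :
    Real.arctan t ≤ t * (945 + 735 * t ^ 2 + 64 * t ^ 4) / (945 + 1050 * t ^ 2 + 225 * t ^ 4) := by
  set f : ℝ → ℝ := fun t =>
    t * (945 + 735 * t ^ 2 + 64 * t ^ 4) / (945 + 1050 * t ^ 2 + 225 * t ^ 4) - Real.arctan t with hf
  have hder : ∀ x : ℝ, HasDerivAt f
      (((945 + 3 * 735 * x ^ 2 + 5 * 64 * x ^ 4) * (945 + 1050 * x ^ 2 + 225 * x ^ 4) -
        (x * (945 + 735 * x ^ 2 + 64 * x ^ 4)) * (2100 * x + 900 * x ^ 3)) /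
        (945 + 1050 * x ^ 2 + 225 * x ^ 4) ^ 2 - 1 / (1 + x ^ 2)) x := by
    intro x
    have hQ : (945 + 1050 * x ^ 2 + 225 * x ^ 4) ≠ 0 := by positivity
    refine HasDerivAt.sub (HasDerivAt.div ?_ ?_ hQ) (Real.hasDerivAt_arctan x)
    · have h := ((hasDerivAt_id x).mul (((hasDerivAt_const x (945:ℝ)).add
        ((hasDerivAt_pow 2 x).const_mul 735)).add ((hasDerivAt_pow 4 x).const_mul 64)))
      refine HasDerivAt.congr_deriv h ?_
      simp [Pi.add_apply]; ring
    · have h := (((hasDerivAt_const x (945:ℝ)).add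
        ((hasDerivAt_pow 2 x).const_mul 1050)).add ((hasDerivAt_pow 4 x).const_mul 225))
      refine HasDerivAt.congr_deriv h ?_
      simp [Pi.add_apply]; ring
  have hmono : Monotone f := by
    refine monotone_of_deriv_nonneg (fun x => (hder x).differentiableAt) (fun x => ?_)
    rw [(hder x).deriv]
    have hQ : 0 < (945 + 1050 * x ^ 2 + 225 * x ^ 4) := by positivity
    have hR : 0 < 1 + x ^ 2 := by positivity
    rw [sub_nonneg, div_le_div_iff₀ hR (by positivity)]
    have : 0 ≤ x ^ 10 := by positivity
    nlinarith
  have := hmono ht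
  simp only [hf] at this
  simp at this
  linarith

/-- the support-sphere constraints, in squared edges scaled by `5741 ^ 2` -/
def FMc (a b c x y z : ℝ) : Prop :=
  ∀ p q s t : ℝ, p + q + s + t = 1 → -45 / 64 ≤ p → p ≤ 1 →
    p * q * a + p * s * b + p * t * c + q * s * x + q * t * y + s * t * z
      ≤ 65918162 * p + 22619538 * (1 - p)

theorem mkLm_spec (n : ℕ) (k : Lm → Bool) (h : mkLm n k false = true) :
    ∃ L : Lm, k L = true ∧ ∀ a b c x y z, FMc a b c x y z → L.val a b c x y z ≤ 0 := by
  simp only [mkLm, force_eq] at h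
  generalize Nat.mod n 512 = n1 at h
  generalize Nat.mod (Nat.div n 512) 512 = n2 at h
  generalize Nat.mod (Nat.div n 262144) 128 = n0 at h
  cases hb : Nat.ble n0 109 with
  | false => rw [hb] at h; simp at h
  | true =>
    rw [hb] at h
    have hn : n0 ≤ 109 := Nat.ble_eq.mp hb
    refine ⟨_, h, ?_⟩
    intro a b c x y z hF
    have key := hF (((n0:ℝ) - 45) / 64) (((n1:ℝ) - 256) / 64) (((n2:ℝ) - 256) / 64)
      ((621 - ((n0:ℝ) + n1 + n2)) / 64) (by ring)
      (by have : (0:ℝ) ≤ n0 := Nat.cast_nonneg _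
          linarith)
      (by have : (n0:ℝ) ≤ 109 := by exact_mod_cast hn
          linarith)
    have d : ∀ A B : ℕ, ((Nat.sub A B : ℕ):ℝ) = (A:ℝ) - B + ((Nat.sub B A : ℕ):ℝ) := by
      intro A B
      simp only [Nat.sub_eq]
      rcases le_total A B with h | h
      · rw [Nat.sub_eq_zero_of_le h, Nat.cast_sub h]; simp
      · rw [Nat.sub_eq_zero_of_le h, Nat.cast_sub h]; simp
    have e109 : ((Nat.sub 109 n0 : ℕ):ℝ) = 109 - (n0:ℝ) := by
      simp only [Nat.sub_eq]; rw [Nat.cast_sub hn]; norm_num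
    have e0 := d n0 45
    have e1 := d n1 256
    have e2 := d n2 256
    have e3 := d 621 (Nat.add (Nat.add n0 n1) n2)
    unfold Lm.val
    simp only [Nat.add_eq, Nat.mul_eq, Nat.cast_add, Nat.cast_mul, Nat.cast_ofNat, e109] at *
    rw [e0, e1, e2, e3]
    linear_combination 4096 * key

theorem leafF_spec (n : ℕ) (B : Bx) (a b c x y z : ℝ) (hB : B.Mem a b c x y z)
    (hF : FMc (a * a) (b * b) (c * c) (x * x) (y * y) (z * z)) : leafF n B ≠ true := by
  intro h
  obtain ⟨L, h1, h2⟩ := mkLm_spec _ _ h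
  have h2 := h2 _ _ _ _ _ _ hF
  obtain ⟨al, ah, bl, bh, cl, ch, xl, xh, yl, yh, zl, zh⟩ := hB
  have h3 := Nat.le_of_ble_eq_true h1
  have h4 : _ < _ := Nat.lt_of_succ_le h3
  have h5 := (Nat.cast_lt (α := ℝ)).mpr h4
  simp only [Nat.add_eq, Nat.mul_eq, Nat.cast_add, Nat.cast_mul] at h5
  unfold Lm.val at h2
  have q : ∀ (l h : ℕ) (e : ℝ), (l:ℝ) ≤ e → e ≤ h → (l:ℝ) * l ≤ e * e ∧ e * e ≤ h * h := by
    intro l h e h1 h2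
    have : (0:ℝ) ≤ l := Nat.cast_nonneg _
    exact ⟨mul_self_le_mul_self this h1, mul_self_le_mul_self (this.trans h1) h2⟩
  have s : ∀ (p n l h : ℕ) (e : ℝ), (l:ℝ) ≤ e → e ≤ h →
      (p:ℝ) * (l * l) - n * (h * h) ≤ ((p:ℝ) - n) * (e * e) := by
    intro p n l h e h1 h2
    have := q l h e h1 h2
    have i1 := mul_le_mul_of_nonneg_left this.1 (Nat.cast_nonneg (α := ℝ) p)
    have i2 := mul_le_mul_of_nonneg_left this.2 (Nat.cast_nonneg (α := ℝ) n)
    linarith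
  have := s L.ap L.an _ _ a al ah
  have := s L.bp L.bn _ _ b bl bh
  have := s L.cp L.cn _ _ c cl ch
  have := s L.xp L.xn _ _ x xl xh
  have := s L.yp L.yn _ _ y yl yh
  have := s L.zp L.zn _ _ z zl zh
  linarith

theorem div_floor_le (A B : ℕ) : (A:ℝ) / B ≤ ((Nat.div A B : ℕ):ℝ) + 1 := by
  have h : Nat.div A B = ⌊(A:ℝ) / B⌋₊ := (Nat.floor_div_eq_div A B).symm
  rw [h]
  exact (Nat.lt_floor_add_one _).le

theorem floor_le_div (A B : ℕ) : ((Nat.div A B : ℕ):ℝ) ≤ (A:ℝ) / B := by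
  have h : Nat.div A B = A / B := rfl
  rw [h]
  exact Nat.cast_div_le

theorem kA_spec (w j : ℕ) :
    (w:ℝ) * (35184372088832 * 189218084021) / (1024 + (j:ℝ) * j) ≤ kA w j := by
  have h := div_floor_le (w * (35184372088832 * 189218084021)) (1024 + j * j)
  have e : ((kA w j : ℕ):ℝ) = ((Nat.div (w * (35184372088832 * 189218084021)) (1024 + j * j) : ℕ):ℝ) + 1 := by
    exact_mod_cast rfl
  rw [e]
  simp only [Nat.cast_mul, Nat.cast_add, Nat.cast_ofNat] at h
  exact h

/-- constant term of the tangent-line upper bound at `j / 32` -/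
noncomputable def ctan (j : ℕ) : ℝ :=
  (j:ℝ) * (990904320 + j * j * (752640 + 64 * (j * j))) /
    (32 * (990904320 + (j:ℝ) * j * (1075200 + 225 * (j * j)))) - 32 * j / (1024 + (j:ℝ) * j)

theorem cA_spec (w j : ℕ) : (w:ℝ) * 17179869184 * ctan j ≤ cA w j := by
  have h1 := div_floor_le (w * 17179869184 * (j * (990904320 + j * j * (752640 + 64 * (j * j)))))
    (32 * (990904320 + j * j * (1075200 + 225 * (j * j))))
  have h2 := floor_le_div (w * 17179869184 * (32 * j)) (1024 + j * j)
  have h3 := cast_sub_ge (Nat.div (w * 17179869184 * (j * (990904320 + j * j * (752640 + 64 * (j * j)))))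
    (32 * (990904320 + j * j * (1075200 + 225 * (j * j)))) + 1)
    (Nat.div (w * 17179869184 * (32 * j)) (1024 + j * j))
  refine le_trans ?_ h3
  push_cast at h1 h2 ⊢
  unfold ctan
  rw [mul_sub]
  have e1 : (w:ℝ) * 17179869184 * (↑j * (990904320 + ↑j * ↑j * (752640 + 64 * (↑j * ↑j))) /
          (32 * (990904320 + ↑j * ↑j * (1075200 + 225 * (↑j * ↑j)))))
        = ↑w * 17179869184 * (↑j * (990904320 + ↑j * ↑j * (752640 + 64 * (↑j * ↑j)))) /
      (32 * (990904320 + ↑j * ↑j * (1075200 + 225 * (↑j * ↑j)))) := by ring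
  have e2 : (w:ℝ) * 17179869184 * (32 * ↑j / (1024 + ↑j * ↑j))
    = ↑w * 17179869184 * (32 * ↑j) / (1024 + ↑j * ↑j) := by ring
  rw [e1, e2]
  linarith

theorem ctan_zero : ctan 0 = 0 := by norm_num [ctan]

theorem arctan_le_ctan (j : ℕ) (t : ℝ) (ht : 0 ≤ t) :
    Real.arctan t ≤ ctan j + t * (1024 / (1024 + (j:ℝ) * j)) := by
  have hj : (0:ℝ) ≤ j := Nat.cast_nonneg _
  have h1 := arctan_tangent t ((j:ℝ) / 32) ht (by positivity)
  have h2 := arctan_pade ((j:ℝ) / 32) (by positivity)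
  have e1 : (j:ℝ) / 32 * (945 + 735 * ((j:ℝ) / 32) ^ 2 + 64 * ((j:ℝ) / 32) ^ 4) /
      (945 + 1050 * ((j:ℝ) / 32) ^ 2 + 225 * ((j:ℝ) / 32) ^ 4) =
      (j:ℝ) * (990904320 + j * j * (752640 + 64 * (j * j))) /
    (32 * (990904320 + (j:ℝ) * j * (1075200 + 225 * (j * j)))) := by
    rw [div_eq_div_iff (by positivity) (by positivity)]
    ring
  have e2 : (t - (j:ℝ) / 32) / (1 + ((j:ℝ) / 32) ^ 2) =
      t * (1024 / (1024 + (j:ℝ) * j)) - 32 * j / (1024 + (j:ℝ) * j) := by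
    field_simp
    ring
  rw [e1] at h2
  rw [e2] at h1
  unfold ctan
  linarith

theorem vertex_bound (w j l h : ℕ) (V d : ℝ) (hV : 0 < V) (hl : 1 ≤ l) (h1 : (l:ℝ) ≤ d)
    (h2 : d ≤ h) :
    (2:ℝ) ^ 64 * 189218084021 * ((w:ℝ) / 2 ^ 30 * Real.arctan (2 * V / d)) ≤
      189218084021 * ((w:ℝ) * 17179869184 * ctan j) +
      V * (((Nat.div (kA w j) l : ℕ):ℝ) + ((Nat.div (kA w j) h : ℕ):ℝ) + 2 -
        ((Nat.div (kA w j) (Nat.mul l h) : ℕ):ℝ) * d) := by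
  have hl0 : (0:ℝ) < l := by exact_mod_cast hl
  have hd : 0 < d := hl0.trans_le h1
  have hh : (0:ℝ) < h := hd.trans_le h2
  have a1 := arctan_le_ctan j (2 * V / d) (by positivity)
  have a2 : (2:ℝ) ^ 64 * 189218084021 * ((w:ℝ) / 2 ^ 30 * Real.arctan (2 * V / d)) ≤
      (2:ℝ) ^ 64 * 189218084021 * ((w:ℝ) / 2 ^ 30 *
        (ctan j + 2 * V / d * (1024 / (1024 + (j:ℝ) * j)))) := by gcongr
  refine a2.trans ?_
  have e1 : (2:ℝ) ^ 64 * 189218084021 * ((w:ℝ) / 2 ^ 30 *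
        (ctan j + 2 * V / d * (1024 / (1024 + (j:ℝ) * j)))) =
      189218084021 * ((w:ℝ) * 17179869184 * ctan j) +
      V * (((w:ℝ) * (35184372088832 * 189218084021) / (1024 + (j:ℝ) * j)) / d) := by
    field_simp
    ring
  rw [e1]
  have hk := kA_spec w j
  gcongr
  generalize kA w j = A at *
  have hA : (0:ℝ) ≤ A := Nat.cast_nonneg _
  have b1 : ((w:ℝ) * (35184372088832 * 189218084021) / (1024 + (j:ℝ) * j)) / d ≤ A / d := by gcongr
  refine b1.trans ?_
  have b2 : (A:ℝ) / d ≤ A / l + A / h - A / (l * h) * d := by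
    have : (A:ℝ) / l + A / h - A / (l * h) * d - A / d = A * ((d - l) * (h - d)) / (l * h * d) := by
      field_simp
      ring
    have h3 : 0 ≤ A * ((d - l) * (h - d)) / (l * h * d) := by
      have := sub_nonneg.mpr h1
      have := sub_nonneg.mpr h2
      positivity
    linarith
  have b3 := div_floor_le A l
  have b4 := div_floor_le A h
  have b5 := floor_le_div A (Nat.mul l h)
  rw [show ((Nat.mul l h : ℕ):ℝ) = l * h by simp [Nat.mul_eq]] at b5
  have b6 := mul_le_mul_of_nonneg_right b5 hd.le
  linarith

/-- the conclusion of the certificate for one tetrahedron (scaled edges) -/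
def Good (a b c x y z : ℝ) : Prop :=
  0 < dd a b c z y x ∧ 0 < dd a x y z c b ∧ 0 < dd b x z y c a ∧ 0 < dd c y z x b a ∧
  ∀ V : ℝ, 0 < V → 4 * V ^ 2 = ww (a * a) (b * b) (c * c) (x * x) (y * y) (z * z) →
    (2:ℝ) ^ 64 * 189218084021 * (Real.arctan (2 * V / dd a b c z y x) + 76308482 / 2 ^ 30 *
      (Real.arctan (2 * V / dd a x y z c b) + Real.arctan (2 * V / dd b x z y c a) +
       Real.arctan (2 * V / dd c y z x b a))) ≤ 3719335000000000000 * V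

theorem dlow_spec (k0 k1 k2 k3 m : ℕ) (L : Lm) (B : Bx) (a b c x y z : ℝ)
    (hB : B.Mem a b c x y z) (h1 : 1 ≤ dlow k0 k1 k2 k3 m L B)
    (hL : L.val (a * a) (b * b) (c * c) (x * x) (y * y) (z * z) ≤ 0) :
    ((dlow k0 k1 k2 k3 m L B : ℕ):ℝ) * 8192 ≤ k0 * dd a b c z y x + k1 * dd a x y z c b
      + k2 * dd b x z y c a + k3 * dd c y z x b a := by
  have e : dlow k0 k1 k2 k3 m L B = lbD k0 k1 k2 k3 m L B / 8192 := rfl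
  have h2 : 1 ≤ lbD k0 k1 k2 k3 m L B := by
    rw [e] at h1; omega
  have h3 := lbD_spec k0 k1 k2 k3 m L B a b c x y z hB h2
  have h4 : ((dlow k0 k1 k2 k3 m L B : ℕ):ℝ) * 8192 ≤ ((lbD k0 k1 k2 k3 m L B : ℕ):ℝ) := by
    have : dlow k0 k1 k2 k3 m L B * 8192 ≤ lbD k0 k1 k2 k3 m L B := by
      rw [e]; omega
    exact_mod_cast this
  have h5 : (m:ℝ) * L.val (a * a) (b * b) (c * c) (x * x) (y * y) (z * z) ≤ 0 :=
    mul_nonpos_of_nonneg_of_nonpos (Nat.cast_nonneg _) hL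
  linarith

theorem dup_spec (al ah bl bh cl ch xl yl zl : ℕ) (a b c x y z : ℝ)
    (h1 : (al:ℝ) ≤ a) (h2 : a ≤ ah) (h3 : (bl:ℝ) ≤ b) (h4 : b ≤ bh) (h5 : (cl:ℝ) ≤ c)
    (h6 : c ≤ ch) (h7 : (xl:ℝ) ≤ x) (h8 : (yl:ℝ) ≤ y) (h9 : (zl:ℝ) ≤ z) :
    dd a b c x y z ≤ ((Nat.sub (d2p ah bh ch) (d2n al bl cl xl yl zl) : ℕ):ℝ) := by
  refine le_trans ?_ (cast_sub_ge _ _)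
  simp only [d2p, d2n, Nat.add_eq, Nat.mul_eq, Nat.cast_add, Nat.cast_mul]
  have a0 : (0:ℝ) ≤ al := Nat.cast_nonneg _
  have b0 : (0:ℝ) ≤ bl := Nat.cast_nonneg _
  have c0 : (0:ℝ) ≤ cl := Nat.cast_nonneg _
  have x0 : (0:ℝ) ≤ xl := Nat.cast_nonneg _
  have y0 : (0:ℝ) ≤ yl := Nat.cast_nonneg _
  have z0 : (0:ℝ) ≤ zl := Nat.cast_nonneg _
  have a1 := a0.trans h1
  have b1 := b0.trans h3
  have c1 := c0.trans h5
  have x1 := x0.trans h7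
  have y1 := y0.trans h8
  have z1 := z0.trans h9
  unfold dd
  gcongr

theorem sqBx_spec (B : Bx) (k : Bx → ℕ) (a b c x y z : ℝ) (hB : B.Mem a b c x y z) :
    ∃ B' : Bx, sqBx B k = k B' ∧ B'.Mem (a * a) (b * b) (c * c) (x * x) (y * y) (z * z) := by
  refine ⟨_, by simp only [sqBx, force_eq]; rfl, ?_⟩
  obtain ⟨al, ah, bl, bh, cl, ch, xl, xh, yl, yh, zl, zh⟩ := hB
  have q : ∀ (l h : ℕ) (e : ℝ), (l:ℝ) ≤ e → e ≤ h →
      ((Nat.mul l l : ℕ):ℝ) ≤ e * e ∧ e * e ≤ ((Nat.mul h h : ℕ):ℝ) := by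
    intro l h e h1 h2
    simp only [Nat.mul_eq, Nat.cast_mul]
    have : (0:ℝ) ≤ l := Nat.cast_nonneg _
    exact ⟨mul_self_le_mul_self this h1, mul_self_le_mul_self (this.trans h1) h2⟩
  exact ⟨(q _ _ _ al ah).1, (q _ _ _ al ah).2, (q _ _ _ bl bh).1, (q _ _ _ bl bh).2,
    (q _ _ _ cl ch).1, (q _ _ _ cl ch).2, (q _ _ _ xl xh).1, (q _ _ _ xl xh).2,
    (q _ _ _ yl yh).1, (q _ _ _ yl yh).2, (q _ _ _ zl zh).1, (q _ _ _ zl zh).2⟩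

theorem brec_true {X b : Bool} (h : @Bool.rec (fun _ => Bool) false X b = true) :
    b = true ∧ X = true := by
  cases b
  · simp at h
  · exact ⟨rfl, h⟩

theorem leafN_core (j0 j1 j2 j3 v mf mW m0 m1 m2 m3 : ℕ) (L : Lm) (B : Bx) (a b c x y z : ℝ)
    (hB : B.Mem a b c x y z)
    (hL : L.val (a * a) (b * b) (c * c) (x * x) (y * y) (z * z) ≤ 0)
    (h : (
    force (cA wA j0 ⊹ cA wB j1 ⊹ cA wB j2 ⊹ cA wB j3) fun c =>
    @Bool.rec (fun _ => Bool) false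
    (force (dlow 8192 0 0 0 m0 L B) fun l0 => force (dlow 0 8192 0 0 m1 L B) fun l1 =>
    force (dlow 0 0 8192 0 m2 L B) fun l2 => force (dlow 0 0 0 8192 m3 L B) fun l3 =>
    @Bool.rec (fun _ => Bool) false
    (force (d2p B.ah B.bh B.ch ∸ d2n B.al B.bl B.cl B.zl B.yl B.xl) fun h0 =>
    force (d2p B.ah B.xh B.yh ∸ d2n B.al B.xl B.yl B.zl B.cl B.bl) fun h1 =>
    force (d2p B.bh B.xh B.zh ∸ d2n B.bl B.xl B.zl B.yl B.cl B.al) fun h2 =>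
    force (d2p B.ch B.yh B.zh ∸ d2n B.cl B.yl B.zl B.xl B.bl B.al) fun h3 =>
    force (kA wA j0) fun A0 => force (kA wB j1) fun A1 => force (kA wB j2) fun A2 =>
    force (kA wB j3) fun A3 =>
    force (A0 ÷ (l0 ⋆ h0)) fun k0 => force (A1 ÷ (l1 ⋆ h1)) fun k1 =>
    force (A2 ÷ (l2 ⋆ h2)) fun k2 => force (A3 ÷ (l3 ⋆ h3)) fun k3 =>
    force (A0 ÷ l0 ⊹ A0 ÷ h0 ⊹ A1 ÷ l1 ⊹ A1 ÷ h1 ⊹ A2 ÷ l2 ⊹ A2 ÷ h2 ⊹ A3 ÷ l3 ⊹ A3 ÷ h3 ⊹ 9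
      ⊹ nite (Nat.ble 1 (j0 ⊹ j1 ⊹ j2 ⊹ j3)) (c ⋆ 189218084021 ÷ v ⊹ 1) 0) fun K =>
    force (lbD k0 k1 k2 k3 mf L B) fun q =>
    Nat.ble 1 q && Nat.ble K (3719335000000000000 ⊹ q))
    (Nat.ble 1 l0 && Nat.ble 1 l1 && Nat.ble 1 l2 && Nat.ble 1 l3))
    (Nat.ble (j0 ⊹ j1 ⊹ j2 ⊹ j3) 0 || (Nat.ble 1 v && Nat.ble (16384 ⋆ (v ⋆ v)) (sqBx B (lbW 4096 mW L))))) = true) :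
    Good a b c x y z := by
  simp only [force_eq] at h
  obtain ⟨hc1, h⟩ := brec_true h
  obtain ⟨hc2, h⟩ := brec_true h
  rw [Bool.and_eq_true] at h
  obtain ⟨hq, hK⟩ := h
  simp only [Bool.and_eq_true] at hc2
  obtain ⟨⟨⟨l0, l1⟩, l2⟩, l3⟩ := hc2
  have l0 := Nat.le_of_ble_eq_true l0
  have l1 := Nat.le_of_ble_eq_true l1
  have l2 := Nat.le_of_ble_eq_true l2
  have l3 := Nat.le_of_ble_eq_true l3
  have hq := Nat.le_of_ble_eq_true hq
  have hK := Nat.le_of_ble_eq_true hK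
  have d0 := dlow_spec _ _ _ _ _ _ _ _ _ _ _ _ _ hB l0 hL
  have d1 := dlow_spec _ _ _ _ _ _ _ _ _ _ _ _ _ hB l1 hL
  have d2 := dlow_spec _ _ _ _ _ _ _ _ _ _ _ _ _ hB l2 hL
  have d3 := dlow_spec _ _ _ _ _ _ _ _ _ _ _ _ _ hB l3 hL
  have hD := lbD_spec _ _ _ _ _ _ _ _ _ _ _ _ _ hB hq
  have u0 := dup_spec _ _ _ _ _ _ _ _ _ a b c z y x hB.al hB.ah hB.bl hB.bh hB.cl hB.ch hB.zl hB.yl hB.xl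
  have u1 := dup_spec _ _ _ _ _ _ _ _ _ a x y z c b hB.al hB.ah hB.xl hB.xh hB.yl hB.yh hB.zl hB.cl hB.bl
  have u2 := dup_spec _ _ _ _ _ _ _ _ _ b x z y c a hB.bl hB.bh hB.xl hB.xh hB.zl hB.zh hB.yl hB.cl hB.al
  have u3 := dup_spec _ _ _ _ _ _ _ _ _ c y z x b a hB.cl hB.ch hB.yl hB.yh hB.zl hB.zh hB.xl hB.bl hB.al
  have hw : ∀ V : ℝ, 0 < V → 4 * V ^ 2 = ww (a * a) (b * b) (c * c) (x * x) (y * y) (z * z) →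
      ∀ v mW : ℕ, (Nat.ble 1 v && Nat.ble (Nat.mul 16384 (Nat.mul v v)) (sqBx B (lbW 4096 mW L))) = true →
      1 ≤ v ∧ (v:ℝ) ≤ V := by
    intro V hV hVw v mW hv
    rw [Bool.and_eq_true] at hv
    have hv1 := Nat.le_of_ble_eq_true hv.1
    have hv2 := Nat.le_of_ble_eq_true hv.2
    obtain ⟨B', e, hB'⟩ := sqBx_spec B (lbW 4096 mW L) a b c x y z hB
    rw [e] at hv2
    have hv3 : 16384 * (v * v) ≤ lbW 4096 mW L B' := hv2
    have hv4 : 1 ≤ v * v := Nat.mul_le_mul hv1 hv1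
    have hv5 := lbW_spec 4096 mW L B' _ _ _ _ _ _ hB' (by omega)
    have hv6 : (16384 * ((v:ℝ) * v)) ≤ (lbW 4096 mW L B' : ℕ) := by exact_mod_cast hv3
    have hv7 : (mW:ℝ) * L.val (a * a) (b * b) (c * c) (x * x) (y * y) (z * z) ≤ 0 :=
      mul_nonpos_of_nonneg_of_nonpos (Nat.cast_nonneg _) hL
    refine ⟨hv1, ?_⟩
    rw [← hVw] at hv5
    push_cast at hv5
    have hv8 : (v:ℝ) ^ 2 ≤ V ^ 2 := by
      have := hv6.trans hv5
      linarith [this, hv7]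
    exact (sq_le_sq₀ (Nat.cast_nonneg _) hV.le).mp hv8
  have hmf : ∀ m : ℕ, (m:ℝ) * L.val (a * a) (b * b) (c * c) (x * x) (y * y) (z * z) ≤ 0 :=
    fun m => mul_nonpos_of_nonneg_of_nonpos (Nat.cast_nonneg _) hL
  have hmf := hmf mf
  generalize dlow 8192 0 0 0 _ L B = L0 at *
  generalize dlow 0 8192 0 0 _ L B = L1 at *
  generalize dlow 0 0 8192 0 _ L B = L2 at *
  generalize dlow 0 0 0 8192 _ L B = L3 at *
  simp only [Nat.cast_ofNat, Nat.cast_zero, zero_mul, add_zero, zero_add] at d0 d1 d2 d3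
  have d0 : (L0:ℝ) ≤ dd a b c z y x := by linarith
  have d1 : (L1:ℝ) ≤ dd a x y z c b := by linarith
  have d2 : (L2:ℝ) ≤ dd b x z y c a := by linarith
  have d3 : (L3:ℝ) ≤ dd c y z x b a := by linarith
  have p0 : (0:ℝ) < L0 := by exact_mod_cast l0
  have p1 : (0:ℝ) < L1 := by exact_mod_cast l1
  have p2 : (0:ℝ) < L2 := by exact_mod_cast l2
  have p3 : (0:ℝ) < L3 := by exact_mod_cast l3
  refine ⟨p0.trans_le d0, p1.trans_le d1, p2.trans_le d2, p3.trans_le d3, ?_⟩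
  intro V hV hVw
  have hw := hw V hV hVw
  generalize Nat.sub (d2p B.ah B.bh B.ch) _ = H0 at *
  generalize Nat.sub (d2p B.ah B.xh B.yh) _ = H1 at *
  generalize Nat.sub (d2p B.bh B.xh B.zh) _ = H2 at *
  generalize Nat.sub (d2p B.ch B.yh B.zh) _ = H3 at *
  have b0 := vertex_bound wA j0 L0 H0 V _ hV l0 d0 u0
  have b1 := vertex_bound wB j1 L1 H1 V _ hV l1 d1 u1
  have b2 := vertex_bound wB j2 L2 H2 V _ hV l2 d2 u2
  have b3 := vertex_bound wB j3 L3 H3 V _ hV l3 d3 u3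
  have c0 := cA_spec wA j0
  have c1 := cA_spec wB j1
  have c2 := cA_spec wB j2
  have c3 := cA_spec wB j3
  -- the constant term
  have hC : 189218084021 * ((wA:ℝ) * 17179869184 * ctan j0) + 189218084021 * ((wB:ℝ) * 17179869184 * ctan j1)
     + 189218084021 * ((wB:ℝ) * 17179869184 * ctan j2) + 189218084021 * ((wB:ℝ) * 17179869184 * ctan j3) ≤
     V * ((nite (Nat.ble 1 (j0⊹j1⊹j2⊹j3))
                        ((cA wA j0⊹cA wB j1⊹cA wB j2⊹cA wB j3)⋆189218084021÷v⊹1) 0 : ℕ):ℝ) := by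
    rcases Nat.eq_zero_or_pos (j0⊹j1⊹j2⊹j3) with hj | hj
    · rw [hj]
      simp only [Nat.add_eq] at hj
      have e0 : j0 = 0 := by omega
      have e1 : j1 = 0 := by omega
      have e2 : j2 = 0 := by omega
      have e3 : j3 = 0 := by omega
      subst e0 e1 e2 e3
      rw [ctan_zero]
      simp only [mul_zero, add_zero]
      exact mul_nonneg hV.le (Nat.cast_nonneg _)
    · have hj1 : Nat.ble 1 (j0⊹j1⊹j2⊹j3) = true := Nat.ble_eq.mpr hj
      have hj2 : Nat.ble (j0⊹j1⊹j2⊹j3) 0 = false := by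
        by_contra hc
        have := Nat.le_of_ble_eq_true (Bool.eq_true_of_not_eq_false hc)
        omega
      rw [hj2, Bool.false_or] at hc1
      obtain ⟨v1, v2⟩ := hw v mW hc1
      rw [hj1]
      have hv0 : (0:ℝ) < v := by exact_mod_cast v1
      have f := div_floor_le ((cA wA j0⊹cA wB j1⊹cA wB j2⊹cA wB j3)⋆189218084021) v
      have g : ((nite true
                        ((cA wA j0⊹cA wB j1⊹cA wB j2⊹cA wB j3)⋆189218084021÷v⊹1) 0 : ℕ):ℝ) =
         (((cA wA j0⊹cA wB j1⊹cA wB j2⊹cA wB j3)⋆189218084021÷v : ℕ):ℝ) + 1 := by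
        simp [nite, Nat.add_eq]
      rw [g]
      have f2 := mul_le_mul_of_nonneg_left f hV.le
      refine le_trans ?_ f2
      simp only [Nat.add_eq, Nat.mul_eq, Nat.cast_add, Nat.cast_mul, Nat.cast_ofNat]
      have f3 : ((cA wA j0:ℝ) + cA wB j1 + cA wB j2 + cA wB j3) * 189218084021 ≤
          V * (((cA wA j0:ℝ) + cA wB j1 + cA wB j2 + cA wB j3) * 189218084021 / v) := by
        rw [← mul_div_assoc, le_div_iff₀ hv0, mul_comm]
        have : (0:ℝ) ≤ ((cA wA j0:ℝ) + cA wB j1 + cA wB j2 + cA wB j3) * 189218084021 := by positivity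
        gcongr
      linarith
  have hK' := (Nat.cast_le (α := ℝ)).mpr hK
  generalize nite _ _ 0 = cc at *
  generalize lbD _ _ _ _ _ _ _ = q at *
  have wA' : ((wA:ℕ):ℝ) = 2 ^ 30 := by norm_num [wA]
  have wB' : ((wB:ℕ):ℝ) = 76308482 := by norm_num [wB]
  generalize kA wA j0 = A0 at *
  generalize kA wB j1 = A1 at *
  generalize kA wB j2 = A2 at *
  generalize kA wB j3 = A3 at *
  simp only [Nat.add_eq, Nat.cast_add, Nat.cast_ofNat] at hK'
  rw [wA', div_self (by norm_num), one_mul] at b0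
  rw [wB'] at b1 b2 b3
  rw [wA', wB'] at hC
  have fin := add_le_add (add_le_add (add_le_add b0 b1) (add_le_add b2 b3)) hC
  have fin2 := mul_le_mul_of_nonneg_left (hK'.trans (add_le_add_right (hD.trans (add_le_of_nonpos_right hmf)) _)) hV.le
  linarith [fin, fin2, hV]

theorem leafN_spec (n : ℕ) (B : Bx) (a b c x y z : ℝ) (hB : B.Mem a b c x y z)
    (hF : FMc (a * a) (b * b) (c * c) (x * x) (y * y) (z * z)) (h : leafN n B = true) :
    Good a b c x y z := by
  unfold leafN at h
  iterate 13 rw [force_eq] at h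
  obtain ⟨L, h, hL⟩ := mkLm_spec _ _ h
  exact leafN_core _ _ _ _ _ _ _ _ _ _ _ L B a b c x y z hB (hL _ _ _ _ _ _ hF) h

theorem chk_spec (T : CT) : ∀ (B : Bx) (a b c x y z : ℝ), B.Mem a b c x y z →
    FMc (a * a) (b * b) (c * c) (x * x) (y * y) (z * z) → x ≤ z → y ≤ z → b ≤ c →
    T.chk B = true →
    (a ≤ 8291 ∧ b ≤ 8291 ∧ c ≤ 8291 ∧ x ≤ 4928 ∧ y ≤ 4928 ∧ z ≤ 4928) ∨ Good a b c x y z := by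
  induction T with
  | a s t ihs iht =>
    intro B a b c x y z hB hF h1 h2 h3 h
    simp only [CT.chk, force_eq, Bool.and_eq_true] at h
    rcases le_total a ((Nat.div (Nat.add B.al B.ah) 2 : ℕ):ℝ) with hm | hm
    · refine ihs _ a b c x y z ?_ hF h1 h2 h3 h.1
      exact ⟨hB.al, hm, hB.bl, hB.bh, hB.cl, hB.ch, hB.xl, hB.xh, hB.yl, hB.yh, hB.zl, hB.zh⟩
    · refine iht _ a b c x y z ?_ hF h1 h2 h3 h.2
      exact ⟨hm, hB.ah, hB.bl, hB.bh, hB.cl, hB.ch, hB.xl, hB.xh, hB.yl, hB.yh, hB.zl, hB.zh⟩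
  | b s t ihs iht =>
    intro B a b c x y z hB hF h1 h2 h3 h
    simp only [CT.chk, force_eq, Bool.and_eq_true] at h
    rcases le_total b ((Nat.div (Nat.add B.bl B.bh) 2 : ℕ):ℝ) with hm | hm
    · refine ihs _ a b c x y z ?_ hF h1 h2 h3 h.1
      exact ⟨hB.al, hB.ah, hB.bl, hm, hB.cl, hB.ch, hB.xl, hB.xh, hB.yl, hB.yh, hB.zl, hB.zh⟩
    · refine iht _ a b c x y z ?_ hF h1 h2 h3 h.2
      exact ⟨hB.al, hB.ah, hm, hB.bh, hB.cl, hB.ch, hB.xl, hB.xh, hB.yl, hB.yh, hB.zl, hB.zh⟩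
  | c s t ihs iht =>
    intro B a b c x y z hB hF h1 h2 h3 h
    simp only [CT.chk, force_eq, Bool.and_eq_true] at h
    rcases le_total c ((Nat.div (Nat.add B.cl B.ch) 2 : ℕ):ℝ) with hm | hm
    · refine ihs _ a b c x y z ?_ hF h1 h2 h3 h.1
      exact ⟨hB.al, hB.ah, hB.bl, hB.bh, hB.cl, hm, hB.xl, hB.xh, hB.yl, hB.yh, hB.zl, hB.zh⟩
    · refine iht _ a b c x y z ?_ hF h1 h2 h3 h.2
      exact ⟨hB.al, hB.ah, hB.bl, hB.bh, hm, hB.ch, hB.xl, hB.xh, hB.yl, hB.yh, hB.zl, hB.zh⟩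
  | d s t ihs iht =>
    intro B a b c x y z hB hF h1 h2 h3 h
    simp only [CT.chk, force_eq, Bool.and_eq_true] at h
    rcases le_total x ((Nat.div (Nat.add B.xl B.xh) 2 : ℕ):ℝ) with hm | hm
    · refine ihs _ a b c x y z ?_ hF h1 h2 h3 h.1
      exact ⟨hB.al, hB.ah, hB.bl, hB.bh, hB.cl, hB.ch, hB.xl, hm, hB.yl, hB.yh, hB.zl, hB.zh⟩
    · refine iht _ a b c x y z ?_ hF h1 h2 h3 h.2
      exact ⟨hB.al, hB.ah, hB.bl, hB.bh, hB.cl, hB.ch, hm, hB.xh, hB.yl, hB.yh, hB.zl, hB.zh⟩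
  | e s t ihs iht =>
    intro B a b c x y z hB hF h1 h2 h3 h
    simp only [CT.chk, force_eq, Bool.and_eq_true] at h
    rcases le_total y ((Nat.div (Nat.add B.yl B.yh) 2 : ℕ):ℝ) with hm | hm
    · refine ihs _ a b c x y z ?_ hF h1 h2 h3 h.1
      exact ⟨hB.al, hB.ah, hB.bl, hB.bh, hB.cl, hB.ch, hB.xl, hB.xh, hB.yl, hm, hB.zl, hB.zh⟩
    · refine iht _ a b c x y z ?_ hF h1 h2 h3 h.2
      exact ⟨hB.al, hB.ah, hB.bl, hB.bh, hB.cl, hB.ch, hB.xl, hB.xh, hm, hB.yh, hB.zl, hB.zh⟩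
  | f s t ihs iht =>
    intro B a b c x y z hB hF h1 h2 h3 h
    simp only [CT.chk, force_eq, Bool.and_eq_true] at h
    rcases le_total z ((Nat.div (Nat.add B.zl B.zh) 2 : ℕ):ℝ) with hm | hm
    · refine ihs _ a b c x y z ?_ hF h1 h2 h3 h.1
      exact ⟨hB.al, hB.ah, hB.bl, hB.bh, hB.cl, hB.ch, hB.xl, hB.xh, hB.yl, hB.yh, hB.zl, hm⟩
    · refine iht _ a b c x y z ?_ hF h1 h2 h3 h.2
      exact ⟨hB.al, hB.ah, hB.bl, hB.bh, hB.cl, hB.ch, hB.xl, hB.xh, hB.yl, hB.yh, hm, hB.zh⟩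
  | y =>
    intro B a b c x y z hB hF h1 h2 h3 h
    exfalso
    simp only [CT.chk, leafY, Bool.or_eq_true] at h
    have q : ∀ p q : ℕ, Nat.blt p q = true → (p:ℝ) < q := by
      intro p q hpq
      exact_mod_cast Nat.lt_of_succ_le (Nat.le_of_ble_eq_true hpq)
    rcases h with (h | h) | h
    · linarith [q _ _ h, hB.zh, hB.xl]
    · linarith [q _ _ h, hB.zh, hB.yl]
    · linarith [q _ _ h, hB.ch, hB.bl]
  | z =>
    intro B a b c x y z hB hF h1 h2 h3 h
    left
    simp only [CT.chk, leafZ, Bool.and_eq_true] at h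
    obtain ⟨⟨⟨⟨⟨ha, hb⟩, hc⟩, hx⟩, hy⟩, hz⟩ := h
    have q : ∀ p : ℕ, ∀ q : ℕ, Nat.ble p q = true → (p:ℝ) ≤ q := by
      intro p q hpq
      exact_mod_cast Nat.le_of_ble_eq_true hpq
    have qa := q _ _ ha
    have qb := q _ _ hb
    have qc := q _ _ hc
    have qx := q _ _ hx
    have qy := q _ _ hy
    have qz := q _ _ hz
    push_cast at qa qb qc qx qy qz
    exact ⟨hB.ah.trans qa, hB.bh.trans qb, hB.ch.trans qc, hB.xh.trans qx, hB.yh.trans qy, hB.zh.trans qz⟩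
  | w k =>
    intro B a b c x y z hB hF h1 h2 h3 h
    exact absurd h (leafF_spec k B a b c x y z hB hF)
  | n k =>
    intro B a b c x y z hB hF h1 h2 h3 h
    exact Or.inr (leafN_spec k B a b c x y z hB hF h)

theorem inv_step (l h d d0 P N : ℝ) (hl : 0 < l) (h1 : l ≤ d) (h2 : d ≤ h) (h0 : 0 < d0)
    (hP : 0 ≤ P) (hN : 0 ≤ N) (hd : d0 + P - N ≤ d) : 1 / d ≤ 1 / d0 + (N / l - P / h) / d0 := by
  have hd0 : 0 < d := hl.trans_le h1
  have e : 1 / d - 1 / d0 = (d0 - d) / d / d0 := by field_simp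
  have e2 : (d0 - d) / d ≤ N / l - P / h := by
    have i1 : (d0 - d) / d ≤ (N - P) / d := div_le_div_of_nonneg_right (by linarith) hd0.le
    have i2 : N / d ≤ N / l := by gcongr
    have i3 : P / h ≤ P / d := by gcongr
    rw [sub_div N P] at i1
    linarith
  have e3 : (d0 - d) / d / d0 ≤ (N / l - P / h) / d0 := by gcongr
  linarith

theorem dd_lower (a b c x y z a0 b0 c0 x0 y0 z0 g n : ℝ) (ha : a0 ≤ a) (hb : b0 ≤ b) (hc : c0 ≤ c)
    (hx : x0 ≤ x) (hy : y0 ≤ y) (hz : z0 ≤ z)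
    (ga : g ≤ (b + c) * (a + a0 + b + c) - x * x)
    (gb : g ≤ (a0 + c) * (b + b0 + a0 + c) - y * y)
    (gc : g ≤ (a0 + b0) * (c + c0 + a0 + b0) - z * z)
    (nx : a0 * (x + x0) ≤ n) (ny : b0 * (y + y0) ≤ n) (nz : c0 * (z + z0) ≤ n) :
    dd a0 b0 c0 x0 y0 z0 + g * ((a - a0) + (b - b0) + (c - c0))
      - n * ((x - x0) + (y - y0) + (z - z0)) ≤ dd a b c x y z := by
  have i1 := mul_le_mul_of_nonneg_left ga (sub_nonneg.mpr ha)
  have i2 := mul_le_mul_of_nonneg_left gb (sub_nonneg.mpr hb)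
  have i3 := mul_le_mul_of_nonneg_left gc (sub_nonneg.mpr hc)
  have i4 := mul_le_mul_of_nonneg_left nx (sub_nonneg.mpr hx)
  have i5 := mul_le_mul_of_nonneg_left ny (sub_nonneg.mpr hy)
  have i6 := mul_le_mul_of_nonneg_left nz (sub_nonneg.mpr hz)
  unfold dd
  linear_combination i1 + i2 + i3 + i4 + i5 + i6

theorem dd_bounds (a b c x y z a1 a2 b1 b2 c1 c2 x1 x2 y1 y2 z1 z2 : ℝ)
    (ha1 : a1 ≤ a) (ha2 : a ≤ a2) (hb1 : b1 ≤ b) (hb2 : b ≤ b2) (hc1 : c1 ≤ c) (hc2 : c ≤ c2)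
    (hx1 : x1 ≤ x) (hx2 : x ≤ x2) (hy1 : y1 ≤ y) (hy2 : y ≤ y2) (hz1 : z1 ≤ z) (hz2 : z ≤ z2)
    (a0 : 0 ≤ a1) (b0 : 0 ≤ b1) (c0 : 0 ≤ c1) (x0 : 0 ≤ x1) (y0 : 0 ≤ y1) (z0 : 0 ≤ z1) :
    (a1 + b1) * (b1 + c1) * (c1 + a1) - (a2 * (x2 * x2) + b2 * (y2 * y2) + c2 * (z2 * z2))
      ≤ dd a b c x y z ∧
    dd a b c x y z ≤
    (a2 + b2) * (b2 + c2) * (c2 + a2) - (a1 * (x1 * x1) + b1 * (y1 * y1) + c1 * (z1 * z1)) := by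
  unfold dd
  have := a0.trans ha1
  have := b0.trans hb1
  have := c0.trans hc1
  have := x0.trans hx1
  have := y0.trans hy1
  have := z0.trans hz1
  have := (a0.trans ha1).trans ha2
  have := (b0.trans hb1).trans hb2
  have := (c0.trans hc1).trans hc2
  have := (x0.trans hx1).trans hx2
  have := (y0.trans hy1).trans hy2
  have := (z0.trans hz1).trans hz2
  constructor <;> gcongr

theorem sqrt2_bounds : (1.41421356 : ℝ) < √2 ∧ √2 < 1.41421357 := by
  constructor
  · rw [Real.lt_sqrt] <;> norm_num
  · rw [Real.sqrt_lt'] <;> norm_num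

theorem arctan_ge (t : ℝ) (ht : 0 ≤ t) : t / (1 + t ^ 2) ≤ Real.arctan t := by
  have h := arctan_tangent 0 t le_rfl ht
  rw [Real.arctan_zero] at h
  have e : (0 - t) / (1 + t ^ 2) = - (t / (1 + t ^ 2)) := by ring
  linarith

/-- the weighted sum of half solid angles -/
noncomputable def Phi (V d0 d1 d2 d3 : ℝ) : ℝ :=
  Real.arctan (2 * V / d0) + (√2 - 1) ^ 3 *
    (Real.arctan (2 * V / d1) + Real.arctan (2 * V / d2) + Real.arctan (2 * V / d3))

/-- tight values -/
noncomputable def dA0 : ℝ := dd √2 √2 √2 (2 * (√2 - 1)) (2 * (√2 - 1)) (2 * (√2 - 1))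
noncomputable def dB0 : ℝ := dd √2 (2 * (√2 - 1)) (2 * (√2 - 1)) (2 * (√2 - 1)) √2 √2

theorem sq2 : √2 * √2 = 2 := Real.mul_self_sqrt (by norm_num)

theorem dA0_bounds : 19.71572 < dA0 ∧ dA0 < 19.71574 := by
  have h := sqrt2_bounds
  have e : dA0 = 52 * √2 * 0 + (8 * (√2 * (√2 * √2)) - 12 * √2 * (√2 * √2 - 2 * √2 + 1)) := by
    unfold dA0 dd; ring
  rw [e, sq2]
  have : 12 * √2 * (2 - 2 * √2 + 1) = 36 * √2 - 24 * (√2 * √2) := by ring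
  rw [this, sq2]
  constructor <;> linarith

theorem dB0_bounds : 4.0487 < dB0 ∧ dB0 < 4.0488 := by
  have h := sqrt2_bounds
  have e : dB0 = 28 * (√2 * √2 * √2) - 72 * (√2 * √2) + 60 * √2 - 16 := by
    unfold dB0 dd; ring
  rw [e, sq2]
  constructor <;> linarith

/-- increase of the squared volume near the tight tetrahedron -/
theorem ww_mono (a b c x y z s p : ℝ) (ha : s ≤ a) (hb : s ≤ b) (hc : s ≤ c)
    (hx : p ≤ x) (hy : p ≤ y) (hz : p ≤ z)
    (ha' : a ≤ 2.0857) (hb' : b ≤ 2.0857) (hc' : c ≤ 2.0857)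
    (hx' : x ≤ 0.7369) (hy' : y ≤ 0.7369) (hz' : z ≤ 0.7369) (hs : s = 2) (hp : 0.6862 ≤ p) :
    p * p * (3 * s - p) ≤ ww a b c x y z := by
  have hp' : p ≤ 0.7369 := hx.trans hx'
  subst hs
  have g1 : 0 ≤ z * (b + x + c + y - a - 2 - z) + (b - c) * (y - x) := by nlinarith
  have g2 : 0 ≤ y * (2 + x + c + z - b - 2 - y) + (2 - c) * (z - x) := by nlinarith
  have g3 : 0 ≤ x * (2 + y + 2 + z - c - 2 - x) + (2 - 2) * (z - y) := by nlinarith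
  have g4 : 0 ≤ 2 * (2 + 2 + y + z - x - p - 2) + (2 - y) * (z - 2) := by nlinarith
  have g5 : 0 ≤ 2 * (2 + 2 + p + z - y - p - 2) + (2 - p) * (z - 2) := by nlinarith
  have g6 : 0 ≤ 2 * (2 + 2 + p + p - z - p - 2) + (2 - p) * (p - 2) := by nlinarith
  have m1 := mul_nonneg (sub_nonneg.mpr ha) g1
  have m2 := mul_nonneg (sub_nonneg.mpr hb) g2
  have m3 := mul_nonneg (sub_nonneg.mpr hc) g3
  have m4 := mul_nonneg (sub_nonneg.mpr hx) g4
  have m5 := mul_nonneg (sub_nonneg.mpr hy) g5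
  have m6 := mul_nonneg (sub_nonneg.mpr hz) g6
  unfold ww
  linear_combination m1 + m2 + m3 + m4 + m5 + m6

theorem dA_near (a b c x y z : ℝ)
    (ha : √2 ≤ a) (hb : √2 ≤ b) (hc : √2 ≤ c)
    (hx : 2 * (√2 - 1) ≤ x) (hy : 2 * (√2 - 1) ≤ y) (hz : 2 * (√2 - 1) ≤ z)
    (ha' : a ≤ 1.44418) (hb' : b ≤ 1.44418) (hc' : c ≤ 1.44418)
    (hx' : x ≤ 0.858388) (hy' : y ≤ 0.858388) (hz' : z ≤ 0.858388) :
    19.4 ≤ dd a b c z y x ∧ 1 / dd a b c z y x ≤ 1 / dA0 +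
      (2.4 * ((z - 2 * (√2 - 1)) + (y - 2 * (√2 - 1)) + (x - 2 * (√2 - 1))) / 19.4
        - 15 * ((a - √2) + (b - √2) + (c - √2)) / 21.2) / dA0 := by
  have hs := sqrt2_bounds
  have bd := dd_bounds a b c z y x 1.41421 1.44418 1.41421 1.44418 1.41421 1.44418
    0.82842 0.858388 0.82842 0.858388 0.82842 0.858388
    (by linarith) ha' (by linarith) hb' (by linarith) hc' (by linarith) hz' (by linarith) hy'
    (by linarith) hx' (by norm_num) (by norm_num) (by norm_num) (by norm_num) (by norm_num)
    (by norm_num)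
  have l1 : 19.4 ≤ dd a b c z y x := le_trans (by norm_num) bd.1
  have l2 : dd a b c z y x ≤ 21.2 := le_trans bd.2 (by norm_num)
  refine ⟨l1, ?_⟩
  apply inv_step _ _ _ _ _ _ (by norm_num) l1 l2 (by linarith [dA0_bounds])
  · nlinarith
  · nlinarith
  · apply dd_lower a b c z y x √2 √2 √2 (2 * (√2 - 1)) (2 * (√2 - 1)) (2 * (√2 - 1)) 15 2.4
      ha hb hc hz hy hx <;> nlinarith

theorem dB_near (a b c x y z : ℝ)
    (ha : √2 ≤ a) (hb : √2 ≤ b) (hc : √2 ≤ c)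
    (hx : 2 * (√2 - 1) ≤ x) (hy : 2 * (√2 - 1) ≤ y) (hz : 2 * (√2 - 1) ≤ z)
    (ha' : a ≤ 1.44418) (hb' : b ≤ 1.44418) (hc' : c ≤ 1.44418)
    (hx' : x ≤ 0.858388) (hy' : y ≤ 0.858388) (hz' : z ≤ 0.858388) :
    3.68 ≤ dd a x y z c b ∧ 1 / dd a x y z c b ≤ 1 / dB0 +
      (2.4 * ((z - 2 * (√2 - 1)) + (c - √2) + (b - √2)) / 3.68
        - 6.6 * ((a - √2) + (x - 2 * (√2 - 1)) + (y - 2 * (√2 - 1))) / 4.82) / dB0 := by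
  have hs := sqrt2_bounds
  have bd := dd_bounds a x y z c b 1.41421 1.44418 0.82842 0.858388 0.82842 0.858388
    0.82842 0.858388 1.41421 1.44418 1.41421 1.44418
    (by linarith) ha' (by linarith) hx' (by linarith) hy' (by linarith) hz' (by linarith) hc'
    (by linarith) hb' (by norm_num) (by norm_num) (by norm_num) (by norm_num) (by norm_num)
    (by norm_num)
  have l1 : 3.68 ≤ dd a x y z c b := le_trans (by norm_num) bd.1
  have l2 : dd a x y z c b ≤ 4.82 := le_trans bd.2 (by norm_num)
  refine ⟨l1, ?_⟩
  apply inv_step _ _ _ _ _ _ (by norm_num) l1 l2 (by linarith [dB0_bounds])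
  · nlinarith
  · nlinarith
  · apply dd_lower a x y z c b √2 (2 * (√2 - 1)) (2 * (√2 - 1)) (2 * (√2 - 1)) √2 √2 6.6 2.4
      ha hx hy hz hc hb <;> nlinarith

theorem vol_near (a b c x y z V V0 : ℝ)
    (ha : √2 ≤ a) (hb : √2 ≤ b) (hc : √2 ≤ c)
    (hx : 2 * (√2 - 1) ≤ x) (hy : 2 * (√2 - 1) ≤ y) (hz : 2 * (√2 - 1) ≤ z)
    (ha' : a ≤ 1.44418) (hb' : b ≤ 1.44418) (hc' : c ≤ 1.44418)
    (hx' : x ≤ 0.858388) (hy' : y ≤ 0.858388) (hz' : z ≤ 0.858388)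
    (hV : 0 < V) (hVw : 4 * V ^ 2 = ww (a * a) (b * b) (c * c) (x * x) (y * y) (z * z))
    (hV0 : 0 < V0) (hVw0 : 4 * V0 ^ 2 = ww (√2 * √2) (√2 * √2) (√2 * √2)
      (2 * (√2 - 1) * (2 * (√2 - 1))) (2 * (√2 - 1) * (2 * (√2 - 1))) (2 * (√2 - 1) * (2 * (√2 - 1)))) :
    V0 ≤ V := by
  have hs := sqrt2_bounds
  have p0 : 0 ≤ √2 := by linarith
  have p1 : 0 ≤ 2 * (√2 - 1) := by linarith
  have up : ∀ u : ℝ, √2 ≤ u → u ≤ 1.44418 → u * u ≤ 2.0857 := by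
    intro u h1 h2
    have := mul_self_le_mul_self (p0.trans h1) h2
    norm_num at this ⊢
    linarith
  have up2 : ∀ u : ℝ, 2 * (√2 - 1) ≤ u → u ≤ 0.858388 → u * u ≤ 0.7369 := by
    intro u h1 h2
    have := mul_self_le_mul_self (p1.trans h1) h2
    norm_num at this ⊢
    linarith
  have hp : 0.6862 ≤ 2 * (√2 - 1) * (2 * (√2 - 1)) := by
    have e : 2 * (√2 - 1) * (2 * (√2 - 1)) = 4 * (√2 * √2) - 8 * √2 + 4 := by ring
    rw [e, sq2]; linarith
  have h1 := ww_mono (a * a) (b * b) (c * c) (x * x) (y * y) (z * z) (√2 * √2)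
      (2 * (√2 - 1) * (2 * (√2 - 1))) (mul_self_le_mul_self p0 ha) (mul_self_le_mul_self p0 hb)
      (mul_self_le_mul_self p0 hc) (mul_self_le_mul_self p1 hx) (mul_self_le_mul_self p1 hy)
      (mul_self_le_mul_self p1 hz) (up a ha ha') (up b hb hb') (up c hc hc')
      (up2 x hx hx') (up2 y hy hy') (up2 z hz hz') sq2 hp
  have h2 : 4 * V0 ^ 2 ≤ 4 * V ^ 2 := by
    rw [hVw, hVw0]
    refine le_trans (le_of_eq ?_) h1
    unfold ww
    ring
  exact (sq_le_sq₀ hV0.le hV.le).mp (by linarith)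

theorem vol0_eq (V0 : ℝ) (hVw0 : 4 * V0 ^ 2 = ww (√2 * √2) (√2 * √2) (√2 * √2)
      (2 * (√2 - 1) * (2 * (√2 - 1))) (2 * (√2 - 1) * (2 * (√2 - 1))) (2 * (√2 - 1) * (2 * (√2 - 1)))) :
    V0 ^ 2 = 4 * (3 - 2 * √2) ^ 2 * (4 * √2 * 2 - 6) := by
  have e : 2 * (√2 - 1) * (2 * (√2 - 1)) = 4 * (√2 * √2) - 8 * √2 + 4 := by ring
  rw [e, sq2] at hVw0
  have e2 : 4 * V0 ^ 2 = (4 * 2 - 8 * √2 + 4) ^ 2 * (3 * 2 - (4 * 2 - 8 * √2 + 4)) := by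
    rw [hVw0]; unfold ww; ring
  linear_combination e2 / 4

theorem vol0_le (V0 : ℝ) (hVw0 : 4 * V0 ^ 2 = ww (√2 * √2) (√2 * √2) (√2 * √2)
      (2 * (√2 - 1) * (2 * (√2 - 1))) (2 * (√2 - 1) * (2 * (√2 - 1))) (2 * (√2 - 1) * (2 * (√2 - 1)))) :
    V0 ≤ 1 := by
  have hs := sqrt2_bounds
  have e := vol0_eq V0 hVw0
  have e1 : (3 - 2 * √2) ^ 2 ≤ 0.04 := by nlinarith
  have e2 : (3 - 2 * √2) ^ 2 * (4 * √2 * 2 - 6) ≤ 0.04 * 6 :=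
    mul_le_mul e1 (by linarith) (by linarith) (by norm_num)
  nlinarith

theorem lin_num (U W S1 S2 : ℝ) (u0 : 0 ≤ U) (u1 : U ≤ 1 / 19.7) (u2 : 0.056 * (1 / 4.05) ≤ W)
    (h1 : 0 ≤ S1) (h2 : 0 ≤ S2) :
    U * ((2.4 / 19.4) * S2 - 15 / 21.2 * S1) + W *
        (S1 * (2 * 2.4 / 3.68 - 6.6 / 4.82) + S2 * (2.4 / 3.68 - 2 * 6.6 / 4.82)) ≤ 0 := by
  have y1 := mul_nonneg u0 h1
  have y2 := mul_le_mul_of_nonneg_right u1 h2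
  have y3 := mul_le_mul_of_nonneg_right u2 h1
  have y4 := mul_le_mul_of_nonneg_right u2 h2
  linarith

set_option maxHeartbeats 1000000 in
theorem near_T0 (a b c x y z V V0 : ℝ)
    (ha : √2 ≤ a) (hb : √2 ≤ b) (hc : √2 ≤ c)
    (hx : 2 * (√2 - 1) ≤ x) (hy : 2 * (√2 - 1) ≤ y) (hz : 2 * (√2 - 1) ≤ z)
    (ha' : a ≤ 1.44418) (hb' : b ≤ 1.44418) (hc' : c ≤ 1.44418)
    (hx' : x ≤ 0.858388) (hy' : y ≤ 0.858388) (hz' : z ≤ 0.858388)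
    (hV : 0 < V) (hVw : 4 * V ^ 2 = ww (a * a) (b * b) (c * c) (x * x) (y * y) (z * z))
    (hV0 : 0 < V0) (hVw0 : 4 * V0 ^ 2 = ww (√2 * √2) (√2 * √2) (√2 * √2)
      (2 * (√2 - 1) * (2 * (√2 - 1))) (2 * (√2 - 1) * (2 * (√2 - 1))) (2 * (√2 - 1) * (2 * (√2 - 1)))) :
    0 < dd a b c z y x ∧ 0 < dd a x y z c b ∧ 0 < dd b x z y c a ∧ 0 < dd c y z x b a ∧
    Phi V (dd a b c z y x) (dd a x y z c b) (dd b x z y c a) (dd c y z x b a) / V ≤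
      Phi V0 dA0 dB0 dB0 dB0 / V0 := by
  have hs := sqrt2_bounds
  obtain ⟨lA, iA⟩ := dA_near a b c x y z ha hb hc hx hy hz ha' hb' hc' hx' hy' hz'
  obtain ⟨lB, iB⟩ := dB_near a b c x y z ha hb hc hx hy hz ha' hb' hc' hx' hy' hz'
  obtain ⟨lC, iC⟩ := dB_near b a c x z y hb ha hc hx hz hy hb' ha' hc' hx' hz' hy'
  obtain ⟨lD, iD⟩ := dB_near c a b y z x hc ha hb hy hz hx hc' ha' hb' hy' hz' hx'
  obtain ⟨bA1, bA2⟩ := dA0_bounds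
  obtain ⟨bB1, bB2⟩ := dB0_bounds
  have qC : dd b x z y c a = dd b x z y c a := rfl
  have pA : 0 < dd a b c z y x := by linarith
  have pB : 0 < dd a x y z c b := by linarith
  have pC : 0 < dd b x z y c a := by linarith
  have pD : 0 < dd c y z x b a := by linarith
  refine ⟨pA, pB, pC, pD, ?_⟩
  have hVV := vol_near a b c x y z V V0 ha hb hc hx hy hz ha' hb' hc' hx' hy' hz' hV hVw hV0 hVw0
  have hV01 := vol0_le V0 hVw0
  clear hVw hVw0
  generalize dd a b c z y x = dA at *
  generalize dd a x y z c b = dB at *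
  generalize dd b x z y c a = dC at *
  generalize dd c y z x b a = dD at *
  unfold Phi
  have hr : (√2 - 1) ^ 3 = 5 * √2 - 7 := by
    have : (√2 - 1) ^ 3 = √2 * √2 * √2 - 3 * (√2 * √2) + 3 * √2 - 1 := by ring
    rw [this, sq2]; ring
  have hr1 : 0.07 ≤ (√2 - 1) ^ 3 := by rw [hr]; linarith
  generalize (√2 - 1) ^ 3 = w at *
  set tA := 2 * V0 / dA0 with htA
  set tB := 2 * V0 / dB0 with htB
  have hdA0 : 0 < dA0 := by linarith
  have hdB0 : 0 < dB0 := by linarith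
  have tA0 : 0 ≤ tA := by positivity
  have tB0 : 0 ≤ tB := by positivity
  have tB1 : tB ≤ 0.5 := by
    rw [htB, div_le_iff₀ hdB0]; linarith
  have aA := arctan_tangent (2 * V / dA) tA (by positivity) tA0
  have aB := arctan_tangent (2 * V / dB) tB (by positivity) tB0
  have aC := arctan_tangent (2 * V / dC) tB (by positivity) tB0
  have aD := arctan_tangent (2 * V / dD) tB (by positivity) tB0
  have gA := arctan_ge tA tA0
  have gB := arctan_ge tB tB0
  have hw : 0 ≤ w := by linarith
  -- kappas
  obtain ⟨kA, hkA⟩ : ∃ k, k = 1 / (1 + tA ^ 2) := ⟨_, rfl⟩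
  obtain ⟨kB, hkB⟩ : ∃ k, k = 1 / (1 + tB ^ 2) := ⟨_, rfl⟩
  have kA1 : kA ≤ 1 := by
    rw [hkA, div_le_one (by positivity)]; nlinarith
  have kA0 : 0 ≤ kA := by rw [hkA]; positivity
  have kB0 : 0.8 ≤ kB := by
    rw [hkB, le_div_iff₀ (by positivity)]; nlinarith
  have dv : ∀ u v : ℝ, u / v = u * (1 / v) := fun u v => by ring
  rw [dv _ (1 + tA ^ 2), ← hkA] at aA gA
  rw [dv _ (1 + tB ^ 2), ← hkB] at aB aC aD gB
  rw [dv (2 * V) dA] at aA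
  rw [dv (2 * V) dB] at aB
  rw [dv (2 * V) dC] at aC
  rw [dv (2 * V) dD] at aD
  have eA : tA = 2 * V0 * (1 / dA0) := by rw [htA]; ring
  have eB : tB = 2 * V0 * (1 / dB0) := by rw [htB]; ring
  rw [div_le_div_iff₀ hV hV0]
  -- the linear comparison of reciprocals
  have key : kA * (1 / dA) + w * kB * (1 / dB + 1 / dC + 1 / dD) ≤
      kA * (1 / dA0) + w * kB * (3 * (1 / dB0)) := by
    have m1 := mul_le_mul_of_nonneg_left iA kA0
    have wk : 0 ≤ w * kB := by positivity
    have wk1 : 0.056 ≤ w * kB := by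
      calc (0.056 : ℝ) = 0.07 * 0.8 := by norm_num
        _ ≤ w * kB := mul_le_mul hr1 kB0 (by norm_num) hw
    have m2 := mul_le_mul_of_nonneg_left (add_le_add (add_le_add iB iC) iD) wk
    have rA : 1 / dA0 ≤ 1 / 19.7 := one_div_le_one_div_of_le (by norm_num) (by linarith)
    have rA0 : 0 ≤ 1 / dA0 := by positivity
    have rB : 1 / 4.05 ≤ 1 / dB0 := one_div_le_one_div_of_le (by linarith) (by linarith)
    have hS1 : 0 ≤ (a - √2) + (b - √2) + (c - √2) := by linarith
    have hS2 : 0 ≤ (x - 2 * (√2 - 1)) + (y - 2 * (√2 - 1)) + (z - 2 * (√2 - 1)) := by linarith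
    generalize hT1 : (a - √2) + (b - √2) + (c - √2) = S1 at *
    generalize hT2 : (x - 2 * (√2 - 1)) + (y - 2 * (√2 - 1)) + (z - 2 * (√2 - 1)) = S2 at *
    have n1 : kA * (1 / dA0) * ((2.4 / 19.4) * S2 - 15 / 21.2 * S1) + (w * kB) * (1 / dB0) *
        (S1 * (2 * 2.4 / 3.68 - 6.6 / 4.82) + S2 * (2.4 / 3.68 - 2 * 6.6 / 4.82)) ≤ 0 := by
      have u1 : kA * (1 / dA0) ≤ 1 / 19.7 := by
        calc kA * (1 / dA0) ≤ 1 * (1 / 19.7) := mul_le_mul kA1 rA rA0 zero_le_one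
          _ = 1 / 19.7 := one_mul _
      have u0 : 0 ≤ kA * (1 / dA0) := by positivity
      have u2 : 0.056 * (1 / 4.05) ≤ (w * kB) * (1 / dB0) := by
        apply mul_le_mul wk1 rB (by norm_num) wk
      exact lin_num _ _ _ _ u0 u1 u2 hS1 hS2
    have n2 : kA * (1 / dA0 + (2.4 * ((z - 2 * (√2 - 1)) + (y - 2 * (√2 - 1)) + (x - 2 * (√2 - 1))) / 19.4
        - 15 * S1 / 21.2) / dA0) = kA * (1 / dA0) + kA * (1 / dA0) * ((2.4 / 19.4) * S2 - 15 / 21.2 * S1) := by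
      rw [← hT2]; ring
    have n3 : ∀ u v : ℝ, w * kB * (1 / dB0 + (2.4 * ((z - 2 * (√2 - 1)) + (c - √2) + (b - √2)) / 3.68
        - 6.6 * ((a - √2) + (x - 2 * (√2 - 1)) + (y - 2 * (√2 - 1))) / 4.82) / dB0 +
       (1 / dB0 + (2.4 * ((y - 2 * (√2 - 1)) + (c - √2) + (a - √2)) / 3.68
        - 6.6 * ((b - √2) + (x - 2 * (√2 - 1)) + (z - 2 * (√2 - 1))) / 4.82) / dB0) +
       (1 / dB0 + (2.4 * ((x - 2 * (√2 - 1)) + (b - √2) + (a - √2)) / 3.68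
        - 6.6 * ((c - √2) + (y - 2 * (√2 - 1)) + (z - 2 * (√2 - 1))) / 4.82) / dB0)) =
        w * kB * (3 * (1 / dB0)) + (w * kB) * (1 / dB0) *
        (S1 * (2 * 2.4 / 3.68 - 6.6 / 4.82) + S2 * (2.4 / 3.68 - 2 * 6.6 / 4.82)) := by
      intro _ _
      rw [← hT2, ← hT1]; ring
    have n3 := n3 0 0
    linarith
  have c0 : 0 ≤ Real.arctan tA - tA * kA + 3 * w * (Real.arctan tB - tB * kB) := by
    have : 0 ≤ 3 * w * (Real.arctan tB - tB * kB) := by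
      apply mul_nonneg (by positivity) (by linarith)
    linarith
  have c1 := mul_le_mul_of_nonneg_right hVV c0
  have f1 := mul_le_mul_of_nonneg_left (add_le_add (add_le_add aB aC) aD) hw
  have f2 := mul_le_mul_of_nonneg_right (add_le_add aA f1) hV0.le
  have f3 := mul_le_mul_of_nonneg_left key (mul_nonneg (mul_nonneg zero_le_two hV.le) hV0.le)
  rw [dv (2 * V) dA, dv (2 * V) dB, dv (2 * V) dC, dv (2 * V) dD]
  refine f2.trans ?_
  rw [eA, eB] at c1 ⊢
  linear_combination f3 + c1

theorem arctan_pade_lower (t : ℝ) (ht : 0 ≤ t) :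
    t * (1155 + 1190 * t ^ 2 + 231 * t ^ 4) / (1155 + 1575 * t ^ 2 + 525 * t ^ 4 + 25 * t ^ 6)
      ≤ Real.arctan t := by
  set f : ℝ → ℝ := fun t => Real.arctan t -
    t * (1155 + 1190 * t ^ 2 + 231 * t ^ 4) / (1155 + 1575 * t ^ 2 + 525 * t ^ 4 + 25 * t ^ 6) with hf
  have hder : ∀ x : ℝ, HasDerivAt f
      (1 / (1 + x ^ 2) - ((1155 + 3 * 1190 * x ^ 2 + 5 * 231 * x ^ 4) *
          (1155 + 1575 * x ^ 2 + 525 * x ^ 4 + 25 * x ^ 6) -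
        (x * (1155 + 1190 * x ^ 2 + 231 * x ^ 4)) * (3150 * x + 2100 * x ^ 3 + 150 * x ^ 5)) /
        (1155 + 1575 * x ^ 2 + 525 * x ^ 4 + 25 * x ^ 6) ^ 2) x := by
    intro x
    have hQ : (1155 + 1575 * x ^ 2 + 525 * x ^ 4 + 25 * x ^ 6) ≠ 0 := by positivity
    refine HasDerivAt.sub (Real.hasDerivAt_arctan x) (HasDerivAt.div ?_ ?_ hQ)
    · have h := ((hasDerivAt_id x).mul (((hasDerivAt_const x (1155:ℝ)).add
        ((hasDerivAt_pow 2 x).const_mul 1190)).add ((hasDerivAt_pow 4 x).const_mul 231)))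
      refine HasDerivAt.congr_deriv h ?_
      simp [Pi.add_apply]; ring
    · have h := ((((hasDerivAt_const x (1155:ℝ)).add
        ((hasDerivAt_pow 2 x).const_mul 1575)).add ((hasDerivAt_pow 4 x).const_mul 525)).add
        ((hasDerivAt_pow 6 x).const_mul 25))
      refine HasDerivAt.congr_deriv h ?_
      simp [Pi.add_apply]; ring
  have hmono : Monotone f := by
    refine monotone_of_deriv_nonneg (fun x => (hder x).differentiableAt) (fun x => ?_)
    rw [(hder x).deriv]
    have hQ : 0 < (1155 + 1575 * x ^ 2 + 525 * x ^ 4 + 25 * x ^ 6) := by positivity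
    have hR : 0 < 1 + x ^ 2 := by positivity
    rw [sub_nonneg, div_le_div_iff₀ (by positivity) hR]
    have : 0 ≤ x ^ 12 := by positivity
    nlinarith
  have := hmono ht
  simp only [hf] at this
  simp at this
  linarith

theorem arctan_lower2 (t l u : ℝ) (ht : 0 ≤ t) (hl : 0 ≤ l) (h1 : l ≤ t ^ 2) (h2 : t ^ 2 ≤ u) :
    t * ((1155 + 1190 * l + 231 * l ^ 2) / (1155 + 1575 * u + 525 * u ^ 2 + 25 * u ^ 3))
      ≤ Real.arctan t := by
  refine le_trans ?_ (arctan_pade_lower t ht)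
  rw [mul_div_assoc]
  apply mul_le_mul_of_nonneg_left _ ht
  have hu : 0 ≤ u := by linarith
  have e4 : t ^ 4 = (t ^ 2) ^ 2 := by ring
  have e6 : t ^ 6 = (t ^ 2) ^ 3 := by ring
  rw [e4, e6]
  generalize t ^ 2 = s at *
  have hs : 0 ≤ s := by linarith
  gcongr

theorem sqrt2_fine : (1.414213562373 : ℝ) < √2 ∧ √2 < 1.414213562374 := by
  constructor
  · rw [Real.lt_sqrt] <;> norm_num
  · rw [Real.sqrt_lt'] <;> norm_num

theorem dA0_eq : dA0 = 48 - 20 * √2 := by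
  have e : dA0 = 52 * √2 * 0 + (8 * (√2 * (√2 * √2)) - 12 * √2 * (√2 * √2 - 2 * √2 + 1)) := by
    unfold dA0 dd; ring
  rw [e, sq2]
  linear_combination 24 * sq2

theorem dB0_eq : dB0 = 116 * √2 - 160 := by
  have e : dB0 = 28 * (√2 * √2 * √2) - 72 * (√2 * √2) + 60 * √2 - 16 := by
    unfold dB0 dd; ring
  rw [e, sq2]; ring

theorem w_eq : (√2 - 1) ^ 3 = 5 * √2 - 7 := by
  have : (√2 - 1) ^ 3 = √2 * √2 * √2 - 3 * (√2 * √2) + 3 * √2 - 1 := by ring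
  rw [this, sq2]; ring

theorem phi0_ge (V0 : ℝ) (hV0 : 0 < V0)
    (hVw0 : 4 * V0 ^ 2 = ww (√2 * √2) (√2 * √2) (√2 * √2)
      (2 * (√2 - 1) * (2 * (√2 - 1))) (2 * (√2 - 1) * (2 * (√2 - 1))) (2 * (√2 - 1) * (2 * (√2 - 1)))) :
    3719335000000000000 / 2 ^ 64 ≤ Phi V0 dA0 dB0 dB0 dB0 / V0 := by
  have hs := sqrt2_fine
  have e := vol0_eq V0 hVw0
  have e : V0 ^ 2 = 832 * √2 - 1176 := by
    rw [e]
    linear_combination (16 * (8 * √2 - 6) - 12 * 32) * sq2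
  unfold Phi
  rw [w_eq]
  have a1 : 0 < dA0 := by rw [dA0_eq]; linarith
  have b1 : 0 < dB0 := by rw [dB0_eq]; linarith
  have a2 : dA0 ≤ 19.71572875254 := by rw [dA0_eq]; linarith
  have a3 : 19.71572875252 ≤ dA0 := by rw [dA0_eq]; linarith
  have b2 : dB0 ≤ 4.04877323539 := by rw [dB0_eq]; linarith
  have b3 : 4.04877323526 ≤ dB0 := by rw [dB0_eq]; linarith
  have v1 : 0.625683894 ≤ V0 ^ 2 := by rw [e]; linarith
  have v2 : V0 ^ 2 ≤ 0.625683896 := by rw [e]; linarith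
  have tA : (2 * V0 / dA0) ^ 2 = 4 * V0 ^ 2 / (dA0 * dA0) := by ring
  have tB : (2 * V0 / dB0) ^ 2 = 4 * V0 ^ 2 / (dB0 * dB0) := by ring
  have LA := arctan_lower2 (2 * V0 / dA0) 0.00643856 0.00643857 (by positivity) (by norm_num)
    (by rw [tA, le_div_iff₀ (by positivity)]; nlinarith)
    (by rw [tA, div_le_iff₀ (by positivity)]; nlinarith)
  have LB := arctan_lower2 (2 * V0 / dB0) 0.15267504 0.15267505 (by positivity) (by norm_num)
    (by rw [tB, le_div_iff₀ (by positivity)]; nlinarith)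
    (by rw [tB, div_le_iff₀ (by positivity)]; nlinarith)
  have iA : (1:ℝ) / 19.71572875254 ≤ 1 / dA0 := one_div_le_one_div_of_le a1 a2
  have iB : (1:ℝ) / 4.04877323539 ≤ 1 / dB0 := one_div_le_one_div_of_le b1 b2
  rw [le_div_iff₀ hV0]
  have qA : 2 * V0 / dA0 = V0 * (2 * (1 / dA0)) := by ring
  have qB : 2 * V0 / dB0 = V0 * (2 * (1 / dB0)) := by ring
  rw [qA] at LA ⊢
  rw [qB] at LB ⊢
  have mA := mul_le_mul_of_nonneg_left iA hV0.le
  have mB := mul_le_mul_of_nonneg_left iB hV0.le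
  have LA' : V0 * (2 * 0.05061248) ≤ Real.arctan (V0 * (2 * (1 / dA0))) := by
    refine le_trans ?_ LA
    norm_num at mA ⊢
    linarith
  have LB' : V0 * (2 * 0.2354578) ≤ Real.arctan (V0 * (2 * (1 / dB0))) := by
    refine le_trans ?_ LB
    norm_num at mB ⊢
    linarith
  have hw : 0.0710678118 ≤ 5 * √2 - 7 := by linarith
  have pos : 0 ≤ Real.arctan (V0 * (2 * (1 / dB0))) := Real.arctan_nonneg.mpr (by positivity)
  have f := mul_le_mul_of_nonneg_right hw pos
  norm_num at *
  linarith

theorem dd_p12 (a b c x y z : ℝ) : dd a b c x y z = dd b a c y x z := by unfold dd; ring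
theorem dd_p23 (a b c x y z : ℝ) : dd a b c x y z = dd a c b x z y := by unfold dd; ring
theorem ww_p12 (a b c x y z : ℝ) : ww a b c x y z = ww b a c x z y := by unfold ww; ring
theorem ww_p23 (a b c x y z : ℝ) : ww a b c x y z = ww a c b y x z := by unfold ww; ring

/-- the constraint coming from the support sphere -/
def FMu (a b c x y z : ℝ) : Prop :=
  ∀ p q s t : ℝ, p + q + s + t = 1 → -45 / 64 ≤ p → p ≤ 1 →
    p * q * (a * a) + p * s * (b * b) + p * t * (c * c) + q * s * (x * x) + q * t * (y * y)
      + s * t * (z * z) ≤ 2 * p + 4 * (√2 - 1) ^ 2 * (1 - p)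

structure Rng (a b c x y z : ℝ) : Prop where
  al : √2 ≤ a
  bl : √2 ≤ b
  cl : √2 ≤ c
  xl : 2 * (√2 - 1) ≤ x
  yl : 2 * (√2 - 1) ≤ y
  zl : 2 * (√2 - 1) ≤ z
  ah : a ≤ √2 + 2 * (√2 - 1)
  bh : b ≤ √2 + 2 * (√2 - 1)
  ch : c ≤ √2 + 2 * (√2 - 1)
  xh : x ≤ 4 * (√2 - 1)
  yh : y ≤ 4 * (√2 - 1)
  zh : z ≤ 4 * (√2 - 1)

def Concl (a b c x y z V V0 : ℝ) : Prop :=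
    0 < dd a b c z y x ∧ 0 < dd a x y z c b ∧ 0 < dd b x z y c a ∧ 0 < dd c y z x b a ∧
    Phi V (dd a b c z y x) (dd a x y z c b) (dd b x z y c a) (dd c y z x b a) / V ≤
      Phi V0 dA0 dB0 dB0 dB0 / V0

theorem Concl.p12 {a b c x y z V V0 : ℝ} (h : Concl a b c x y z V V0) :
    Concl b a c x z y V V0 := by
  obtain ⟨h1, h2, h3, h4, h5⟩ := h
  have e1 : dd b a c y z x = dd a b c z y x := dd_p12 _ _ _ _ _ _
  have e4 : dd c z y x a b = dd c y z x b a := dd_p23 _ _ _ _ _ _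
  refine ⟨by rw [e1]; exact h1, h3, h2, by rw [e4]; exact h4, ?_⟩
  rw [e1, e4]
  refine le_trans (le_of_eq ?_) h5
  unfold Phi
  ring

theorem Concl.p23 {a b c x y z V V0 : ℝ} (h : Concl a b c x y z V V0) :
    Concl a c b y x z V V0 := by
  obtain ⟨h1, h2, h3, h4, h5⟩ := h
  have e1 : dd a c b z x y = dd a b c z y x := dd_p23 _ _ _ _ _ _
  have e2 : dd a y x z b c = dd a x y z c b := dd_p23 _ _ _ _ _ _
  have e3 : dd b x z y c a = dd b x z y c a := rfl
  refine ⟨by rw [e1]; exact h1, by rw [e2]; exact h2, h4, h3, ?_⟩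
  rw [e1, e2]
  refine le_trans (le_of_eq ?_) h5
  unfold Phi
  ring

theorem FMu.p12 {a b c x y z : ℝ} (h : FMu a b c x y z) : FMu b a c x z y := by
  intro p q s t h1 h2 h3
  have := h p s q t (by linarith) h2 h3
  linarith

theorem FMu.p23 {a b c x y z : ℝ} (h : FMu a b c x y z) : FMu a c b y x z := by
  intro p q s t h1 h2 h3
  have := h p q t s (by linarith) h2 h3
  linarith

theorem Rng.p12 {a b c x y z : ℝ} (h : Rng a b c x y z) : Rng b a c x z y :=
  ⟨h.bl, h.al, h.cl, h.xl, h.zl, h.yl, h.bh, h.ah, h.ch, h.xh, h.zh, h.yh⟩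

theorem Rng.p23 {a b c x y z : ℝ} (h : Rng a b c x y z) : Rng a c b y x z :=
  ⟨h.al, h.cl, h.bl, h.yl, h.xl, h.zl, h.ah, h.ch, h.bh, h.yh, h.xh, h.zh⟩

theorem dd_scale (S a b c x y z : ℝ) :
    dd (S * a) (S * b) (S * c) (S * x) (S * y) (S * z) = S ^ 3 * dd a b c x y z := by
  unfold dd; ring

theorem num_sorted (a b c x y z V V0 : ℝ) (hR : Rng a b c x y z) (hF : FMu a b c x y z)
    (h1 : x ≤ z) (h2 : y ≤ z) (h3 : b ≤ c)
    (hV : 0 < V) (hVw : 4 * V ^ 2 = ww (a * a) (b * b) (c * c) (x * x) (y * y) (z * z))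
    (hV0 : 0 < V0) (hVw0 : 4 * V0 ^ 2 = ww (√2 * √2) (√2 * √2) (√2 * √2)
      (2 * (√2 - 1) * (2 * (√2 - 1))) (2 * (√2 - 1) * (2 * (√2 - 1))) (2 * (√2 - 1) * (2 * (√2 - 1)))) :
    Concl a b c x y z V V0 := by
  have hs := sqrt2_fine
  have hM : root.Mem (5741 * a) (5741 * b) (5741 * c) (5741 * x) (5741 * y) (5741 * z) := by
    obtain ⟨al, bl, cl, xl, yl, zl, ah, bh, ch, xh, yh, zh⟩ := hR
    constructor <;> norm_num [root] <;> linarith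
  have hFc : FMc (5741 * a * (5741 * a)) (5741 * b * (5741 * b)) (5741 * c * (5741 * c))
      (5741 * x * (5741 * x)) (5741 * y * (5741 * y)) (5741 * z * (5741 * z)) := by
    intro p q s t g1 g2 g3
    have g := hF p q s t g1 g2 g3
    have e : 4 * (√2 - 1) ^ 2 = 12 - 8 * √2 := by linear_combination 4 * sq2
    rw [e] at g
    have k : (12 - 8 * √2) * (1 - p) ≤ 22619538 / 5741 ^ 2 * (1 - p) :=
      mul_le_mul_of_nonneg_right (by linarith) (by linarith)
    linarith
  rcases chk_spec CT.t28 root _ _ _ _ _ _ hM hFc (by linarith) (by linarith) (by linarith)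
    chk_root with h | h
  · obtain ⟨ha, hb, hc, hx, hy, hz⟩ := h
    exact near_T0 a b c x y z V V0 hR.al hR.bl hR.cl hR.xl hR.yl hR.zl (by linarith) (by linarith)
      (by linarith) (by linarith) (by linarith) (by linarith) hV hVw hV0 hVw0
  · unfold Good at h
    simp only [dd_scale] at h
    obtain ⟨p1, p2, p3, p4, h⟩ := h
    have S0 : (0:ℝ) < 5741 ^ 3 := by norm_num
    replace p1 := pos_of_mul_pos_right p1 S0.le
    replace p2 := pos_of_mul_pos_right p2 S0.le
    replace p3 := pos_of_mul_pos_right p3 S0.le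
    replace p4 := pos_of_mul_pos_right p4 S0.le
    refine ⟨p1, p2, p3, p4, ?_⟩
    refine le_trans ?_ (phi0_ge V0 hV0 hVw0)
    have g := h (5741 ^ 3 * V) (by positivity) (by
      have : 4 * (5741 ^ 3 * V) ^ 2 = 5741 ^ 6 * (4 * V ^ 2) := by ring
      rw [this, hVw]; unfold ww; ring)
    have sc : ∀ d : ℝ, 2 * (5741 ^ 3 * V) / (5741 ^ 3 * d) = 2 * V / d := by
      intro d
      rw [← mul_assoc, mul_comm (2:ℝ), mul_assoc, mul_div_mul_left _ _ S0.ne']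
    simp only [sc] at g
    unfold Phi
    rw [w_eq, div_le_iff₀ hV]
    have q2 := Real.arctan_nonneg.mpr (show 0 ≤ 2 * V / dd a x y z c b by positivity)
    have q3 := Real.arctan_nonneg.mpr (show 0 ≤ 2 * V / dd b x z y c a by positivity)
    have q4 := Real.arctan_nonneg.mpr (show 0 ≤ 2 * V / dd c y z x b a by positivity)
    have hw : 5 * √2 - 7 ≤ 76308482 / 2 ^ 30 := by norm_num; linarith
    have m := mul_le_mul_of_nonneg_right hw (add_nonneg (add_nonneg q2 q3) q4)
    norm_num at g m ⊢
    linarith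

theorem num_all (a b c x y z V V0 : ℝ) (hR : Rng a b c x y z) (hF : FMu a b c x y z)
    (hV : 0 < V) (hVw : 4 * V ^ 2 = ww (a * a) (b * b) (c * c) (x * x) (y * y) (z * z))
    (hV0 : 0 < V0) (hVw0 : 4 * V0 ^ 2 = ww (√2 * √2) (√2 * √2) (√2 * √2)
      (2 * (√2 - 1) * (2 * (√2 - 1))) (2 * (√2 - 1) * (2 * (√2 - 1))) (2 * (√2 - 1) * (2 * (√2 - 1)))) :
    Concl a b c x y z V V0 := by
  have step1 : ∀ a b c x y z : ℝ, Rng a b c x y z → FMu a b c x y z →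
      4 * V ^ 2 = ww (a * a) (b * b) (c * c) (x * x) (y * y) (z * z) → x ≤ z → y ≤ z →
      Concl a b c x y z V V0 := by
    intro a b c x y z hR hF hw h1 h2
    rcases le_total b c with h3 | h3
    · exact num_sorted a b c x y z V V0 hR hF h1 h2 h3 hV hw hV0 hVw0
    · exact (num_sorted a c b y x z V V0 hR.p23 hF.p23 h2 h1 h3 hV (by rw [hw, ww_p23])
        hV0 hVw0).p23
  have step2 : ∀ a b c x y z : ℝ, Rng a b c x y z → FMu a b c x y z →
      4 * V ^ 2 = ww (a * a) (b * b) (c * c) (x * x) (y * y) (z * z) → x ≤ y → z ≤ y →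
      Concl a b c x y z V V0 := by
    intro a b c x y z hR hF hw h1 h2
    exact (step1 b a c x z y hR.p12 hF.p12 (by rw [hw, ww_p12]) h1 h2).p12
  rcases le_total x z with h1 | h1
  · rcases le_total y z with h2 | h2
    · exact step1 a b c x y z hR hF hVw h1 h2
    · exact step2 a b c x y z hR hF hVw (h1.trans h2) h2
  · rcases le_total x y with h2 | h2
    · exact step2 a b c x y z hR hF hVw h2 (h1.trans h2)
    · exact (step2 a c b y x z hR.p23 hF.p23 (by rw [hVw, ww_p23]) h2 h1).p23

/-- polar factorization for sets defined by the modulus and the argument -/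
theorem sector_aux (S : Set ℂ) (J M : Set ℝ) (hS : MeasurableSet S) (hJ : MeasurableSet J)
    (hM : MeasurableSet M)
    (h : ∀ r φ : ℝ, 0 < r → -Real.pi < φ → φ < Real.pi →
      ((r * (Real.cos φ + Real.sin φ * Complex.I) : ℂ) ∈ S ↔ r ∈ M ∧ φ ∈ J)) :
    volume S = (∫⁻ r in Set.Ioi 0, M.indicator (fun r => ENNReal.ofReal r) r) *
      volume (J ∩ Set.Ioo (-Real.pi) Real.pi) := by
  rw [← lintegral_indicator_one hS, ← Complex.lintegral_comp_polarCoord_symm]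
  have e : ∀ p ∈ polarCoord.target,
      ENNReal.ofReal p.1 • S.indicator 1 (Complex.polarCoord.symm p) =
      (M.indicator (fun r => ENNReal.ofReal r) p.1) * (J.indicator (1 : ℝ → ENNReal) p.2) := by
    rintro ⟨r, φ⟩ hp
    rw [polarCoord_target] at hp
    obtain ⟨h1, h2, h3⟩ := hp
    have := h r φ h1 h2 h3
    rw [Complex.polarCoord_symm_apply]
    generalize (((r, φ) : ℝ × ℝ).1 * (Real.cos ((r, φ) : ℝ × ℝ).2 +
      Real.sin ((r, φ) : ℝ × ℝ).2 * Complex.I) : ℂ) = z at this ⊢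
    by_cases a : r ∈ M <;> by_cases b : φ ∈ J <;> simp [Set.indicator, this, a, b]
  rw [setLIntegral_congr_fun polarCoord.open_target.measurableSet e, polarCoord_target,
    Measure.volume_eq_prod, ← Measure.prod_restrict]
  rw [lintegral_prod_mul (f := M.indicator fun r => ENNReal.ofReal r)
    (g := J.indicator (1 : ℝ → ENNReal))]
  · rw [lintegral_indicator_one hJ, Measure.restrict_apply hJ]
  · exact (ENNReal.measurable_ofReal.indicator hM).aemeasurable
  · exact (measurable_one.indicator hJ).aemeasurable

theorem sector (w : ℂ) (hw : 0 < w.im) (M : Set ℝ) (hM : MeasurableSet M) :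
    volume {z : ℂ | (0 < z.im ∧ 0 < z.re * w.im - z.im * w.re) ∧ ‖z‖ ∈ M} *
      ENNReal.ofReal (2 * Real.pi) = ENNReal.ofReal w.arg * volume {z : ℂ | ‖z‖ ∈ M} := by
  have hn : 0 < ‖w‖ := norm_pos_iff.mpr (by rintro rfl; simp at hw)
  have hre := Complex.norm_mul_cos_arg w
  have him := Complex.norm_mul_sin_arg w
  have a0 : 0 ≤ w.arg := Complex.arg_nonneg_iff.mpr hw.le
  have api := Complex.arg_le_pi w
  have a1 : 0 < w.arg := by
    rcases a0.lt_or_eq with h | h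
    · exact h
    · rw [← h] at him; simp at him; linarith
  have a2 : w.arg < Real.pi := by
    rcases api.lt_or_eq with h | h
    · exact h
    · rw [h] at him; simp at him; linarith
  have m1 : MeasurableSet {z : ℂ | ‖z‖ ∈ M} := measurable_norm hM
  have m2 : MeasurableSet {z : ℂ | 0 < z.im ∧ 0 < z.re * w.im - z.im * w.re} := by
    have h1 : MeasurableSet {z : ℂ | 0 < z.im} :=
      measurableSet_lt measurable_const Complex.measurable_im
    have h2 : MeasurableSet {z : ℂ | 0 < z.re * w.im - z.im * w.re} := by
      refine measurableSet_lt measurable_const ?_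
      exact (Complex.measurable_re.mul_const _).sub (Complex.measurable_im.mul_const _)
    exact h1.inter h2
  have nrm : ∀ r φ : ℝ, 0 < r → ‖(r * (Real.cos φ + Real.sin φ * Complex.I) : ℂ)‖ = r := by
    intro r φ hr
    have := Complex.norm_polarCoord_symm (r, φ)
    rw [Complex.polarCoord_symm_apply] at this
    rw [this, abs_of_pos hr]
  rw [sector_aux {z : ℂ | (0 < z.im ∧ 0 < z.re * w.im - z.im * w.re) ∧ ‖z‖ ∈ M} (Set.Ioo 0 w.arg) M (m2.inter m1) measurableSet_Ioo hM,
    sector_aux {z : ℂ | ‖z‖ ∈ M} Set.univ M m1 MeasurableSet.univ hM]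
  · have : Set.Ioo 0 w.arg ∩ Set.Ioo (-Real.pi) Real.pi = Set.Ioo 0 w.arg := by
      apply Set.inter_eq_left.mpr
      intro x hx
      exact ⟨by linarith [hx.1, Real.pi_pos], by linarith [hx.2]⟩
    rw [this, Set.univ_inter, Real.volume_Ioo, Real.volume_Ioo]
    have : Real.pi - -Real.pi = 2 * Real.pi := by ring
    rw [this, sub_zero]
    ring
  · intro r φ hr h1 h2
    simp only [Set.mem_setOf_eq, nrm r φ hr, Set.mem_univ, and_true]
  · intro r φ hr h1 h2
    simp only [Set.mem_setOf_eq, nrm r φ hr, Set.mem_inter_iff]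
    rw [and_comm]
    refine and_congr_right fun _ => ?_
    have e1 : (r * (Real.cos φ + Real.sin φ * Complex.I) : ℂ).im = r * Real.sin φ := by
      simp [Complex.cos_ofReal_im, Complex.sin_ofReal_re]
    have e2 : (r * (Real.cos φ + Real.sin φ * Complex.I) : ℂ).re = r * Real.cos φ := by
      simp [Complex.cos_ofReal_re, Complex.sin_ofReal_im]
    rw [e1, e2]
    have e3 : r * Real.cos φ * w.im - r * Real.sin φ * w.re = r * ‖w‖ * Real.sin (w.arg - φ) := by
      rw [Real.sin_sub, ← hre, ← him]; ring
    rw [e3, mul_pos_iff_of_pos_left hr, mul_pos_iff_of_pos_left (mul_pos hr hn)]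
    constructor
    · rintro ⟨k1, k2⟩
      have p0 : 0 < φ := by
        by_contra hc
        have := Real.sin_nonpos_of_nonpos_of_neg_pi_le (not_lt.mp hc) h1.le
        linarith
      refine ⟨p0, ?_⟩
      by_contra hc
      have := Real.sin_nonpos_of_nonpos_of_neg_pi_le (x := w.arg - φ) (by linarith [not_lt.mp hc])
        (by linarith)
      linarith
    · rintro ⟨k1, k2⟩
      exact ⟨Real.sin_pos_of_pos_of_lt_pi k1 h2, Real.sin_pos_of_pos_of_lt_pi (by linarith)
        (by linarith)⟩

theorem split_preserving : MeasurePreserving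
    (fun x : EuclideanSpace ℝ (Fin 3) => ((x 0, (⟨x 1, x 2⟩ : ℂ)) : ℝ × ℂ)) := by
  have h1 := PiLp.volume_preserving_ofLp (Fin 3)
  have h2 := volume_preserving_piFinSuccAbove (fun _ : Fin 3 => ℝ) 0
  have h3 := (MeasurePreserving.id (volume : Measure ℝ)).prod
    (Complex.volume_preserving_equiv_pi.symm)
  have h := (h3.comp (h2.comp h1))
  rw [Measure.volume_eq_prod ℝ ℂ]
  convert h using 1
  funext x
  refine Prod.ext rfl ?_
  apply Complex.ext
  · simp [Complex.measurableEquivPi]; rfl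
  · simp [Complex.measurableEquivPi]; rfl

theorem wedge_coord (w : ℂ) (hw : 0 < w.im) (ρ : ℝ) :
    volume {x : EuclideanSpace ℝ (Fin 3) | (0 < x 2 ∧ 0 < x 1 * w.im - x 2 * w.re) ∧ ‖x‖ < ρ} *
      ENNReal.ofReal (2 * Real.pi) =
    ENNReal.ofReal w.arg * volume (ball (0 : EuclideanSpace ℝ (Fin 3)) ρ) := by
  have nr : ∀ x : EuclideanSpace ℝ (Fin 3), ‖x‖ < ρ ↔
      (0 < ρ ∧ x 0 ^ 2 + ‖(⟨x 1, x 2⟩ : ℂ)‖ ^ 2 < ρ ^ 2) := by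
    intro x
    have e : ‖x‖ ^ 2 = x 0 ^ 2 + ‖(⟨x 1, x 2⟩ : ℂ)‖ ^ 2 := by
      rw [EuclideanSpace.norm_sq_eq, Fin.sum_univ_three, ← Complex.normSq_eq_norm_sq,
        Complex.normSq_mk]
      simp only [Real.norm_eq_abs, sq_abs]
      ring
    rw [← e]
    constructor
    · intro h
      have := norm_nonneg x
      exact ⟨by linarith, by gcongr⟩
    · rintro ⟨h0, h⟩
      exact lt_of_pow_lt_pow_left₀ 2 h0.le h
  set M : ℝ → Set ℝ := fun t => {s | 0 < ρ ∧ t ^ 2 + s ^ 2 < ρ ^ 2} with hMdef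
  have hM : ∀ t, MeasurableSet (M t) := by
    intro t
    have m : MeasurableSet {s : ℝ | t ^ 2 + s ^ 2 < ρ ^ 2} :=
      measurableSet_lt (by fun_prop) measurable_const
    have m2 : MeasurableSet {s : ℝ | 0 < ρ} := MeasurableSet.const _
    exact m2.inter m
  have hP : MeasurableSet {p : ℝ × ℂ | ‖p.2‖ ∈ M p.1} := by
    have m : MeasurableSet {p : ℝ × ℂ | p.1 ^ 2 + ‖p.2‖ ^ 2 < ρ ^ 2} :=
      measurableSet_lt (by fun_prop) measurable_const
    have m2 : MeasurableSet {p : ℝ × ℂ | 0 < ρ} := MeasurableSet.const _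
    exact m2.inter m
  have hQ : MeasurableSet {p : ℝ × ℂ | (0 < p.2.im ∧ 0 < p.2.re * w.im - p.2.im * w.re) ∧
      ‖p.2‖ ∈ M p.1} := by
    have m : MeasurableSet {p : ℝ × ℂ | 0 < p.2.im} :=
      measurableSet_lt measurable_const (Complex.measurable_im.comp measurable_snd)
    have m2 : MeasurableSet {p : ℝ × ℂ | 0 < p.2.re * w.im - p.2.im * w.re} := by
      refine measurableSet_lt measurable_const ?_
      exact ((Complex.measurable_re.comp measurable_snd).mul_const _).sub
        ((Complex.measurable_im.comp measurable_snd).mul_const _)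
    exact (m.inter m2).inter hP
  have s1 : {x : EuclideanSpace ℝ (Fin 3) | (0 < x 2 ∧ 0 < x 1 * w.im - x 2 * w.re) ∧ ‖x‖ < ρ} =
      (fun x : EuclideanSpace ℝ (Fin 3) => ((x 0, (⟨x 1, x 2⟩ : ℂ)) : ℝ × ℂ)) ⁻¹'
      {p : ℝ × ℂ | (0 < p.2.im ∧ 0 < p.2.re * w.im - p.2.im * w.re) ∧ ‖p.2‖ ∈ M p.1} := by
    ext x
    exact and_congr_right fun _ => nr x
  have s2 : ball (0 : EuclideanSpace ℝ (Fin 3)) ρ =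
      (fun x : EuclideanSpace ℝ (Fin 3) => ((x 0, (⟨x 1, x 2⟩ : ℂ)) : ℝ × ℂ)) ⁻¹'
      {p : ℝ × ℂ | ‖p.2‖ ∈ M p.1} := by
    ext x
    rw [mem_ball_zero_iff]
    exact nr x
  rw [s1, s2, split_preserving.measure_preimage hQ.nullMeasurableSet,
    split_preserving.measure_preimage hP.nullMeasurableSet, Measure.volume_eq_prod,
    Measure.prod_apply hQ, Measure.prod_apply hP]
  rw [← lintegral_mul_const _ (measurable_measure_prodMk_left hQ),
    ← lintegral_const_mul _ (measurable_measure_prodMk_left hP)]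
  refine lintegral_congr fun t => ?_
  exact sector w hw (M t) (hM t)

local notation "E3" => EuclideanSpace ℝ (Fin 3)

theorem tri_basis (u v w : E3) (h : LinearIndependent ℝ ![u, v, w]) :
    ∃ e : OrthonormalBasis (Fin 3) ℝ E3, inner ℝ (e 1) u = 0 ∧ inner ℝ (e 2) u = 0 ∧
      inner ℝ (e 2) v = 0 ∧ 0 < inner ℝ (e 0) u ∧ 0 < inner ℝ (e 1) v ∧ 0 < inner ℝ (e 2) w := by
  have hd : Module.finrank ℝ E3 = Fintype.card (Fin 3) := by simp
  set f : Fin 3 → E3 := ![u, v, w] with hf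
  have tri : ∀ i j : Fin 3, i < j →
      inner ℝ (InnerProductSpace.gramSchmidtOrthonormalBasis hd f j) (f i) = 0 :=
    fun i j hij => InnerProductSpace.gramSchmidtOrthonormalBasis_inv_triangular hd f hij
  have pos : ∀ i : Fin 3,
      0 < inner ℝ (InnerProductSpace.gramSchmidtOrthonormalBasis hd f i) (f i) := by
    intro i
    have n0 := InnerProductSpace.gramSchmidt_ne_zero (𝕜 := ℝ) i h
    have n1 : InnerProductSpace.gramSchmidtNormed ℝ f i ≠ 0 := by
      have := InnerProductSpace.gramSchmidtNormed_unit_length (𝕜 := ℝ) i h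
      intro hc
      rw [hc] at this
      simp at this
    rw [InnerProductSpace.gramSchmidtOrthonormalBasis_apply hd n1]
    unfold InnerProductSpace.gramSchmidtNormed
    have key : inner ℝ (InnerProductSpace.gramSchmidt ℝ f i) (f i) =
        ‖InnerProductSpace.gramSchmidt ℝ f i‖ ^ 2 := by
      conv_lhs => rw [InnerProductSpace.gramSchmidt_def'' ℝ f i]
      rw [inner_add_right, inner_sum, Finset.sum_eq_zero, add_zero, real_inner_self_eq_norm_sq]
      intro j hj
      rw [inner_smul_right, InnerProductSpace.gramSchmidt_orthogonal ℝ f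
        (Finset.mem_Iio.mp hj).ne', mul_zero]
    rw [real_inner_smul_left, key]
    have : 0 < ‖InnerProductSpace.gramSchmidt ℝ f i‖ := norm_pos_iff.mpr n0
    simp only [RCLike.ofReal_real_eq_id, id_eq]
    positivity
  exact ⟨InnerProductSpace.gramSchmidtOrthonormalBasis hd f, tri 0 1 (by decide),
    tri 0 2 (by decide), tri 1 2 (by decide), pos 0, pos 1, pos 2⟩

/-- Gram determinant -/
noncomputable def gram3 (u v w : E3) : ℝ :=
  inner ℝ u u * inner ℝ v v * inner ℝ w w + 2 * (inner ℝ u v * inner ℝ u w * inner ℝ v w)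
  - inner ℝ u u * inner ℝ v w ^ 2 - inner ℝ v v * inner ℝ u w ^ 2 - inner ℝ w w * inner ℝ u v ^ 2

/-- the complex number whose argument is the dihedral angle -/
noncomputable def zz (u v w : E3) (V : ℝ) : ℂ :=
  ⟨inner ℝ u u * inner ℝ v w - inner ℝ u v * inner ℝ u w, ‖u‖ * V⟩

theorem wedge (u v w : E3) (h : LinearIndependent ℝ ![u, v, w]) (V : ℝ) (hV : 0 < V)
    (hG : V ^ 2 = gram3 u v w) (f g : E3 →ₗ[ℝ] ℝ) (fu : f u = 0) (fv : f v = 1) (fw : f w = 0)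
    (gu : g u = 0) (gv : g v = 0) (gw : g w = 1) (ρ : ℝ) :
    volume ({x : E3 | 0 < f x ∧ 0 < g x} ∩ ball 0 ρ) * ENNReal.ofReal (2 * Real.pi) =
      ENNReal.ofReal (zz u v w V).arg * volume (ball (0 : E3) ρ) := by
  obtain ⟨e, z1, z2, z3, p0, p1, p2⟩ := tri_basis u v w h
  have ip : ∀ x y : E3, inner ℝ x y = inner ℝ (e 0) x * inner ℝ (e 0) y +
      inner ℝ (e 1) x * inner ℝ (e 1) y + inner ℝ (e 2) x * inner ℝ (e 2) y := by
    intro x y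
    rw [← e.sum_inner_mul_inner x y, Fin.sum_univ_three]
    simp only [real_inner_comm]
  have dec : ∀ x : E3, x = inner ℝ (e 0) x • e 0 + inner ℝ (e 1) x • e 1 + inner ℝ (e 2) x • e 2 := by
    intro x
    have := e.sum_repr' x
    rw [Fin.sum_univ_three] at this
    exact this.symm
  have lin : ∀ (f : E3 →ₗ[ℝ] ℝ) (x : E3), f x = inner ℝ (e 0) x * f (e 0) +
      inner ℝ (e 1) x * f (e 1) + inner ℝ (e 2) x * f (e 2) := by
    intro f x
    conv_lhs => rw [dec x]
    simp only [map_add, map_smul, smul_eq_mul]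
  have Fu := lin f u
  have Fv := lin f v
  have Fw := lin f w
  have Gu := lin g u
  have Gv := lin g v
  have Gw := lin g w
  rw [fu, z1, z2] at Fu
  rw [fv, z3] at Fv
  rw [fw] at Fw
  rw [gu, z1, z2] at Gu
  rw [gv, z3] at Gv
  rw [gw] at Gw
  have uu := ip u u
  have uv := ip u v
  have uw := ip u w
  have vv := ip v v
  have vw := ip v w
  have ww := ip w w
  have F := lin f
  have G := lin g
  rw [z1, z2] at uu uv uw
  rw [z3] at uv vv vw
  have nu : ‖u‖ = inner ℝ (e 0) u := by
    rw [← abs_of_pos p0, ← abs_of_nonneg (norm_nonneg u), ← sq_eq_sq_iff_abs_eq_abs,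
      ← real_inner_self_eq_norm_sq, uu]
    ring
  unfold zz
  unfold gram3 at hG
  rw [nu]
  rw [uu, uv, uw, vw]
  rw [uu, uv, uw, vv, vw, ww] at hG
  have cz : (⟨inner ℝ (e 1) w, inner ℝ (e 2) w⟩ : ℂ).arg =
      (⟨(inner ℝ (e 0) u * inner ℝ (e 0) u + 0 * 0 + 0 * 0) *
      (inner ℝ (e 0) v * inner ℝ (e 0) w + inner ℝ (e 1) v * inner ℝ (e 1) w + 0 * inner ℝ (e 2) w)
      - (inner ℝ (e 0) u * inner ℝ (e 0) v + 0 * inner ℝ (e 1) v + 0 * 0) *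
      (inner ℝ (e 0) u * inner ℝ (e 0) w + 0 * inner ℝ (e 1) w + 0 * inner ℝ (e 2) w),
      inner ℝ (e 0) u * V⟩ : ℂ).arg := by
    have hVe : V = inner ℝ (e 0) u * inner ℝ (e 1) v * inner ℝ (e 2) w := by
      rw [← abs_of_pos hV, ← abs_of_pos (mul_pos (mul_pos p0 p1) p2), ← sq_eq_sq_iff_abs_eq_abs, hG]
      ring
    rw [← Complex.arg_real_mul _ (mul_pos (mul_pos p0 p0) p1)]
    congr 1
    apply Complex.ext
    · simp only [Complex.re_ofReal_mul]; ring
    · simp only [Complex.im_ofReal_mul]; rw [hVe]; ring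
  rw [← cz, ← wedge_coord _ p2 ρ]
  congr 1
  have ms : MeasurableSet {x : E3 | (0 < x 2 ∧ 0 < x 1 * (⟨inner ℝ (e 1) w, inner ℝ (e 2) w⟩ : ℂ).im
      - x 2 * (⟨inner ℝ (e 1) w, inner ℝ (e 2) w⟩ : ℂ).re) ∧ ‖x‖ < ρ} := by
    have m1 : MeasurableSet {x : E3 | 0 < x 2} := measurableSet_lt measurable_const (by fun_prop)
    have m2 : MeasurableSet {x : E3 | 0 < x 1 * (⟨inner ℝ (e 1) w, inner ℝ (e 2) w⟩ : ℂ).im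
      - x 2 * (⟨inner ℝ (e 1) w, inner ℝ (e 2) w⟩ : ℂ).re} :=
      measurableSet_lt measurable_const (by fun_prop)
    have m3 : MeasurableSet {x : E3 | ‖x‖ < ρ} := measurableSet_lt (by fun_prop) measurable_const
    exact (m1.inter m2).inter m3
  rw [← e.measurePreserving_repr.measure_preimage ms.nullMeasurableSet]
  congr 1
  have fe0 : f (e 0) = 0 := by
    have : inner ℝ (e 0) u * f (e 0) = 0 := by linarith
    exact (mul_eq_zero.mp this).resolve_left p0.ne'
  have ge0 : g (e 0) = 0 := by
    have : inner ℝ (e 0) u * g (e 0) = 0 := by linarith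
    exact (mul_eq_zero.mp this).resolve_left p0.ne'
  rw [fe0] at Fv Fw
  rw [ge0] at Gv Gw
  have ge1 : g (e 1) = 0 := by
    have : inner ℝ (e 1) v * g (e 1) = 0 := by linarith
    exact (mul_eq_zero.mp this).resolve_left p1.ne'
  rw [ge1] at Gw
  have ge2 : 0 < g (e 2) := by
    have : 0 < inner ℝ (e 2) w * g (e 2) := by linarith
    exact (pos_iff_pos_of_mul_pos this).mp p2
  have fe1 : 0 < f (e 1) := by
    have : 0 < inner ℝ (e 1) v * f (e 1) := by linarith
    exact (pos_iff_pos_of_mul_pos this).mp p1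
  ext x
  have hn : ‖e.repr x‖ = ‖x‖ := e.repr.norm_map x
  simp only [Set.mem_inter_iff, Set.mem_preimage, Set.mem_ofPred_eq, mem_ball_zero_iff,
    OrthonormalBasis.repr_apply_apply, hn]
  have h1 : 0 < f x ↔ 0 < inner ℝ (e 1) x * inner ℝ (e 2) w - inner ℝ (e 2) x * inner ℝ (e 1) w := by
    have : f x * inner ℝ (e 2) w = f (e 1) *
        (inner ℝ (e 1) x * inner ℝ (e 2) w - inner ℝ (e 2) x * inner ℝ (e 1) w) := by
      rw [F x, fe0]
      linear_combination (-inner ℝ (e 2) x) * Fw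
    rw [← mul_pos_iff_of_pos_right p2, this, mul_pos_iff_of_pos_left fe1]
  have h2 : 0 < g x ↔ 0 < inner ℝ (e 2) x := by
    have : g x = inner ℝ (e 2) x * g (e 2) := by
      rw [G x, ge0, ge1]; ring
    rw [this, mul_pos_iff_of_pos_right ge2]
  rw [h1, h2]
  tauto

theorem incl3 {α : Type*} [MeasurableSpace α] (μ : Measure α) [IsFiniteMeasure μ] (P Q R : Set α)
    (hP : MeasurableSet P) (hQ : MeasurableSet Q) (hR : MeasurableSet R) :
    μ.real (Pᶜ ∩ Qᶜ ∩ Rᶜ) = μ.real Set.univ - μ.real P - μ.real Q - μ.real R + μ.real (P ∩ Q)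
      + μ.real (P ∩ R) + μ.real (Q ∩ R) - μ.real (P ∩ Q ∩ R) := by
  have key : ∀ A B : Set α, MeasurableSet B → μ.real (A ∩ Bᶜ) = μ.real A - μ.real (A ∩ B) := by
    intro A B hB
    have := measureReal_inter_add_sdiff (μ := μ) (s := A) hB
    rw [Set.diff_eq] at this
    linarith
  have k1 := key (Pᶜ ∩ Qᶜ) R hR
  have k2 := key Pᶜ Q hQ
  have k3 := key Set.univ P hP
  have k4 := key Q P hP
  have k5 := key (R ∩ Pᶜ) Q hQ
  have k6 := key R P hP
  have k7 := key (R ∩ Q) P hP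
  have e1 : Pᶜ ∩ Qᶜ ∩ R = R ∩ Pᶜ ∩ Qᶜ := by ext; simp; tauto
  have e2 : Pᶜ ∩ Q = Q ∩ Pᶜ := Set.inter_comm _ _
  have e3 : R ∩ Pᶜ ∩ Q = R ∩ Q ∩ Pᶜ := by ext; simp; tauto
  have e4 : R ∩ Q ∩ P = P ∩ Q ∩ R := by ext; simp; tauto
  rw [e1] at k1
  rw [e2] at k2
  rw [e3] at k5
  rw [Set.univ_inter, Set.univ_inter] at k3
  rw [e4] at k7
  rw [Set.inter_comm Q P] at k4
  rw [Set.inter_comm R P] at k6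
  rw [Set.inter_comm R Q] at k7 k5
  rw [Set.inter_comm R Q] at *
  linarith

theorem null_plane (f : E3 →ₗ[ℝ] ℝ) (hf : f ≠ 0) : volume {x : E3 | f x = 0} = 0 := by
  have h : LinearMap.ker f ≠ ⊤ := by
    rwa [Ne, LinearMap.ker_eq_top]
  have := Measure.addHaar_submodule (volume : Measure E3) (LinearMap.ker f) h
  convert this using 2
  ext x
  simp

theorem meas_pos (f : E3 →ₗ[ℝ] ℝ) : MeasurableSet {x : E3 | 0 < f x} :=
  measurableSet_lt measurable_const f.continuous_of_finiteDimensional.measurable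

theorem cone_incl (f g h : E3 →ₗ[ℝ] ℝ) (hf : f ≠ 0) (hg : g ≠ 0) (hh : h ≠ 0) (ρ : ℝ) :
    2 * volume.real ({x : E3 | 0 < f x ∧ 0 < g x ∧ 0 < h x} ∩ ball 0 ρ) +
      volume.real (ball (0 : E3) ρ) / 2 =
    volume.real ({x : E3 | 0 < f x ∧ 0 < g x} ∩ ball 0 ρ) +
    volume.real ({x : E3 | 0 < f x ∧ 0 < h x} ∩ ball 0 ρ) +
    volume.real ({x : E3 | 0 < g x ∧ 0 < h x} ∩ ball 0 ρ) := by
  set μ : Measure E3 := volume.restrict (ball 0 ρ) with hμ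
  have : IsFiniteMeasure μ := ⟨by
    rw [hμ, Measure.restrict_apply_univ]; exact measure_ball_lt_top⟩
  have mf := meas_pos f
  have mg := meas_pos g
  have mh := meas_pos h
  have conv : ∀ S : Set E3, MeasurableSet S → volume.real (S ∩ ball 0 ρ) = μ.real S := by
    intro S hS
    rw [hμ, measureReal_restrict_apply hS]
  have neg : ∀ S : Set E3, MeasurableSet S → μ.real (-S) = μ.real S := by
    intro S hS
    rw [← conv _ hS, ← conv _ hS.neg]
    have : -S ∩ ball (0 : E3) ρ = -(S ∩ ball 0 ρ) := by
      ext x; simp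
    rw [this]
    unfold Measure.real
    rw [Measure.measure_neg]
  have ae0 : ∀ f : E3 →ₗ[ℝ] ℝ, f ≠ 0 → ∀ᵐ x ∂μ, f x ≠ 0 := by
    intro f hf
    apply ae_restrict_of_ae
    have := null_plane f hf
    rw [ae_iff]
    simpa using this
  have half : ∀ f : E3 →ₗ[ℝ] ℝ, f ≠ 0 → μ.real {x | 0 < f x} = μ.real Set.univ / 2 := by
    intro f hf
    have m := meas_pos f
    have h1 := measureReal_compl (μ := μ) m
    have h2 := neg _ m
    have h3 : μ.real {x | 0 < f x}ᶜ = μ.real (-{x | 0 < f x}) := by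
      apply measureReal_congr
      filter_upwards [ae0 f hf] with x hx
      apply propext
      change ¬ (0 < f x) ↔ 0 < f (-x)
      rw [map_neg]
      constructor
      · intro h; have := lt_of_le_of_ne (not_lt.mp h) hx; linarith
      · intro h; linarith
    linarith
  have I := incl3 μ _ _ _ mf mg mh
  have I2 := neg _ ((mf.inter mg).inter mh)
  have I3 : μ.real ({x | 0 < f x}ᶜ ∩ {x | 0 < g x}ᶜ ∩ {x | 0 < h x}ᶜ) =
      μ.real (-({x | 0 < f x} ∩ {x | 0 < g x} ∩ {x | 0 < h x})) := by
    apply measureReal_congr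
    filter_upwards [ae0 f hf, ae0 g hg, ae0 h hh] with x hx hy hz
    apply propext
    change (¬ (0 < f x) ∧ ¬ (0 < g x)) ∧ ¬ (0 < h x) ↔ (0 < f (-x) ∧ 0 < g (-x)) ∧ 0 < h (-x)
    rw [map_neg, map_neg, map_neg]
    constructor
    · rintro ⟨⟨h1, h2⟩, h3⟩
      have := lt_of_le_of_ne (not_lt.mp h1) hx
      have := lt_of_le_of_ne (not_lt.mp h2) hy
      have := lt_of_le_of_ne (not_lt.mp h3) hz
      exact ⟨⟨by linarith, by linarith⟩, by linarith⟩
    · rintro ⟨⟨h1, h2⟩, h3⟩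
      exact ⟨⟨by linarith, by linarith⟩, by linarith⟩
  rw [half f hf, half g hg, half h hh] at I
  have c1 := conv _ (mf.inter mg)
  have c2 := conv _ (mf.inter mh)
  have c3 := conv _ (mg.inter mh)
  have c4 := conv _ ((mf.inter mg).inter mh)
  have c5 := conv _ MeasurableSet.univ
  rw [Set.univ_inter] at c5
  have d : {x : E3 | 0 < f x ∧ 0 < g x ∧ 0 < h x} =
      {x | 0 < f x} ∩ {x | 0 < g x} ∩ {x | 0 < h x} := by
    ext x
    exact and_assoc.symm
  have d1 : {x : E3 | 0 < f x ∧ 0 < g x} = {x | 0 < f x} ∩ {x | 0 < g x} := rfl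
  have d2 : {x : E3 | 0 < f x ∧ 0 < h x} = {x | 0 < f x} ∩ {x | 0 < h x} := rfl
  have d3 : {x : E3 | 0 < g x ∧ 0 < h x} = {x | 0 < g x} ∩ {x | 0 < h x} := rfl
  rw [d, d1, d2, d3, c1, c2, c3, c4, c5]
  linarith

/-- angle identity -/
theorem arg_sum (z1 z2 z3 : ℂ) (h1 : 0 < z1.im) (h2 : 0 < z2.im) (h3 : 0 < z3.im)
    (k D V : ℝ) (hk : 0 < k) (hD : 0 < D) (hV : 0 < V)
    (h : z1 * z2 * z3 = -(k : ℂ) * (⟨D, V⟩ : ℂ) ^ 2) :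
    z1.arg + z2.arg + z3.arg - Real.pi = 2 * Real.arctan (V / D) := by
  have P : ∀ z : ℂ, 0 < z.im → 0 < z.arg ∧ z.arg < Real.pi := by
    intro z hz
    refine ⟨?_, ?_⟩
    · have h0 : 0 ≤ z.arg := Complex.arg_nonneg_iff.mpr hz.le
      refine lt_of_le_of_ne h0 fun hc => ?_
      have := (Complex.arg_eq_zero_iff.mp hc.symm).2
      linarith
    · exact Complex.arg_lt_pi_iff.mpr (Or.inr hz.ne')
  have nz : ∀ z : ℂ, 0 < z.im → z ≠ 0 := by
    rintro z hz rfl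
    simp at hz
  have e4 : (⟨D, V⟩ : ℂ).arg = Real.arctan (V / D) := by
    have := Complex.arg_of_re_nonneg (x := ⟨D, V⟩) hD.le
    rw [Real.arctan_eq_arcsin, this]
    congr 1
    have hn : ‖(⟨D, V⟩ : ℂ)‖ = D * √(1 + (V / D) ^ 2) := by
      rw [Complex.norm_def, Complex.normSq_mk]
      have e : D * D + V * V = D ^ 2 * (1 + (V / D) ^ 2) := by
        field_simp
      rw [e, Real.sqrt_mul (by positivity), Real.sqrt_sq hD.le]
    rw [hn]
    field_simp
  have p4 := Real.arctan_pos.mpr (div_pos hV hD)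
  have q4 := Real.arctan_lt_pi_div_two (V / D)
  obtain ⟨a1, b1⟩ := P z1 h1
  obtain ⟨a2, b2⟩ := P z2 h2
  obtain ⟨a3, b3⟩ := P z3 h3
  have n4 : (⟨D, V⟩ : ℂ) ≠ 0 := nz _ hV
  have ang : ((z1.arg + z2.arg + z3.arg : ℝ) : Real.Angle) =
      ((Real.pi + 2 * Real.arctan (V / D) : ℝ) : Real.Angle) := by
    have l : ((z1 * z2 * z3).arg : Real.Angle) = ((z1.arg + z2.arg + z3.arg : ℝ) : Real.Angle) := by
      rw [Complex.arg_mul_coe_angle (mul_ne_zero (nz _ h1) (nz _ h2)) (nz _ h3),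
        Complex.arg_mul_coe_angle (nz _ h1) (nz _ h2)]
      push_cast
      rfl
    have r : ((-(k : ℂ) * (⟨D, V⟩ : ℂ) ^ 2).arg : Real.Angle) =
        ((Real.pi + 2 * Real.arctan (V / D) : ℝ) : Real.Angle) := by
      have nk : (-(k : ℂ)) ≠ 0 := by
        simpa using hk.ne'
      rw [Complex.arg_mul_coe_angle nk (pow_ne_zero 2 n4), sq, Complex.arg_mul_coe_angle n4 n4, e4]
      have : (-(k : ℂ)).arg = Real.pi := by
        have := Complex.arg_ofReal_of_neg (x := -k) (by linarith)
        simpa using this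
      rw [this, two_mul]
      push_cast
      rfl
    rw [← l, ← r, h]
  rw [Real.Angle.angle_eq_iff_two_pi_dvd_sub] at ang
  obtain ⟨n, hn⟩ := ang
  have hp := Real.pi_pos
  have : n = 0 := by
    have u : (n : ℝ) < 1 := by
      by_contra hc
      push Not at hc
      nlinarith
    have l : (-1 : ℝ) < n := by
      by_contra hc
      push Not at hc
      nlinarith
    have u' : n < 1 := by exact_mod_cast u
    have l' : -1 < n := by exact_mod_cast l
    omega
  rw [this] at hn
  simp at hn
  linarith

theorem zz_prod (a b c p q s V : ℝ)
    (hV : V ^ 2 = a * a * (b * b) * (c * c) + 2 * (p * q * s) - a * a * s ^ 2 - b * b * q ^ 2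
      - c * c * p ^ 2) :
    (⟨a * a * s - p * q, a * V⟩ : ℂ) * ⟨b * b * q - p * s, b * V⟩ * ⟨c * c * p - q * s, c * V⟩ =
      -(((a * b - p) * (a * c - q) * (b * c - s) / 2 : ℝ) : ℂ) *
        (⟨a * b * c + a * s + b * q + c * p, V⟩ : ℂ) ^ 2 := by
  apply Complex.ext
  · simp only [Complex.mul_re, Complex.mul_im, Complex.neg_re, Complex.neg_im, Complex.ofReal_re,
      Complex.ofReal_im, sq (⟨a * b * c + a * s + b * q + c * p, V⟩ : ℂ)]
    linear_combination (-(b * c * (a * a * s - p * q) + a * c * (b * b * q - p * s) +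
      a * b * (c * c * p - q * s)) - (a * b - p) * (a * c - q) * (b * c - s) / 2) * hV
  · simp only [Complex.mul_re, Complex.mul_im, Complex.neg_re, Complex.neg_im, Complex.ofReal_re,
      Complex.ofReal_im, sq (⟨a * b * c + a * s + b * q + c * p, V⟩ : ℂ)]
    linear_combination (-(a * b * c * V)) * hV

theorem cs_strict (a b c p q s V : ℝ) (hp : p ≤ a * b) (hq : q ≤ a * c)
    (hs : -(b * c) ≤ s) (hV0 : 0 < V)
    (hV : V ^ 2 = a * a * (b * b) * (c * c) + 2 * (p * q * s) - a * a * s ^ 2 - b * b * q ^ 2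
      - c * c * p ^ 2) : p < a * b ∧ q < a * c := by
  have e : (a * b * c + a * s - b * q - c * p) ^ 2 + V ^ 2 =
      2 * ((a * b - p) * (a * c - q) * (b * c + s)) := by
    rw [hV]; ring
  have : 0 < 2 * ((a * b - p) * (a * c - q) * (b * c + s)) := by rw [← e]; positivity
  constructor
  · refine lt_of_le_of_ne hp fun hc => ?_
    rw [hc] at this
    simp at this
  · refine lt_of_le_of_ne hq fun hc => ?_
    rw [hc] at this
    simp at this

/-- The denominator in the solid angle formula. -/
noncomputable def DD (u v w : E3) : ℝ :=
  ‖u‖ * ‖v‖ * ‖w‖ + ‖u‖ * inner ℝ v w + ‖v‖ * inner ℝ u w + ‖w‖ * inner ℝ u v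

theorem cone_vol (u v w : E3) (li : LinearIndependent ℝ ![u, v, w]) (V : ℝ) (hV : 0 < V)
    (hG : V ^ 2 = gram3 u v w) (hD : 0 < DD u v w) (f g h : E3 →ₗ[ℝ] ℝ)
    (fu : f u = 1) (fv : f v = 0) (fw : f w = 0) (gu : g u = 0) (gv : g v = 1) (gw : g w = 0)
    (hu : h u = 0) (hv : h v = 0) (hw : h w = 1) (ρ : ℝ) (hρ : 0 < ρ) :
    volume.real ({x : E3 | 0 < f x ∧ 0 < g x ∧ 0 < h x} ∩ ball 0 ρ) =
      2 / 3 * ρ ^ 3 * Real.arctan (V / DD u v w) := by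
  have li2 : LinearIndependent ℝ ![v, u, w] := by
    have := li.comp ![1, 0, 2] (by decide)
    convert this using 1
    ext i : 1; fin_cases i <;> rfl
  have li3 : LinearIndependent ℝ ![w, u, v] := by
    have := li.comp ![2, 0, 1] (by decide)
    convert this using 1
    ext i : 1; fin_cases i <;> rfl
  have hG2 : V ^ 2 = gram3 v u w := by
    rw [hG]; unfold gram3; rw [real_inner_comm u v]; ring
  have hG3 : V ^ 2 = gram3 w u v := by
    rw [hG]; unfold gram3; rw [real_inner_comm u w, real_inner_comm v w]; ring
  have vb : volume.real (ball (0 : E3) ρ) = ρ ^ 3 * (Real.pi * 4 / 3) := by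
    unfold Measure.real
    rw [EuclideanSpace.volume_ball_fin_three, ENNReal.toReal_mul, ENNReal.toReal_pow,
      ENNReal.toReal_ofReal hρ.le, ENNReal.toReal_ofReal (by positivity)]
  have nf : f ≠ 0 := by rintro rfl; simp at fu
  have ng : g ≠ 0 := by rintro rfl; simp at gv
  have nh : h ≠ 0 := by rintro rfl; simp at hw
  have I := cone_incl f g h nf ng nh ρ
  have W : ∀ (u v w : E3), LinearIndependent ℝ ![u, v, w] → V ^ 2 = gram3 u v w →
      ∀ (f g : E3 →ₗ[ℝ] ℝ), f u = 0 → f v = 1 → f w = 0 → g u = 0 → g v = 0 → g w = 1 →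
      volume.real ({x : E3 | 0 < f x ∧ 0 < g x} ∩ ball 0 ρ) = 
        ρ ^ 3 * (2 / 3) * (zz u v w V).arg := by
    intro u v w li hG f g h1 h2 h3 h4 h5 h6
    have := congrArg ENNReal.toReal (wedge u v w li V hV hG f g h1 h2 h3 h4 h5 h6 ρ)
    rw [ENNReal.toReal_mul, ENNReal.toReal_mul, ENNReal.toReal_ofReal (by positivity),
      ENNReal.toReal_ofReal] at this
    · change volume.real _ * _ = _ * volume.real _ at this
      rw [vb] at this
      have hp := Real.pi_pos
      have : volume.real ({x : E3 | 0 < f x ∧ 0 < g x} ∩ ball 0 ρ) * (2 * Real.pi) = 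
        ρ ^ 3 * (2 / 3) * (zz u v w V).arg * (2 * Real.pi) := by rw [this]; ring
      exact mul_right_cancel₀ (by positivity) this
    · rw [Complex.arg_nonneg_iff]
      exact mul_nonneg (norm_nonneg _) hV.le
  rw [W w u v li3 hG3 f g fw fu fv gw gu gv, W v u w li2 hG2 f h fv fu fw hv hu hw,
    W u v w li hG g h gu gv gw hu hv hw, vb] at I
  have nu : 0 < ‖u‖ := norm_pos_iff.mpr (by simpa using li.ne_zero 0)
  have nv : 0 < ‖v‖ := norm_pos_iff.mpr (by simpa using li.ne_zero 1)
  have nw : 0 < ‖w‖ := norm_pos_iff.mpr (by simpa using li.ne_zero 2)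
  have c1 := abs_le.mp (abs_real_inner_le_norm u v)
  have c2 := abs_le.mp (abs_real_inner_le_norm u w)
  have c3 := abs_le.mp (abs_real_inner_le_norm v w)
  have hG' := hG
  unfold gram3 at hG'
  simp only [real_inner_self_eq_norm_mul_norm] at hG'
  obtain ⟨s1, s2⟩ := cs_strict ‖u‖ ‖v‖ ‖w‖ _ _ _ V c1.2 c2.2 c3.1 hV hG'
  obtain ⟨-, s3⟩ := cs_strict ‖v‖ ‖u‖ ‖w‖ (inner ℝ u v) (inner ℝ v w) (inner ℝ u w) V
    (by linarith) c3.2 c2.1 hV (by rw [hG']; ring)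
  have key := zz_prod _ _ _ _ _ _ V hG'
  have A := arg_sum (zz u v w V) (zz v u w V) (zz w u v V) (mul_pos nu hV) (mul_pos nv hV)
    (mul_pos nw hV) _ (DD u v w) V (by
      have := mul_pos (mul_pos (sub_pos.mpr s1) (sub_pos.mpr s2)) (sub_pos.mpr s3)
      exact half_pos this) hD hV (by
      unfold zz DD
      rw [real_inner_comm u v, real_inner_comm u w, real_inner_comm v w,
        real_inner_self_eq_norm_mul_norm, real_inner_self_eq_norm_mul_norm, 
        real_inner_self_eq_norm_mul_norm]
      exact key)
  have : (zz u v w V).arg + (zz v u w V).arg + (zz w u v V).arg = Real.pi + 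
    2 * Real.arctan (V / DD u v w) := by linarith
  linear_combination I / 2 + ρ ^ 3 / 3 * this

theorem li_of_aff (A B C D : E3) (h : AffineIndependent ℝ ![A, B, C, D]) :
    LinearIndependent ℝ ![B - A, C - A, D - A] := by
  have h1 := (affineIndependent_iff_linearIndependent_vsub ℝ _ (0 : Fin 4)).mp h
  have h2 := h1.comp (fun i : Fin 3 => (⟨i.succ, Fin.succ_ne_zero i⟩ : {x : Fin 4 // x ≠ 0}))
    (by intro i j hij; simpa using hij)
  have e : ((fun i : {x : Fin 4 // x ≠ 0} => ![A, B, C, D] ↑i -ᵥ ![A, B, C, D] 0) ∘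
      fun i : Fin 3 => (⟨i.succ, Fin.succ_ne_zero i⟩ : {x : Fin 4 // x ≠ 0})) =
      ![B - A, C - A, D - A] := by
    ext i : 1
    fin_cases i <;> rfl
  rw [e] at h2
  exact h2

theorem gram_pos (u v w : E3) (h : LinearIndependent ℝ ![u, v, w]) : 0 < gram3 u v w := by
  obtain ⟨e, z1, z2, z3, p0, p1, p2⟩ := tri_basis u v w h
  have ip : ∀ x y : E3, inner ℝ x y = inner ℝ (e 0) x * inner ℝ (e 0) y +
      inner ℝ (e 1) x * inner ℝ (e 1) y + inner ℝ (e 2) x * inner ℝ (e 2) y := by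
    intro x y
    rw [← e.sum_inner_mul_inner x y, Fin.sum_univ_three]
    simp only [real_inner_comm]
  have : gram3 u v w = (inner ℝ (e 0) u * inner ℝ (e 1) v * inner ℝ (e 2) w) ^ 2 := by
    unfold gram3
    rw [ip u u, ip u v, ip u w, ip v v, ip v w, ip w w, z1, z2, z3]
    ring
  rw [this]
  positivity

theorem li_of_gram (u v w : E3) (h : 0 < gram3 u v w) : LinearIndependent ℝ ![u, v, w] := by
  rw [Fintype.linearIndependent_iff]
  intro c hc
  rw [Fin.sum_univ_three] at hc
  simp only [Matrix.cons_val_zero, Matrix.cons_val_one, Matrix.cons_val] at hc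
  have e : ∀ t : E3, c 0 * inner ℝ t u + c 1 * inner ℝ t v + c 2 * inner ℝ t w = 0 := by
    intro t
    have := congrArg (inner ℝ t) hc
    simpa only [inner_add_right, inner_smul_right, inner_zero_right] using this
  have e1 := e u
  have e2 := e v
  have e3 := e w
  rw [real_inner_comm u v] at e2
  rw [real_inner_comm u w, real_inner_comm v w] at e3
  have k0 : c 0 * gram3 u v w = 0 := by
    unfold gram3
    linear_combination (inner ℝ v v * inner ℝ w w - inner ℝ v w ^ 2) * e1 +
      (inner ℝ v w * inner ℝ u w - inner ℝ u v * inner ℝ w w) * e2 +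
      (inner ℝ u v * inner ℝ v w - inner ℝ v v * inner ℝ u w) * e3
  have k1 : c 1 * gram3 u v w = 0 := by
    unfold gram3
    linear_combination (inner ℝ v w * inner ℝ u w - inner ℝ u v * inner ℝ w w) * e1 +
      (inner ℝ u u * inner ℝ w w - inner ℝ u w ^ 2) * e2 +
      (inner ℝ u v * inner ℝ u w - inner ℝ u u * inner ℝ v w) * e3
  have k2 : c 2 * gram3 u v w = 0 := by
    unfold gram3
    linear_combination (inner ℝ u v * inner ℝ v w - inner ℝ v v * inner ℝ u w) * e1 +
      (inner ℝ u v * inner ℝ u w - inner ℝ u u * inner ℝ v w) * e2 +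
      (inner ℝ u u * inner ℝ v v - inner ℝ u v ^ 2) * e3
  intro i
  fin_cases i
  · exact (mul_eq_zero.mp k0).resolve_right h.ne'
  · exact (mul_eq_zero.mp k1).resolve_right h.ne'
  · exact (mul_eq_zero.mp k2).resolve_right h.ne'

/-- dual basis -/
theorem dual_basis (u v w : E3) (li : LinearIndependent ℝ ![u, v, w]) :
    ∃ f g h : E3 →ₗ[ℝ] ℝ, (f u = 1 ∧ f v = 0 ∧ f w = 0) ∧ (g u = 0 ∧ g v = 1 ∧ g w = 0) ∧
      (h u = 0 ∧ h v = 0 ∧ h w = 1) ∧ ∀ x, x = f x • u + g x • v + h x • w := by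
  let b := basisOfLinearIndependentOfCardEqFinrank li (by simp)
  have hb : ⇑b = ![u, v, w] := coe_basisOfLinearIndependentOfCardEqFinrank _ _
  have b0 : b 0 = u := by rw [hb]; rfl
  have b1 : b 1 = v := by rw [hb]; rfl
  have b2 : b 2 = w := by rw [hb]; rfl
  refine ⟨b.coord 0, b.coord 1, b.coord 2, ⟨?_, ?_, ?_⟩, ⟨?_, ?_, ?_⟩, ⟨?_, ?_, ?_⟩, ?_⟩
  rotate_right
  · intro x
    have := b.sum_repr x
    rw [Fin.sum_univ_three, b0, b1, b2] at this
    exact this.symm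
  all_goals (first | rw [← b0] | rw [← b1] | rw [← b2]); simp

/-- the volume of the standard corner simplex -/
noncomputable def cS : ℝ := volume.real (convexHull ℝ {(0 : E3), EuclideanSpace.single 0 1,
  EuclideanSpace.single 1 1, EuclideanSpace.single 2 1})

theorem tetra_vol (A B C D : E3) (V : ℝ) (hV : 0 ≤ V)
    (hG : V ^ 2 = gram3 (B - A) (C - A) (D - A)) :
    volume.real (tetra A B C D) = V * cS := by
  set b := (EuclideanSpace.basisFun (Fin 3) ℝ).toBasis with hb
  set M : Matrix (Fin 3) (Fin 3) ℝ := Matrix.of fun i j => (![B - A, C - A, D - A] j) i with hM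
  set L := Matrix.toLin b b M with hL
  have det : LinearMap.det L = M.det := LinearMap.det_toLin b M
  have Lb : ∀ j, L (EuclideanSpace.single j 1) = ![B - A, C - A, D - A] j := by
    intro j
    have h1 : (EuclideanSpace.single j 1 : E3) = b j := by simp [hb]
    rw [h1, hL, Matrix.toLin_self]
    ext i
    simp [hb, hM]
    fin_cases i <;> simp [Fin.sum_univ_three]
  have T : tetra A B C D = (fun x => A + x) '' (L '' (convexHull ℝ {(0 : E3),
      EuclideanSpace.single 0 1, EuclideanSpace.single 1 1, EuclideanSpace.single 2 1})) := by
    rw [LinearMap.image_convexHull]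
    have := AffineMap.image_convexHull (AffineMap.const ℝ E3 A + AffineMap.id ℝ E3)
      (L '' {(0 : E3), EuclideanSpace.single 0 1, EuclideanSpace.single 1 1,
        EuclideanSpace.single 2 1})
    have e : ⇑(AffineMap.const ℝ E3 A + AffineMap.id ℝ E3) = fun x => A + x := by
      ext x; simp
    rw [e] at this
    rw [this]
    unfold tetra
    congr 1
    simp only [Set.image_insert_eq, Set.image_singleton, Lb, map_zero, add_zero]
    simp
  have dV : |LinearMap.det L| = V := by
    rw [← abs_of_nonneg hV, ← sq_eq_sq_iff_abs_eq_abs, hG, det, Matrix.det_fin_three]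
    unfold gram3
    simp only [hM, EuclideanSpace.inner_eq_star_dotProduct, dotProduct, Fin.sum_univ_three]
    simp
    ring
  unfold Measure.real cS
  rw [T, Set.image_add_left, measure_preimage_add, Measure.addHaar_image_linearMap,
    ENNReal.toReal_mul, dV, ENNReal.toReal_ofReal hV]
  rfl

/-- open cone of radius `ρ` with apex `P` -/
def kone (P u v w : E3) (ρ : ℝ) : Set E3 :=
  {y | ∃ α β γ : ℝ, 0 < α ∧ 0 < β ∧ 0 < γ ∧ y = P + (α • u + β • v + γ • w) ∧ dist y P < ρ}

theorem kone_facts (P u v w : E3) (li : LinearIndependent ℝ ![u, v, w]) (V : ℝ) (hV : 0 < V)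
    (hG : V ^ 2 = gram3 u v w) (hD : 0 < DD u v w) (ρ : ℝ) (hρ : 0 < ρ) :
    MeasurableSet (kone P u v w ρ) ∧
    volume.real (kone P u v w ρ) = 2 / 3 * ρ ^ 3 * Real.arctan (V / DD u v w) ∧
    volume (tetra P (P + u) (P + v) (P + w) ∩ closedBall P ρ) ≤ volume (kone P u v w ρ) := by
  obtain ⟨f, g, h, ⟨fu, fv, fw⟩, ⟨gu, gv, gw⟩, ⟨hu, hv, hw⟩, dec⟩ := dual_basis u v w li
  have cv := cone_vol u v w li V hV hG hD f g h fu fv fw gu gv gw hu hv hw ρ hρ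
  set S : Set E3 := {x : E3 | 0 < f x ∧ 0 < g x ∧ 0 < h x} ∩ ball 0 ρ with hS
  have mS : MeasurableSet S :=
    ((meas_pos f).inter ((meas_pos g).inter (meas_pos h))).inter measurableSet_ball
  have eS : kone P u v w ρ = (fun y => -P + y) ⁻¹' S := by
    ext y
    simp only [kone, hS, Set.mem_preimage, Set.mem_inter_iff, mem_ball_zero_iff]
    constructor
    · rintro ⟨α, β, γ, hα, hβ, hγ, hy, hd⟩
      rw [dist_eq_norm] at hd
      have e : -P + y = α • u + β • v + γ • w := by rw [hy]; abel
      refine ⟨?_, by rwa [neg_add_eq_sub]⟩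
      rw [e]
      change 0 < f _ ∧ 0 < g _ ∧ 0 < h _
      simp only [map_add, map_smul, fu, fv, fw, gu, gv, gw, hu, hv, hw, smul_eq_mul, mul_one,
        mul_zero, add_zero, zero_add]
      exact ⟨hα, hβ, hγ⟩
    · rintro ⟨⟨h1, h2, h3⟩, hd⟩
      refine ⟨_, _, _, h1, h2, h3, ?_, ?_⟩
      · rw [← dec (-P + y)]; abel
      · rw [dist_eq_norm, ← neg_add_eq_sub]; exact hd
  refine ⟨?_, ?_, ?_⟩
  · rw [eS]
    exact (measurable_const_add _) mS
  · rw [eS, ← cv]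
    unfold Measure.real
    rw [measure_preimage_add]
  · rw [eS, measure_preimage_add, ← measure_preimage_add volume P]
    have nf : f ≠ 0 := by rintro rfl; simp at fu
    have ng : g ≠ 0 := by rintro rfl; simp at gv
    have nh : h ≠ 0 := by rintro rfl; simp at hw
    have sub : (fun y => P + y) ⁻¹' (tetra P (P + u) (P + v) (P + w) ∩ closedBall P ρ) ⊆
        S ∪ (({x | f x = 0} ∪ {x | g x = 0} ∪ {x | h x = 0}) ∪ sphere 0 ρ) := by
      have T : tetra P (P + u) (P + v) (P + w) ⊆
          {y | 0 ≤ f (y - P) ∧ 0 ≤ g (y - P) ∧ 0 ≤ h (y - P)} := by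
        unfold tetra
        apply convexHull_min
        · intro y hy
          simp only [Set.mem_insert_iff, Set.mem_singleton_iff] at hy
          change 0 ≤ f (y - P) ∧ 0 ≤ g (y - P) ∧ 0 ≤ h (y - P)
          rcases hy with rfl | rfl | rfl | rfl <;> simp [fu, fv, fw, gu, gv, gw, hu, hv, hw]
        · intro x hx y hy a b ha hb hab
          have e : a • x + b • y - P = a • (x - P) + b • (y - P) := by
            have : P = a • P + b • P := by rw [← add_smul, hab, one_smul]
            conv_lhs => rw [this]
            rw [smul_sub, smul_sub]; abel
          change 0 ≤ f _ ∧ 0 ≤ g _ ∧ 0 ≤ h _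
          rw [e]
          obtain ⟨h1, h2, h3⟩ := hx
          obtain ⟨k1, k2, k3⟩ := hy
          simp only [map_add, map_smul, smul_eq_mul]
          exact ⟨by positivity, by positivity, by positivity⟩
      rintro y ⟨hy, hb⟩
      have t := T hy
      change 0 ≤ f (P + y - P) ∧ 0 ≤ g (P + y - P) ∧ 0 ≤ h (P + y - P) at t
      rw [add_sub_cancel_left] at t
      have hb' : ‖y‖ ≤ ρ := by
        rw [mem_closedBall, dist_eq_norm, add_sub_cancel_left] at hb
        exact hb
      by_contra hc
      simp only [Set.mem_union, not_or] at hc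
      obtain ⟨c1, ⟨⟨c2, c3⟩, c4⟩, c5⟩ := hc
      apply c1
      refine ⟨⟨lt_of_le_of_ne t.1 (Ne.symm c2), lt_of_le_of_ne t.2.1 (Ne.symm c3),
        lt_of_le_of_ne t.2.2 (Ne.symm c4)⟩, ?_⟩
      rw [mem_ball_zero_iff]
      refine lt_of_le_of_ne hb' fun hh => c5 ?_
      rw [mem_sphere_zero_iff_norm]; exact hh
    refine (measure_mono sub).trans ?_
    refine (measure_union_le _ _).trans ?_
    have n0 : volume (({x | f x = 0} ∪ {x | g x = 0} ∪ {x | h x = 0}) ∪ sphere (0 : E3) ρ) = 0 := by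
      rw [measure_union_null_iff, measure_union_null_iff, measure_union_null_iff]
      exact ⟨⟨⟨null_plane f nf, null_plane g ng⟩, null_plane h nh⟩,
        Measure.addHaar_sphere volume _ _⟩
    rw [n0, add_zero]

theorem kone_sub (P u v w : E3) (ρ : ℝ)
    (hyp : ∀ α β γ : ℝ, 0 < α → 0 < β → 0 < γ → ‖α • u + β • v + γ • w‖ < ρ → α + β + γ ≤ 1) :
    kone P u v w ρ ⊆ tetra P (P + u) (P + v) (P + w) := by
  rintro y ⟨α, β, γ, hα, hβ, hγ, rfl, hd⟩
  rw [dist_eq_norm, add_sub_cancel_left] at hd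
  have hs := hyp α β γ hα hβ hγ hd
  unfold tetra
  have c := convex_convexHull ℝ ({P, P + u, P + v, P + w} : Set E3)
  have key := c.sum_mem (t := Finset.univ) (w := ![1 - α - β - γ, α, β, γ])
    (z := ![P, P + u, P + v, P + w])
    (by intro i _; fin_cases i <;> simp <;> linarith)
    (by rw [Fin.sum_univ_four]; simp; ring)
    (by intro i _; apply subset_convexHull; fin_cases i <;> simp)
  rw [Fin.sum_univ_four] at key
  convert key using 1
  simp
  module

theorem inner_edges (P Q R : E3) :
    inner ℝ (Q - P) (R - P) = (dist P Q * dist P Q + dist P R * dist P R - dist Q R * dist Q R) / 2 := by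
  rw [real_inner_eq_norm_mul_self_add_norm_mul_self_sub_norm_sub_mul_self_div_two,
    sub_sub_sub_cancel_right, dist_comm P Q, dist_comm P R, dist_eq_norm, dist_eq_norm, dist_eq_norm]

theorem gram_edges (P Q R S : E3) : 4 * gram3 (Q - P) (R - P) (S - P) =
    ww (dist P Q * dist P Q) (dist P R * dist P R) (dist P S * dist P S)
      (dist Q R * dist Q R) (dist Q S * dist Q S) (dist R S * dist R S) := by
  unfold gram3 ww
  simp only [inner_edges, dist_self]
  ring

theorem DD_edges (P Q R S : E3) : 2 * DD (Q - P) (R - P) (S - P) =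
    dd (dist P Q) (dist P R) (dist P S) (dist R S) (dist Q S) (dist Q R) := by
  unfold DD dd
  simp only [inner_edges, ← dist_eq_norm, dist_comm _ P]
  ring

theorem vertex (P Q R S : E3) (V : ℝ) (hV : 0 < V)
    (hw : 4 * V ^ 2 = ww (dist P Q * dist P Q) (dist P R * dist P R) (dist P S * dist P S)
      (dist Q R * dist Q R) (dist Q S * dist Q S) (dist R S * dist R S))
    (hd : 0 < dd (dist P Q) (dist P R) (dist P S) (dist R S) (dist Q S) (dist Q R))
    (ρ : ℝ) (hρ : 0 < ρ) :
    MeasurableSet (kone P (Q - P) (R - P) (S - P) ρ) ∧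
    volume.real (kone P (Q - P) (R - P) (S - P) ρ) = 2 / 3 * ρ ^ 3 * Real.arctan
      (2 * V / dd (dist P Q) (dist P R) (dist P S) (dist R S) (dist Q S) (dist Q R)) ∧
    volume.real (tetra P Q R S ∩ closedBall P ρ) ≤ 2 / 3 * ρ ^ 3 * Real.arctan
      (2 * V / dd (dist P Q) (dist P R) (dist P S) (dist R S) (dist Q S) (dist Q R)) := by
  rw [← gram_edges] at hw
  rw [← DD_edges] at hd ⊢
  have hG : V ^ 2 = gram3 (Q - P) (R - P) (S - P) := by linarith
  have li := li_of_gram _ _ _ (show 0 < gram3 (Q - P) (R - P) (S - P) by rw [← hG]; positivity)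
  obtain ⟨h1, h2, h3⟩ := kone_facts P _ _ _ li V hV hG (by linarith) ρ hρ
  rw [mul_div_mul_left _ _ (two_ne_zero)]
  refine ⟨h1, h2, ?_⟩
  rw [← h2]
  rw [add_sub_cancel, add_sub_cancel, add_sub_cancel] at h3
  apply ENNReal.toReal_mono _ h3
  have : kone P (Q - P) (R - P) (S - P) ρ ⊆ ball P ρ := by
    rintro y ⟨α, β, γ, -, -, -, -, h⟩
    exact h
  exact ((measure_mono this).trans_lt measure_ball_lt_top).ne

theorem tetra_pB (A B C D : E3) : tetra A B C D = tetra B A C D := by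
  unfold tetra; rw [Set.insert_comm]

theorem tetra_pC (A B C D : E3) : tetra A B C D = tetra C A B D := by
  unfold tetra; rw [Set.insert_comm B C, Set.insert_comm A C]

theorem tetra_pD (A B C D : E3) : tetra A B C D = tetra D A B C := by
  unfold tetra; congr 1; ext x; simp; tauto

theorem four_vertices (A B C D : E3) (V : ℝ) (hV : 0 < V) (a b c x y z : ℝ)
    (ha : dist A B = a) (hb : dist A C = b) (hc : dist A D = c)
    (hx : dist B C = x) (hy : dist B D = y) (hz : dist C D = z)
    (hw : 4 * V ^ 2 = ww (a * a) (b * b) (c * c) (x * x) (y * y) (z * z))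
    (h1 : 0 < dd a b c z y x) (h2 : 0 < dd a x y z c b) (h3 : 0 < dd b x z y c a)
    (h4 : 0 < dd c y z x b a) (ρ σ : ℝ) (hρ : 0 < ρ) (hσ : 0 < σ) :
    (MeasurableSet (kone A (B - A) (C - A) (D - A) ρ) ∧
    volume.real (kone A (B - A) (C - A) (D - A) ρ) = 2 / 3 * ρ ^ 3 * Real.arctan
      (2 * V / dd a b c z y x) ∧
    volume.real (tetra A B C D ∩ closedBall A ρ) ≤ 2 / 3 * ρ ^ 3 * Real.arctan
      (2 * V / dd a b c z y x)) ∧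
    (MeasurableSet (kone B (A - B) (C - B) (D - B) σ) ∧
    volume.real (kone B (A - B) (C - B) (D - B) σ) = 2 / 3 * σ ^ 3 * Real.arctan
      (2 * V / dd a x y z c b) ∧
    volume.real (tetra A B C D ∩ closedBall B σ) ≤ 2 / 3 * σ ^ 3 * Real.arctan
      (2 * V / dd a x y z c b)) ∧
    (MeasurableSet (kone C (A - C) (B - C) (D - C) σ) ∧
    volume.real (kone C (A - C) (B - C) (D - C) σ) = 2 / 3 * σ ^ 3 * Real.arctan
      (2 * V / dd b x z y c a) ∧
    volume.real (tetra A B C D ∩ closedBall C σ) ≤ 2 / 3 * σ ^ 3 * Real.arctan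
      (2 * V / dd b x z y c a)) ∧
    (MeasurableSet (kone D (A - D) (B - D) (C - D) σ) ∧
    volume.real (kone D (A - D) (B - D) (C - D) σ) = 2 / 3 * σ ^ 3 * Real.arctan
      (2 * V / dd c y z x b a) ∧
    volume.real (tetra A B C D ∩ closedBall D σ) ≤ 2 / 3 * σ ^ 3 * Real.arctan
      (2 * V / dd c y z x b a)) := by
  subst ha hb hc hx hy hz
  refine ⟨vertex A B C D V hV hw h1 ρ hρ, ?_, ?_, ?_⟩
  · have := vertex B A C D V hV
    rw [dist_comm B A, ← tetra_pB A B C D] at this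
    exact this (by rw [hw]; unfold ww; ring) h2 σ hσ
  · have := vertex C A B D V hV
    rw [dist_comm C A, dist_comm C B, ← tetra_pC A B C D] at this
    exact this (by rw [hw]; unfold ww; ring) h3 σ hσ
  · have := vertex D A B C V hV
    rw [dist_comm D A, dist_comm D B, dist_comm D C, ← tetra_pD A B C D] at this
    exact this (by rw [hw]; unfold ww; ring) h4 σ hσ

theorem tetra_finite (A B C D : E3) : volume (tetra A B C D) < ⊤ := by
  unfold tetra
  exact (Set.Finite.isCompact_convexHull ℝ (Set.toFinite _)).measure_lt_top

theorem upper (A B C D : E3) (V : ℝ) (hV : 0 < V) (a b c x y z : ℝ)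
    (ha : dist A B = a) (hb : dist A C = b) (hc : dist A D = c)
    (hx : dist B C = x) (hy : dist B D = y) (hz : dist C D = z)
    (hw : 4 * V ^ 2 = ww (a * a) (b * b) (c * c) (x * x) (y * y) (z * z))
    (h1 : 0 < dd a b c z y x) (h2 : 0 < dd a x y z c b) (h3 : 0 < dd b x z y c a)
    (h4 : 0 < dd c y z x b a) :
    density A B C D 1 (√2 - 1) (√2 - 1) (√2 - 1) ≤
      2 / 3 / cS * (Phi V (dd a b c z y x) (dd a x y z c b) (dd b x z y c a) (dd c y z x b a) / V) := by
  have hr : 0 < √2 - 1 := by have := sqrt2_bounds; linarith [this.1]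
  obtain ⟨⟨-, -, p1⟩, ⟨-, -, p2⟩, ⟨-, -, p3⟩, ⟨-, -, p4⟩⟩ :=
    four_vertices A B C D V hV a b c x y z ha hb hc hx hy hz hw h1 h2 h3 h4 1 (√2 - 1) one_pos hr
  have tv := tetra_vol A B C D V hV.le (by
    have := gram_edges A B C D
    rw [ha, hb, hc, hx, hy, hz, ← hw] at this
    linarith)
  have hc0 : 0 ≤ cS := measureReal_nonneg
  unfold density
  change volume.real _ / volume.real _ ≤ _
  rw [tv, Set.inter_union_distrib_left, Set.inter_union_distrib_left, Set.inter_union_distrib_left]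
  have e : ∀ K : ℝ, 2 / 3 / cS * (K / V) = (2 / 3 * K) / (V * cS) := by
    intro K
    rw [div_mul_div_comm, mul_comm V]
  rw [e]
  gcongr
  refine (measureReal_union_le _ _).trans ?_
  have q1 := measureReal_union_le (μ := volume) (tetra A B C D ∩ closedBall A 1 ∪ tetra A B C D ∩ closedBall B (√2 - 1)) (tetra A B C D ∩ closedBall C (√2 - 1))
  have q2 := measureReal_union_le (μ := volume) (tetra A B C D ∩ closedBall A 1) (tetra A B C D ∩ closedBall B (√2 - 1))
  unfold Phi
  linarith

theorem nsq (u v w : E3) (α β γ : ℝ) : ‖α • u + β • v + γ • w‖ ^ 2 =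
    α ^ 2 * inner ℝ u u + β ^ 2 * inner ℝ v v + γ ^ 2 * inner ℝ w w + 2 * (α * β * inner ℝ u v) +
      2 * (α * γ * inner ℝ u w) + 2 * (β * γ * inner ℝ v w) := by
  rw [← real_inner_self_eq_norm_sq]
  simp only [inner_add_left, inner_add_right, real_inner_smul_left, real_inner_smul_right,
    real_inner_comm u v, real_inner_comm u w, real_inner_comm v w]
  ring

/-- at the big vertex -/
theorem kone_big (A B C D : E3) (ha : dist A B = √2) (hb : dist A C = √2) (hc : dist A D = √2)
    (hx : dist B C = 2 * (√2 - 1)) (hy : dist B D = 2 * (√2 - 1)) (hz : dist C D = 2 * (√2 - 1)) :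
    kone A (B - A) (C - A) (D - A) 1 ⊆ tetra A B C D := by
  have h := kone_sub A (B - A) (C - A) (D - A) 1 (by
    intro α β γ hα hβ hγ hn
    have n2 : ‖α • (B - A) + β • (C - A) + γ • (D - A)‖ ^ 2 < 1 := by
      have := norm_nonneg (α • (B - A) + β • (C - A) + γ • (D - A))
      nlinarith
    rw [nsq] at n2
    simp only [inner_edges, dist_self, ha, hb, hc, hx, hy, hz] at n2
    have s2 := sq2
    have sb := sqrt2_bounds
    have hr : (2 * (√2 - 1)) * (2 * (√2 - 1)) = 12 - 8 * √2 := by linear_combination 4 * s2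
    rw [hr, s2] at n2
    by_contra hs
    push Not at hs
    have k1 : α ^ 2 + β ^ 2 + γ ^ 2 ≥ α * β + α * γ + β * γ := by
      nlinarith [sq_nonneg (α - β), sq_nonneg (α - γ), sq_nonneg (β - γ)]
    have k2 : 1 < (α + β + γ) ^ 2 := by nlinarith
    have k3 : 0 < α * β + α * γ + β * γ := by positivity
    have k4 : (α * β + α * γ + β * γ) * (12 - 8 * √2) ≤ (α * β + α * γ + β * γ) * 3 := by
      apply mul_le_mul_of_nonneg_left _ k3.le
      linarith [sb.1]
    nlinarith)
  rwa [add_sub_cancel, add_sub_cancel, add_sub_cancel] at h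

theorem kone_small (B A C D : E3) (ha : dist B A = √2) (hb : dist A C = √2) (hc : dist A D = √2)
    (hx : dist B C = 2 * (√2 - 1)) (hy : dist B D = 2 * (√2 - 1)) (hz : dist C D = 2 * (√2 - 1)) :
    kone B (A - B) (C - B) (D - B) (√2 - 1) ⊆ tetra B A C D := by
  have h := kone_sub B (A - B) (C - B) (D - B) (√2 - 1) (by
    intro α β γ hα hβ hγ hn
    have s2 := sq2
    have sb := sqrt2_bounds
    have n2 : ‖α • (A - B) + β • (C - B) + γ • (D - B)‖ ^ 2 < (√2 - 1) ^ 2 := by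
      have := norm_nonneg (α • (A - B) + β • (C - B) + γ • (D - B))
      gcongr
    rw [nsq] at n2
    simp only [inner_edges, dist_self, ha, hb, hc, hx, hy, hz] at n2
    have hr : (2 * (√2 - 1)) * (2 * (√2 - 1)) = 12 - 8 * √2 := by linear_combination 4 * s2
    have hr2 : (√2 - 1) ^ 2 = (12 - 8 * √2) / 4 := by linear_combination s2
    rw [hr, s2, hr2] at n2
    by_contra hs
    push Not at hs
    have k2 : 1 < (α + β + γ) ^ 2 := by nlinarith
    have hp : 0 < 12 - 8 * √2 := by linarith [sb.2]
    have hp2 : 12 - 8 * √2 ≤ 2 := by linarith [sb.1]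
    have k4 : α ^ 2 * (12 - 8 * √2) ≤ α ^ 2 * 2 := mul_le_mul_of_nonneg_left hp2 (by positivity)
    have k5 : (12 - 8 * √2) * (1 / 4) < (12 - 8 * √2) *
        (α ^ 2 + β ^ 2 + γ ^ 2 + α * β + α * γ + β * γ) := by
      apply mul_lt_mul_of_pos_left _ hp
      nlinarith [mul_pos hα hβ, mul_pos hα hγ, mul_pos hβ hγ]
    nlinarith)
  rwa [add_sub_cancel, add_sub_cancel, add_sub_cancel] at h

theorem kone_ball (P u v w : E3) (ρ : ℝ) : kone P u v w ρ ⊆ ball P ρ := by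
  rintro y ⟨α, β, γ, -, -, -, -, h⟩
  exact h

theorem lower (A B C D : E3) (V : ℝ) (hV : 0 < V)
    (ha : dist A B = √2) (hb : dist A C = √2) (hc : dist A D = √2)
    (hx : dist B C = 2 * (√2 - 1)) (hy : dist B D = 2 * (√2 - 1)) (hz : dist C D = 2 * (√2 - 1))
    (hw : 4 * V ^ 2 = ww (√2 * √2) (√2 * √2) (√2 * √2) (2 * (√2 - 1) * (2 * (√2 - 1)))
      (2 * (√2 - 1) * (2 * (√2 - 1))) (2 * (√2 - 1) * (2 * (√2 - 1)))) :
    2 / 3 / cS * (Phi V dA0 dB0 dB0 dB0 / V) ≤ density A B C D 1 (√2 - 1) (√2 - 1) (√2 - 1) := by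
  have sb := sqrt2_bounds
  have hr : 0 < √2 - 1 := by linarith [sb.1]
  have hA0 : 0 < dA0 := by rw [dA0_eq]; linarith [sb.2]
  have hB0 : 0 < dB0 := by rw [dB0_eq]; have := sqrt2_fine; linarith [this.1]
  obtain ⟨⟨m1, p1, -⟩, ⟨m2, p2, -⟩, ⟨m3, p3, -⟩, ⟨m4, p4, -⟩⟩ :=
    four_vertices A B C D V hV _ _ _ _ _ _ ha hb hc hx hy hz hw hA0 hB0 hB0 hB0 1 (√2 - 1) one_pos hr
  have tv := tetra_vol A B C D V hV.le (by
    have := gram_edges A B C D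
    rw [ha, hb, hc, hx, hy, hz, ← hw] at this
    linarith)
  have hc0 : 0 ≤ cS := measureReal_nonneg
  have s1 := kone_big A B C D ha hb hc hx hy hz
  have s2 := kone_small B A C D (by rw [dist_comm, ha]) hb hc hx hy hz
  have s3 := kone_small C A B D (by rw [dist_comm, hb]) ha hc (by rw [dist_comm, hx]) hz hy
  have s4 := kone_small D A B C (by rw [dist_comm, hc]) ha hb (by rw [dist_comm, hy])
    (by rw [dist_comm, hz]) hx
  rw [← tetra_pB A B C D] at s2
  rw [← tetra_pC A B C D] at s3
  rw [← tetra_pD A B C D] at s4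
  set K1 := kone A (B - A) (C - A) (D - A) 1
  set K2 := kone B (A - B) (C - B) (D - B) (√2 - 1)
  set K3 := kone C (A - C) (B - C) (D - C) (√2 - 1)
  set K4 := kone D (A - D) (B - D) (C - D) (√2 - 1)
  have b1 : K1 ⊆ ball A 1 := kone_ball _ _ _ _ _
  have b2 : K2 ⊆ ball B (√2 - 1) := kone_ball _ _ _ _ _
  have b3 : K3 ⊆ ball C (√2 - 1) := kone_ball _ _ _ _ _
  have b4 : K4 ⊆ ball D (√2 - 1) := kone_ball _ _ _ _ _
  have d12 : Disjoint K1 K2 := (ball_disjoint_ball (by rw [ha]; linarith)).mono b1 b2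
  have d13 : Disjoint K1 K3 := (ball_disjoint_ball (by rw [hb]; linarith)).mono b1 b3
  have d14 : Disjoint K1 K4 := (ball_disjoint_ball (by rw [hc]; linarith)).mono b1 b4
  have d23 : Disjoint K2 K3 := (ball_disjoint_ball (by rw [hx]; linarith)).mono b2 b3
  have d24 : Disjoint K2 K4 := (ball_disjoint_ball (by rw [hy]; linarith)).mono b2 b4
  have d34 : Disjoint K3 K4 := (ball_disjoint_ball (by rw [hz]; linarith)).mono b3 b4
  have f1 : volume K1 ≠ ⊤ := ((measure_mono b1).trans_lt measure_ball_lt_top).ne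
  have f2 : volume K2 ≠ ⊤ := ((measure_mono b2).trans_lt measure_ball_lt_top).ne
  have f3 : volume K3 ≠ ⊤ := ((measure_mono b3).trans_lt measure_ball_lt_top).ne
  have f4 : volume K4 ≠ ⊤ := ((measure_mono b4).trans_lt measure_ball_lt_top).ne
  have tot : volume.real (K1 ∪ K2 ∪ K3 ∪ K4) =
      volume.real K1 + volume.real K2 + volume.real K3 + volume.real K4 := by
    rw [measureReal_union (by simp [Set.disjoint_union_left, *]) m4 (by simp [f1, f2, f3]) f4,
      measureReal_union (by simp [Set.disjoint_union_left, *]) m3 (by simp [f1, f2]) f3,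
      measureReal_union d12 m2 f1 f2]
  unfold density
  change _ ≤ volume.real _ / volume.real _
  rw [tv]
  have e : ∀ K : ℝ, 2 / 3 / cS * (K / V) = (2 / 3 * K) / (V * cS) := by
    intro K
    rw [div_mul_div_comm, mul_comm V]
  rw [e]
  gcongr
  have sub : K1 ∪ K2 ∪ K3 ∪ K4 ⊆ tetra A B C D ∩ (closedBall A 1 ∪ closedBall B (√2 - 1) ∪
      closedBall C (√2 - 1) ∪ closedBall D (√2 - 1)) := by
    apply Set.subset_inter
    · exact Set.union_subset (Set.union_subset (Set.union_subset s1 s2) s3) s4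
    · exact Set.union_subset_union (Set.union_subset_union (Set.union_subset_union
        (b1.trans ball_subset_closedBall) (b2.trans ball_subset_closedBall))
        (b3.trans ball_subset_closedBall)) (b4.trans ball_subset_closedBall)
  have mono := measureReal_mono (μ := volume) sub
    ((measure_mono Set.inter_subset_left).trans_lt (tetra_finite A B C D)).ne
  refine le_trans ?_ mono
  rw [tot, p1, p2, p3, p4]
  unfold Phi
  change _ ≤ 2 / 3 * 1 ^ 3 * Real.arctan (2 * V / dA0) + 2 / 3 * (√2 - 1) ^ 3 *
    Real.arctan (2 * V / dB0) + 2 / 3 * (√2 - 1) ^ 3 * Real.arctan (2 * V / dB0) +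
    2 / 3 * (√2 - 1) ^ 3 * Real.arctan (2 * V / dB0)
  linarith

theorem fmu_support (A B C D O : E3) (R : ℝ) (hR0 : 0 < R) (hR : R ≤ √2 - 1)
    (hA : dist O A = 1 + R) (hB : dist O B = (√2 - 1) + R) (hC : dist O C = (√2 - 1) + R)
    (hD : dist O D = (√2 - 1) + R) :
    FMu (dist A B) (dist A C) (dist A D) (dist B C) (dist B D) (dist C D) := by
  intro p q s t hs hp1 hp2
  have n : 0 ≤ ‖p • (A - O) + q • (B - O) + s • (C - O) + t • (D - O)‖ ^ 2 := by positivity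
  have e : ‖p • (A - O) + q • (B - O) + s • (C - O) + t • (D - O)‖ ^ 2 =
      ‖p • (A - O) + q • (B - O) + s • (C - O)‖ ^ 2 + 2 * (p * t * inner ℝ (A - O) (D - O) +
      q * t * inner ℝ (B - O) (D - O) + s * t * inner ℝ (C - O) (D - O)) +
      t ^ 2 * inner ℝ (D - O) (D - O) := by
    rw [norm_add_sq_real, ← real_inner_self_eq_norm_sq (t • (D - O))]
    simp only [inner_add_left, real_inner_smul_left, real_inner_smul_right]
    ring
  rw [e, nsq] at n
  simp only [inner_edges, dist_self, hA, hB, hC, hD] at n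
  have s2 := sq2
  have sb := sqrt2_bounds
  set r := √2 - 1 with hr
  have hr2 : r * r = 1 - 2 * r := by rw [hr]; linear_combination s2
  have ht : t = 1 - p - q - s := by linarith
  subst ht
  have k : 0 ≤ (r - R) * (2 * p * (1 - r) + 3 * r + R) := by
    apply mul_nonneg (by linarith)
    have : r < 0.4143 := by rw [hr]; linarith [sb.2]
    have : 0.4142 < r := by rw [hr]; linarith [sb.1]
    have := mul_nonneg (show 0 ≤ p + 45 / 64 by linarith) (show 0 ≤ 1 - r by linarith)
    nlinarith only [this, ‹0.4142 < r›, ‹r < 0.4143›, hR0]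
  have k2 : p * (1 + R) ^ 2 + (1 - p) * (r + R) ^ 2 ≤ 2 * p + 4 * r ^ 2 * (1 - p) := by
    have : 2 * p + 4 * r ^ 2 * (1 - p) - (p * (1 + R) ^ 2 + (1 - p) * (r + R) ^ 2) =
      (r - R) * (2 * p * (1 - r) + 3 * r + R) := by linear_combination (-p) * hr2
    linarith
  refine le_trans ?_ k2
  linear_combination n

/-- The densest FM-tetrahedron of type 1rrr is the tight one. -/
theorem densest_1rrr
    (A B C D A₀ B₀ C₀ D₀ : EuclideanSpace ℝ (Fin 3))
    (haff : AffineIndependent ℝ ![A, B, C, D])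
    (hAB : 1 + (Real.sqrt 2 - 1) ≤ dist A B)
    (hAC : 1 + (Real.sqrt 2 - 1) ≤ dist A C) (hAD : 1 + (Real.sqrt 2 - 1) ≤ dist A D)
    (hBC : 2 * (Real.sqrt 2 - 1) ≤ dist B C) (hBD : 2 * (Real.sqrt 2 - 1) ≤ dist B D)
    (hCD : 2 * (Real.sqrt 2 - 1) ≤ dist C D)
    (hsupp : ∃ O : EuclideanSpace ℝ (Fin 3), ∃ R : ℝ, 0 < R ∧ R ≤ Real.sqrt 2 - 1 ∧
      dist O A = 1 + R ∧ dist O B = (Real.sqrt 2 - 1) + R ∧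
      dist O C = (Real.sqrt 2 - 1) + R ∧ dist O D = (Real.sqrt 2 - 1) + R)
    (haff₀ : AffineIndependent ℝ ![A₀, B₀, C₀, D₀])
    (hAB₀ : dist A₀ B₀ = 1 + (Real.sqrt 2 - 1)) (hAC₀ : dist A₀ C₀ = 1 + (Real.sqrt 2 - 1))
    (hAD₀ : dist A₀ D₀ = 1 + (Real.sqrt 2 - 1))
    (hBC₀ : dist B₀ C₀ = 2 * (Real.sqrt 2 - 1)) (hBD₀ : dist B₀ D₀ = 2 * (Real.sqrt 2 - 1))
    (hCD₀ : dist C₀ D₀ = 2 * (Real.sqrt 2 - 1)) :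
    density A B C D 1 (Real.sqrt 2 - 1) (Real.sqrt 2 - 1) (Real.sqrt 2 - 1) ≤
      density A₀ B₀ C₀ D₀ 1 (Real.sqrt 2 - 1) (Real.sqrt 2 - 1) (Real.sqrt 2 - 1) := by
  obtain ⟨O, R, hR0, hR, hA, hB, hC, hD⟩ := hsupp
  rw [add_sub_cancel] at hAB hAC hAD hAB₀ hAC₀ hAD₀
  have hF := fmu_support A B C D O R hR0 hR hA hB hC hD
  have tA : ∀ X Y : E3, dist X Y ≤ dist O X + dist O Y := fun X Y => by
    rw [dist_comm O X]; exact dist_triangle X O Y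
  have hRng : Rng (dist A B) (dist A C) (dist A D) (dist B C) (dist B D) (dist C D) :=
    { al := hAB, bl := hAC, cl := hAD, xl := hBC, yl := hBD, zl := hCD
      ah := by linarith [tA A B]
      bh := by linarith [tA A C]
      ch := by linarith [tA A D]
      xh := by linarith [tA B C]
      yh := by linarith [tA B D]
      zh := by linarith [tA C D] }
  have g := gram_pos _ _ _ (li_of_aff A B C D haff)
  have g0 := gram_pos _ _ _ (li_of_aff A₀ B₀ C₀ D₀ haff₀)
  have hV := Real.sqrt_pos.mpr g
  have hV0 := Real.sqrt_pos.mpr g0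
  have hw := gram_edges A B C D
  have hw0 := gram_edges A₀ B₀ C₀ D₀
  rw [← Real.sq_sqrt g.le] at hw
  rw [← Real.sq_sqrt g0.le, hAB₀, hAC₀, hAD₀, hBC₀, hBD₀, hCD₀] at hw0
  obtain ⟨d1, d2, d3, d4, hN⟩ := num_all _ _ _ _ _ _ _ _ hRng hF hV hw hV0 hw0
  have U := upper A B C D _ hV _ _ _ _ _ _ rfl rfl rfl rfl rfl rfl hw d1 d2 d3 d4
  have L := lower A₀ B₀ C₀ D₀ _ hV0 hAB₀ hAC₀ hAD₀ hBC₀ hBD₀ hCD₀ hw0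
  refine U.trans (le_trans ?_ L)
  have hc0 : 0 ≤ cS := measureReal_nonneg
  gcongr
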